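/- Assume V⁺ ∈ L¹ and assumption (i): ℙ{V(ω,z) ≥ 0} = 1 for all z ∈ R₀ and there exists c ∈ ℝ with ℙ{V(ω,z) ≥ c} = 1 for all z ∈ R∖R₀. Fix a face A ≠ {0} of C₊, let R' = R ∩ A, and assume V⁺(·,z) ∈ L_{z,R'} for each z ∈ R'∖{0} and V⁺(·,0) ∈ L_{ẑ,R'} for some ẑ ∈ R'∖{0}. Then there exists a stochastic process {α_∞(ξ) : ξ ∈ relint A} such that ℙ-almost surely: (a) there is a positive random variable C with E[C] < ∞ such that |α_∞(ξ)| ≤ C|ξ|₁ for all ξ ∈ relint A; (b) α_∞(sξ) = sα_∞(ξ) and α_∞(ξ) + α_∞(ζ) ≥ α_∞(ξ+ζ) for all s ∈ ℝ₊ and ξ, ζ ∈ relint A (hence α_∞ is convex and continuous on relint A); (c) for every δ > 0, limsup over x ∈ G₊ ∩ A_δ with |x|₁ → ∞ of |a_∞(0,x) − α_∞(x)|/|x|₁ equals 0. Moreover, if ℙ is ergodic under {T_z : z ∈ R ∩ A}, then α_∞ is deterministic on relint A. -/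

import Mathlib

open MeasureTheory Filter Set
open scoped ENNReal NNReal Classical Topology

noncomputable section

namespace RWRP

abbrev Zd (d : ℕ) := Fin d → ℤ

variable {d : ℕ} {Ω : Type*} {Γ : Type*}

/-- Embedding of `ℤ^d` into `ℝ^d`. -/
def toR (x : Zd d) : Fin d → ℝ := fun i => (x i : ℝ)

/-- The `ℓ¹` norm on `ℝ^d`. -/
def n1 (ξ : Fin d → ℝ) : ℝ := ∑ i, |ξ i|

/-- The `ℓ¹` norm of a lattice point. -/
def n1Z (x : Zd d) : ℝ := n1 (toR x)

/-- `G₊`: the additive semigroup (ℤ₊-combinations) generated by the step set. -/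
def Gp (R : Finset (Zd d)) : Set (Zd d) := {x | ∃ b : Zd d → ℕ, x = ∑ z ∈ R, b z • z}

/-- `G(R')`: the additive group (ℤ-combinations) generated by `R'`. -/
def GZ (R : Finset (Zd d)) : Set (Zd d) := {x | ∃ b : Zd d → ℤ, x = ∑ z ∈ R, b z • z}

/-- ℤ₊-combinations of elements of a set of lattice points. -/
def GpS (S : Set (Zd d)) : Set (Zd d) :=
  {x | ∃ (m : ℕ) (c : Fin m → Zd d), (∀ i, c i ∈ S) ∧ x = ∑ i, c i}

/-- `C₊`: the real cone generated by the step set. -/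
def Cp (R : Finset (Zd d)) : Set (Fin d → ℝ) :=
  {ξ | ∃ b : Zd d → ℝ, (∀ z, 0 ≤ b z) ∧ ξ = ∑ z ∈ R, b z • toR z}

/-- `C'₊`: the rational cone generated by the step set. -/
def CpQ (R : Finset (Zd d)) : Set (Fin d → ℝ) :=
  {ξ | ∃ b : Zd d → ℚ, (∀ z, 0 ≤ b z) ∧ ξ = ∑ z ∈ R, (b z : ℝ) • toR z}

/-- `A` is a face of the convex set `K`. -/
def IsFace (K A : Set (Fin d → ℝ)) : Prop :=
  A ⊆ K ∧ Convex ℝ A ∧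
    ∀ ⦃ξ ζ η : Fin d → ℝ⦄ ⦃t : ℝ⦄, ξ ∈ A → ζ ∈ K → η ∈ K → t ∈ Set.Ioo (0:ℝ) 1 →
      ξ = t • ζ + (1 - t) • η → ζ ∈ A ∧ η ∈ A

/-- `U`: the convex hull of the step set. -/
def hullU (R : Finset (Zd d)) : Set (Fin d → ℝ) := convexHull ℝ (toR '' (R : Set (Zd d)))

/-- `U₀` is the face of `U` containing `0` in its relative interior (the empty set if `0 ∉ U`). -/
def IsZeroFace (R : Finset (Zd d)) (U₀ : Set (Fin d → ℝ)) : Prop :=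
  ((0 : Fin d → ℝ) ∈ hullU R ∧ IsFace (hullU R) U₀ ∧
    (0 : Fin d → ℝ) ∈ intrinsicInterior ℝ U₀) ∨
  ((0 : Fin d → ℝ) ∉ hullU R ∧ U₀ = ∅)

/-- `R₀ = R ∩ U₀`. -/
def R0 (R : Finset (Zd d)) (U₀ : Set (Fin d → ℝ)) : Set (Zd d) := {z | z ∈ R ∧ toR z ∈ U₀}

/-- `A_δ`: the directions in the face `A` at ℓ¹ distance `≥ δ` (after normalization) from the
relative boundary of `A`. -/
def faceDelta (A : Set (Fin d → ℝ)) (δ : ℝ) : Set (Fin d → ℝ) :=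
  {ξ | ξ ∈ A ∧ ξ ≠ 0 ∧
    ENNReal.ofReal δ ≤ ⨅ (η : Fin d → ℝ) (_ : η ∈ A \ intrinsicInterior ℝ A),
      ENNReal.ofReal (n1 ((n1 ξ)⁻¹ • ξ - η))}

/-- `U'_δ = {ξ ∈ U' : dist(ξ, U' ∖ relint Uall) ≥ δ}`. -/
def faceDeltaU (Uall U' : Set (Fin d → ℝ)) (δ : ℝ) : Set (Fin d → ℝ) :=
  {ξ | ξ ∈ U' ∧
    ENNReal.ofReal δ ≤ ⨅ (η : Fin d → ℝ) (_ : η ∈ U' \ intrinsicInterior ℝ Uall),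
      ENNReal.ofReal (n1 (ξ - η))}

/-- `D_n`: points reachable in exactly `n` admissible steps (counted with multiplicities). -/
def Dn (R : Finset (Zd d)) (n : ℕ) : Set (Zd d) :=
  {x | ∃ b : Zd d → ℕ, (∑ z ∈ R, b z) = n ∧ x = ∑ z ∈ R, b z • z}

/-- Position after `k` steps of the path with increments `f`, started at `x`. -/
def pos (x : Zd d) (f : ℕ → Zd d) (k : ℕ) : Zd d := x + ∑ i ∈ Finset.range k, f i

/-- Convert a finite tuple of admissible steps to an increment sequence. -/
def stepF {R : Finset (Zd d)} (n : ℕ) (s : Fin n → {z : Zd d // z ∈ R}) : ℕ → Zd d :=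
  fun i => if h : i < n then (s ⟨i, h⟩ : Zd d) else 0

/-- The path started at `x` with increments `f` hits `y` for the first time (after time `0`)
at time `n`. -/
def firstHit (x y : Zd d) (n : ℕ) (f : ℕ → Zd d) : Prop :=
  pos x f n = y ∧ ∀ k ∈ Finset.Ioo 0 n, pos x f k ≠ y

/-- Probability weight of a tuple of steps under the random walk kernel `p`. -/
def pathW (p : Zd d → ℝ) {R : Finset (Zd d)} {n : ℕ} (s : Fin n → {z : Zd d // z ∈ R}) : ℝ≥0∞ :=
  ∏ i, ENNReal.ofReal (p (s i : Zd d))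

/-- Total potential collected along the first `n` steps of a path. -/
def pathV (T : Zd d → Ω → Ω) (V : Ω → Zd d → ℝ) (ω : Ω) (x : Zd d) (n : ℕ)
    (f : ℕ → Zd d) : ℝ :=
  ∑ i ∈ Finset.range n, V (T (pos x f i) ω) (f i)

/-- `E_x[exp(-∑_{k<τ_y} V(T_{X_k}ω, Z_{k+1})) 1{τ_y < ∞}]`, as a sum over killed paths. -/
def walkK (T : Zd d → Ω → Ω) (V : Ω → Zd d → ℝ) (p : Zd d → ℝ) (R : Finset (Zd d))
    (ω : Ω) (x y : Zd d) : ℝ≥0∞ :=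
  ∑' n : ℕ, ∑ s : Fin (n+1) → {z : Zd d // z ∈ R},
    if firstHit x y (n+1) (stepF (n+1) s) then
      pathW p s * ENNReal.ofReal (Real.exp (-(pathV T V ω x (n+1) (stepF (n+1) s))))
    else 0

/-- The point-to-point quantity `a(ω,x,y)` (real-valued version, with junk values where the
underlying expectation is `0` or `∞`). -/
def aFun (T : Zd d → Ω → Ω) (V : Ω → Zd d → ℝ) (p : Zd d → ℝ) (R : Finset (Zd d))
    (ω : Ω) (x y : Zd d) : ℝ :=
  if y = x then 0 else - Real.log ((walkK T V p R ω x y).toReal)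

/-- The point-to-point quantity `a(ω,x,y)` with values in `[-∞,∞]`. -/
def aE (T : Zd d → Ω → Ω) (V : Ω → Zd d → ℝ) (p : Zd d → ℝ) (R : Finset (Zd d))
    (ω : Ω) (x y : Zd d) : EReal :=
  if y = x then (0 : EReal) else - (ENNReal.log (walkK T V p R ω x y))

/-- The zero-temperature quantity `a_∞(ω,x,y)`: the infimum of the total potential over
admissible paths from `x` to `y` that hit `y` for the first time at their last step. -/
def aInf (T : Zd d → Ω → Ω) (V : Ω → Zd d → ℝ) (R : Finset (Zd d))
    (ω : Ω) (x y : Zd d) : ℝ :=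
  if y = x then 0 else
    sInf {v : ℝ | ∃ n : ℕ, ∃ s : Fin (n+1) → {z : Zd d // z ∈ R},
      firstHit x y (n+1) (stepF (n+1) s) ∧ v = pathV T V ω x (n+1) (stepF (n+1) s)}

/-- The Green's function `g(ω,x,y)`, with values in `[0,∞]`. -/
def greenK (T : Zd d → Ω → Ω) (V : Ω → Zd d → ℝ) (p : Zd d → ℝ) (R : Finset (Zd d))
    (ω : Ω) (x y : Zd d) : ℝ≥0∞ :=
  (if y = x then 1 else 0) +
  ∑' n : ℕ, ∑ s : Fin (n+1) → {z : Zd d // z ∈ R},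
    if pos x (stepF (n+1) s) (n+1) = y then
      pathW p s * ENNReal.ofReal (Real.exp (-(pathV T V ω x (n+1) (stepF (n+1) s))))
    else 0

/-- `E_x[exp(-∑_{k<n} V) 1{X_n = y}]`: the restricted-length partition function. -/
def resK (T : Zd d → Ω → Ω) (V : Ω → Zd d → ℝ) (p : Zd d → ℝ) (R : Finset (Zd d))
    (ω : Ω) (n : ℕ) (x y : Zd d) : ℝ≥0∞ :=
  ∑ s : Fin n → {z : Zd d // z ∈ R},
    if pos x (stepF n s) n = y then
      pathW p s * ENNReal.ofReal (Real.exp (-(pathV T V ω x n (stepF n s))))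
    else 0

/-- `G_{x,(n),y} = log E_x[exp(-∑_{k<n} V) 1{X_n = y}]`. -/
def GRes (T : Zd d → Ω → Ω) (V : Ω → Zd d → ℝ) (p : Zd d → ℝ) (R : Finset (Zd d))
    (ω : Ω) (n : ℕ) (x y : Zd d) : ℝ :=
  Real.log ((resK T V p R ω n x y).toReal)

/-- The return probability `P₀(τ₀ < ∞)` of the reference walk. -/
def retP (p : Zd d → ℝ) (R : Finset (Zd d)) : ℝ≥0∞ :=
  ∑' n : ℕ, ∑ s : Fin (n+1) → {z : Zd d // z ∈ R},
    if firstHit (0 : Zd d) 0 (n+1) (stepF (n+1) s) then pathW p s else 0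

/-- `R_ε`: the ℓ¹-distance from the origin to the nearest point `x` of `G₊(S)` with
`V(T_x ω, z) ≥ ε` for some `z ∈ S`, as an element of `[0,∞]`. -/
def Reps (T : Zd d → Ω → Ω) (V : Ω → Zd d → ℝ) (S : Set (Zd d)) (ε : ℝ) (ω : Ω) : ℝ≥0∞ :=
  ⨅ (x : Zd d) (_ : x ∈ GpS S ∧ ∃ z ∈ S, ε ≤ V (T x ω) z), ENNReal.ofReal (n1Z x)

/-- The shift maps on a product space. -/
def shiftT (z : Zd d) (ω : Zd d → Γ) : Zd d → Γ := fun y => ω (z + y)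

/-- A function is locally Lipschitz (w.r.t. the ℓ¹ norm) on a set. -/
def LocLipOn (f : (Fin d → ℝ) → ℝ) (S : Set (Fin d → ℝ)) : Prop :=
  ∀ ξ ∈ S, ∃ K ε : ℝ, 0 < ε ∧ ∀ x ∈ S, ∀ y ∈ S,
    n1 (x - ξ) < ε → n1 (y - ξ) < ε → |f x - f y| ≤ K * n1 (x - y)

section measurable

variable [MeasurableSpace Ω]

/-- The σ-algebra of measurable sets invariant under the shifts `{T_z : z ∈ S}`. -/
def invSigma (T : Zd d → Ω → Ω) (S : Set (Zd d)) : MeasurableSpace Ω where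
  MeasurableSet' A := MeasurableSet A ∧ ∀ z ∈ S, T z ⁻¹' A = A
  measurableSet_empty := ⟨MeasurableSet.empty, fun _ _ => by simp⟩
  measurableSet_compl A hA := ⟨hA.1.compl, fun z hz => by
    rw [Set.preimage_compl, hA.2 z hz]⟩
  measurableSet_iUnion f hf := ⟨MeasurableSet.iUnion fun i => (hf i).1, fun z hz => by
    rw [Set.preimage_iUnion]
    exact Set.iUnion_congr fun i => (hf i).2 z hz⟩

/-- `ℙ` is ergodic under the shifts `{T_z : z ∈ S}`. -/
def ErgodicUnder (ℙ : Measure Ω) (T : Zd d → Ω → Ω) (S : Set (Zd d)) : Prop :=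
  ∀ A : Set Ω, MeasurableSet A → (∀ z ∈ S, T z ⁻¹' A = A) → ℙ A = 0 ∨ ℙ A = 1

/-- The class `𝓛_{z,R'}`. -/
def classL (ℙ : Measure Ω) (T : Zd d → Ω → Ω) (g : Ω → ℝ) (z : Zd d)
    (R' : Finset (Zd d)) : Prop :=
  ∀ᵐ ω ∂ℙ,
    (⨅ ε : {e : ℝ // 0 < e},
      Filter.limsup (fun n : ℕ =>
        ⨆ (x : Zd d) (_ : x ∈ Gp R' ∧ n1Z x ≤ n),
          (n : ℝ≥0∞)⁻¹ *
            ∑ k ∈ Finset.range (⌊(ε : ℝ) * n⌋₊ + 1), ENNReal.ofReal (g (T (x + k • z) ω)))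
        Filter.atTop) = 0

/-- Extended conditional expectation, with values in `[-∞,∞]`: the decreasing limit of the
conditional expectations of the truncations `max f (-n)`.  It agrees a.s. with the usual
conditional expectation in `[-∞,∞)` whenever `f⁺` is integrable. -/
def condExpE (ℙ : Measure Ω) (m : MeasurableSpace Ω) (f : Ω → ℝ) : Ω → EReal :=
  fun ω => ⨅ n : ℕ, ((MeasureTheory.condExp m ℙ (fun ω' => max (f ω') (-(n : ℝ))) ω : ℝ) : EReal)

/-- `EReal → ℝ≥0∞`, sending `[-∞,0]` to `0` and `⊤` to `⊤`. -/
def erealToENN (x : EReal) : ℝ≥0∞ := if x = ⊤ then ⊤ else ENNReal.ofReal x.toReal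

/-- `ᾱ(x) = inf_{n ≥ 1} (1/n) E[a(0,nx) | I_x]`, with `ᾱ(0) = 0`. -/
def alphaBar (ℙ : Measure Ω) (T : Zd d → Ω → Ω) (V : Ω → Zd d → ℝ) (p : Zd d → ℝ)
    (R : Finset (Zd d)) (x : Zd d) : Ω → EReal :=
  fun ω =>
    if x = 0 then 0 else
    ⨅ n : {m : ℕ // 0 < m},
      (((n : ℕ) : ℝ)⁻¹ : EReal) *
        condExpE ℙ (invSigma T {x}) (fun ω' => aFun T V p R ω' 0 ((n : ℕ) • x)) ω

/-- `x̂_t(ξ) = ∑_z ⌊tγ_z⌋ z`. -/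
def xhat (R : Finset (Zd d)) (γ : Zd d → ℝ) (t : ℝ) : Zd d := ∑ z ∈ R, ⌊t * γ z⌋ • z

/-- `tilde-α(ξ) = inf_{t ∈ ℚ, t>0} (1/t) E[a(0, x̂_t(ξ)) | 𝔖]`, where `𝔖` is the σ-algebra of
sets invariant under the shifts from `S`. -/
def tAlpha (ℙ : Measure Ω) (T : Zd d → Ω → Ω) (V : Ω → Zd d → ℝ) (p : Zd d → ℝ)
    (R : Finset (Zd d)) (S : Set (Zd d)) (γ : Zd d → ℝ) : Ω → EReal :=
  fun ω => ⨅ t : {q : ℚ // 0 < q},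
    ((((t : ℚ) : ℝ))⁻¹ : EReal) *
      condExpE ℙ (invSigma T S) (fun ω' => aFun T V p R ω' 0 (xhat R γ ((t : ℚ) : ℝ))) ω

/-- The σ-algebra `𝔖_ξ` of sets invariant under the shifts from `R_ξ = R ∩ C_ξ`. -/
def Sface (T : Zd d → Ω → Ω) (R : Finset (Zd d))
    (Cface : (Fin d → ℝ) → Set (Fin d → ℝ)) (ξ : Fin d → ℝ) : MeasurableSpace Ω :=
  invSigma T {z | z ∈ R ∧ toR z ∈ Cface ξ}

/-- `tilde-α` as a function of the direction `ξ`, given a choice `Cface` of the face `C_ξ`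
and a choice `γfun` of cone coefficients. -/
def tAlphaF (ℙ : Measure Ω) (T : Zd d → Ω → Ω) (V : Ω → Zd d → ℝ) (p : Zd d → ℝ)
    (R : Finset (Zd d)) (Cface : (Fin d → ℝ) → Set (Fin d → ℝ))
    (γfun : (Fin d → ℝ) → Zd d → ℝ) (ξ : Fin d → ℝ) : Ω → EReal :=
  fun ω => if ξ = 0 then 0 else tAlpha ℙ T V p R {z | z ∈ R ∧ toR z ∈ Cface ξ} (γfun ξ) ω

/-- `B` is an `L¹` covariant cocycle on the group generated by the allowed steps. -/
def IsCocycle (ℙ : Measure Ω) (T : Zd d → Ω → Ω) (S : Set (Zd d))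
    (B : Ω → Zd d → Zd d → ℝ) : Prop :=
  (∀ x y : Zd d, Measurable fun ω => B ω x y) ∧
  (∀ x ∈ S, ∀ y ∈ S, Integrable (fun ω => B ω x y) ℙ) ∧
  (∀ᵐ ω ∂ℙ, ∀ x ∈ S, ∀ y ∈ S, ∀ z ∈ S, B ω x y + B ω y z = B ω x z) ∧
  (∀ᵐ ω ∂ℙ, ∀ x ∈ S, ∀ y ∈ S, ∀ z ∈ S, B ω (x + z) (y + z) = B (T z ω) x y)

/-- The class `K⁺_A(V)` of centered cocycles. -/
def InKplus (ℙ : Measure Ω) (T : Zd d → Ω → Ω) (V : Ω → Zd d → ℝ) (p : Zd d → ℝ)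
    (R' : Finset (Zd d)) (B : Ω → Zd d → Zd d → ℝ) : Prop :=
  IsCocycle ℙ T (GZ R') B ∧
  ∀ᵐ ω ∂ℙ, ∑ z ∈ R', p z * Real.exp (-(V ω z) - B ω 0 z) ≤ 1

/-- The standing setting: shifts, stationary `ℙ`, finite step set, measurable potential,
random walk kernel. -/
def Setting (ℙ : Measure Ω) (T : Zd d → Ω → Ω) (R : Finset (Zd d))
    (V : Ω → Zd d → ℝ) (p : Zd d → ℝ) : Prop :=
  (∀ z : Zd d, Measurable (T z)) ∧ T 0 = id ∧ (∀ x y : Zd d, T (x + y) = T x ∘ T y) ∧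
  (∀ z : Zd d, MeasurePreserving (T z) ℙ ℙ) ∧ 2 ≤ R.card ∧
  (∀ z : Zd d, Measurable fun ω => V ω z) ∧
  (∀ z ∈ R, 0 < p z ∧ p z < 1) ∧ ∑ z ∈ R, p z = 1

/-- `V⁺ ∈ L¹`. -/
def VplusL1 (ℙ : Measure Ω) (V : Ω → Zd d → ℝ) (R : Finset (Zd d)) : Prop :=
  ∀ z ∈ R, Integrable (fun ω => max (V ω z) 0) ℙ

/-- Assumption (i): `V ≥ 0` a.s. on `R₀` and `V ≥ c` a.s. on `R ∖ R₀`. -/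
def AssumptionI (ℙ : Measure Ω) (V : Ω → Zd d → ℝ) (R : Finset (Zd d))
    (U₀ : Set (Fin d → ℝ)) : Prop :=
  (∀ z ∈ R0 R U₀, ∀ᵐ ω ∂ℙ, 0 ≤ V ω z) ∧
  ∃ c : ℝ, ∀ z ∈ R, toR z ∉ U₀ → ∀ᵐ ω ∂ℙ, c ≤ V ω z

end measurable

end RWRP


set_option linter.unusedSectionVars false
set_option linter.unusedVariables false
set_option linter.unusedSimpArgs false
set_option linter.deprecated false

namespace RWRPX
open RWRP
section det
variable {J : Type*} [Fintype J]

def Reg (w : (J → ℕ) → ℝ) : Prop :=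
  ∀ η > (0:ℝ), ∃ ε > (0:ℝ), ∃ N : ℝ, ∀ t ≥ N, ∀ b b' : J → ℕ, b ≤ b' →
    (∑ j, (b' j : ℝ)) ≤ t → (∑ j, ((b' j : ℝ) - b j)) ≤ ε * t → w b' ≤ w b + η * t

def fl (β : J → ℝ) (t : ℝ) : J → ℕ := fun j => ⌊t * β j⌋₊

def LSP (w : (J → ℕ) → ℝ) (β : J → ℝ) (a : ℝ) : Prop :=
  ∀ η > (0:ℝ), ∃ ε > (0:ℝ), ∃ N : ℝ, ∀ t ≥ N, ∀ b : J → ℕ,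
    (∀ j, |(b j : ℝ) - t * β j| ≤ ε * t) → |w b - t * a| ≤ η * t

lemma reg_lin {w : (J → ℕ) → ℝ} (hR : Reg w) (h0 : w 0 = 0) :
    ∃ C : ℝ, 0 ≤ C ∧ ∃ N : ℝ, ∀ t ≥ N, ∀ b : J → ℕ, (∑ j, (b j : ℝ)) ≤ t → w b ≤ C * t := by
  obtain ⟨ε, hε, N, hN⟩ := hR 1 one_pos
  obtain ⟨k, hk⟩ := exists_nat_gt (2 / ε)
  have hk0 : (0:ℝ) < k := lt_trans (by positivity) hk
  refine ⟨k, hk0.le, max N (max 1 (2 * Fintype.card J / ε)), ?_⟩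
  intro t ht b hb
  have ht1 : N ≤ t := le_trans (le_max_left _ _) ht
  have ht2 : 1 ≤ t := le_trans (le_trans (le_max_left _ _) (le_max_right _ _)) ht
  have ht3 : 2 * Fintype.card J / ε ≤ t :=
    le_trans (le_trans (le_max_right _ _) (le_max_right _ _)) ht
  have hkn : 0 < k := by exact_mod_cast hk0
  have key : ∀ i : ℕ, i ≤ k → w (fun j => i * b j / k) ≤ i * t := by
    intro i
    induction i with
    | zero => 
      intro _
      have : (fun j : J => 0 * b j / k) = (0 : J → ℕ) := by ext j; simp
      rw [this, h0]; simp
    | succ i ih =>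
      intro hi
      have h1 := ih (by omega)
      have h2 := hN t ht1 (fun j => i * b j / k) (fun j => (i+1) * b j / k) ?_ ?_ ?_
      · push_cast
        linarith
      · intro j
        apply Nat.div_le_div_right
        nlinarith
      · refine le_trans (Finset.sum_le_sum fun j _ => ?_) hb
        have : (i+1) * b j / k ≤ b j := by
          apply Nat.div_le_of_le_mul
          exact Nat.mul_le_mul_right _ hi
        exact_mod_cast this
      · have hj : ∀ j : J, ((((i+1) * b j / k : ℕ) : ℝ) - ((i * b j / k : ℕ) : ℝ)) ≤ b j / k + 1 := by
          intro j
          have e1 : (((i+1) * b j / k : ℕ) : ℝ) ≤ (((i+1) * b j : ℕ) : ℝ) / k := Nat.cast_div_le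
          have e2 : ((i * b j : ℕ) : ℝ) / k < ((i * b j / k : ℕ) : ℝ) + 1 := by
            rw [div_lt_iff₀ hk0]
            have := Nat.lt_mul_div_succ (i * b j) hkn
            have h3 : i * b j < (i * b j / k + 1) * k := by rw [mul_comm _ k]; exact this
            exact_mod_cast h3
          push_cast at e1 e2
          have e3 : ((i:ℝ) + 1) * b j / k = i * b j / k + b j / k := by ring
          linarith
        refine le_trans (Finset.sum_le_sum fun j _ => hj j) ?_
        rw [Finset.sum_add_distrib, ← Finset.sum_div]
        simp only [Finset.sum_const, Finset.card_univ, nsmul_eq_mul, mul_one]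
        have e4 : (∑ j, (b j : ℝ)) / k ≤ ε * t / 2 := by
          rw [div_le_iff₀ hk0]
          have : 2 < k * ε := by rwa [div_lt_iff₀ hε] at hk
          nlinarith
        have e5 : (Fintype.card J : ℝ) ≤ ε * t / 2 := by
          rw [div_le_iff₀ hε] at ht3; linarith
        linarith
  have := key k le_rfl
  have e : (fun j => k * b j / k) = b := by
    ext j; exact Nat.mul_div_cancel_left _ hkn
  rwa [e] at this

lemma exists_lower (β : J → ℝ) (hβ : ∀ j, 0 < β j) : ∃ m > (0:ℝ), ∀ j, m ≤ β j := by
  by_cases hJ : Nonempty J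
  · obtain ⟨j, hj⟩ := Finite.exists_min β
    exact ⟨β j, hβ j, hj⟩
  · exact ⟨1, one_pos, fun j => (hJ ⟨j⟩).elim⟩

set_option maxHeartbeats 1600000 in
lemma lsp_claim {w : (J → ℕ) → ℝ} (hR : Reg w) (h0 : w 0 = 0) {K : ℝ}
    (hlow : ∀ b, -(K * ∑ j, (b j : ℝ)) ≤ w b)
    (hrat : ∀ b : J → ℕ, ∃ a : ℝ, Tendsto (fun n : ℕ => w (n • b) / n) atTop (𝓝 a))
    (β : J → ℝ) (hβ : ∀ j, 0 < β j) (η : ℝ) (hη : 0 < η) :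
    ∃ a : ℝ, ∃ ε > (0:ℝ), ∃ N : ℝ, ∀ t ≥ N, ∀ b : J → ℕ,
    (∀ j, |(b j : ℝ) - t * β j| ≤ ε * t) → |w b - t * a| ≤ η * t := by
  obtain ⟨C0, hC0, N1, hN1⟩ := reg_lin hR h0
  obtain ⟨m, hm, hmβ⟩ := exists_lower β hβ
  set B := ∑ j, β j with hB
  have hB0 : 0 ≤ B := Finset.sum_nonneg fun j _ => (hβ j).le
  set C := max C0 |K| with hC
  have hCC : 0 ≤ C := le_trans hC0 (le_max_left _ _)
  have hlin : ∀ t ≥ max N1 0, ∀ b : J → ℕ, (∑ j, (b j : ℝ)) ≤ t → |w b| ≤ C * t := by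
    intro t ht b hb
    have ht0 : 0 ≤ t := le_trans (le_max_right _ _) ht
    have hs : 0 ≤ ∑ j, (b j : ℝ) := Finset.sum_nonneg fun j _ => Nat.cast_nonneg _
    rw [abs_le]
    constructor
    · have h1 := hlow b
      have h2 : K * ∑ j, (b j : ℝ) ≤ C * t := by
        calc K * ∑ j, (b j : ℝ) ≤ |K| * ∑ j, (b j : ℝ) :=
              mul_le_mul_of_nonneg_right (le_abs_self K) hs
          _ ≤ C * t := mul_le_mul (le_max_right _ _) hb hs hCC
      linarith
    · have h1 := hN1 t (le_trans (le_max_left _ _) ht) b hb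
      have h2 : C0 * t ≤ C * t := mul_le_mul_of_nonneg_right (le_max_left _ _) ht0
      linarith
  set D := 3 * B + 1 with hD
  have hD1 : 1 ≤ D := by linarith
  have hD0 : 0 < D := by linarith
  obtain ⟨ε0, hε0, N0, hN0⟩ := hR (η / (4 * D)) (by positivity)
  set A := C * (B + 1) with hA
  have hA0 : 0 ≤ A := by positivity
  obtain ⟨θ, hθ, hθ2, hθε, hθA⟩ : ∃ θ > (0:ℝ), θ ≤ 1/2 ∧ θ ≤ ε0 / 2 ∧ θ * A ≤ η / 8 := by
    refine ⟨min (1/2) (min (ε0/2) (η / (8 * (A + 1)))), by positivity, min_le_left _ _,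
      le_trans (min_le_right _ _) (min_le_left _ _), ?_⟩
    have h1 : min (1/2) (min (ε0/2) (η / (8 * (A + 1)))) ≤ η / (8 * (A + 1)) :=
      le_trans (min_le_right _ _) (min_le_right _ _)
    refine le_trans (mul_le_mul_of_nonneg_right h1 hA0) ?_
    rw [div_mul_eq_mul_div, div_le_div_iff₀ (by positivity) (by norm_num)]
    nlinarith
  obtain ⟨q, hq⟩ := exists_nat_gt (8 / (θ * m))
  have hq0 : (0:ℝ) < q := lt_trans (by positivity) hq
  have hqm : 8 < q * (θ * m) := by rwa [div_lt_iff₀ (by positivity)] at hq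
  set b0 : J → ℕ := fl β q with hb0
  have hb0le : ∀ j, (b0 j : ℝ) ≤ q * β j := fun j => Nat.floor_le (by have := hβ j; positivity)
  have hb0ge : ∀ j, (q : ℝ) * β j < b0 j + 1 := fun j => Nat.lt_floor_add_one _
  have hb0s : ∑ j, (b0 j : ℝ) ≤ q * B := by
    rw [hB, Finset.mul_sum]; exact Finset.sum_le_sum fun j _ => hb0le j
  obtain ⟨a0, ha0⟩ := hrat b0
  have ha0b : |a0| ≤ q * A := by
    have h1 : Tendsto (fun n : ℕ => |w (n • b0) / n|) atTop (𝓝 |a0|) := ha0.abs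
    refine le_of_tendsto h1 ?_
    obtain ⟨M, hM⟩ := exists_nat_gt (max N1 0)
    filter_upwards [eventually_ge_atTop (max M 1)] with n hn
    have hn1 : (1:ℝ) ≤ n := by exact_mod_cast le_trans (le_max_right _ _) hn
    have hnM : (M:ℝ) ≤ n := by exact_mod_cast le_trans (le_max_left _ _) hn
    have hq1 : (1:ℝ) ≤ q := by
      have : 0 < q := by exact_mod_cast hq0
      exact_mod_cast this
    have hbig : (n:ℝ) ≤ n * (q * (B+1)) := by
      have : 1 ≤ (q:ℝ) * (B+1) := by nlinarith
      nlinarith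
    have h2 := hlin (n * (q * (B+1))) (by linarith) (n • b0) (by
      simp only [Pi.smul_apply, smul_eq_mul, Nat.cast_mul]
      rw [← Finset.mul_sum]
      refine mul_le_mul_of_nonneg_left ?_ (by positivity)
      linarith)
    rw [abs_div, Nat.abs_cast, div_le_iff₀ (by linarith)]
    refine le_trans h2 (le_of_eq ?_)
    rw [hA]; ring
  set a := a0 / q with ha
  have haA : |a| ≤ A := by
    rw [ha, abs_div, Nat.abs_cast, div_le_iff₀ hq0]; linarith
  have haq : a0 = q * a := by rw [ha]; field_simp
  obtain ⟨N2, hN2⟩ : ∃ N2 : ℕ, ∀ k ≥ N2, |w (k • b0) - k * a0| ≤ (q * η / 24) * k := by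
    have h1 := Metric.tendsto_atTop.1 ha0 (q * η / 24) (by positivity)
    obtain ⟨N2, h⟩ := h1
    refine ⟨max N2 1, fun k hk => ?_⟩
    have hk1 : (1:ℝ) ≤ k := by exact_mod_cast le_trans (le_max_right _ _) hk
    have h2 := h k (le_trans (le_max_left _ _) hk)
    rw [Real.dist_eq] at h2
    have h3 : w (k • b0) - k * a0 = (w (k • b0) / k - a0) * k := by field_simp
    rw [h3, abs_mul, Nat.abs_cast]
    exact mul_le_mul_of_nonneg_right h2.le (by linarith)
  refine ⟨a, θ * m / 2, by positivity, max (max (max N0 0) (2 * q * (N2 + 1)))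
    (max q (max (4 * q * B / (ε0 * D)) (8 * q * A / η))), ?_⟩
  intro t ht b hb
  have ht1 : N0 ≤ t := le_trans (by simp) ht
  have ht0 : 0 ≤ t := le_trans (by simp) ht
  have ht2 : 2 * q * (N2 + 1) ≤ t := le_trans (by simp) ht
  have ht3 : (q:ℝ) ≤ t := le_trans (by simp) ht
  have ht4 : 4 * q * B / (ε0 * D) ≤ t := le_trans (by simp) ht
  have ht5 : 8 * q * A / η ≤ t := le_trans (by simp) ht
  rw [div_le_iff₀ (by positivity)] at ht4 ht5
  have ht00 : 0 < t := by linarith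
  have htθ : t * θ ≤ t * (1/2) := mul_le_mul_of_nonneg_left hθ2 ht0
  have htθ0 : 0 ≤ t * θ := by positivity
  set k1 := ⌊t * (1 - θ) / q⌋₊ with hk1
  set k2 := ⌈t * (1 + θ) / q⌉₊ with hk2
  have hk1nn : 0 ≤ t * (1 - θ) / q := div_nonneg (mul_nonneg ht0 (by linarith)) hq0.le
  have hk1le : (k1 : ℝ) * q ≤ t * (1 - θ) := by
    have := Nat.floor_le hk1nn
    rwa [le_div_iff₀ hq0] at this
  have hk1ge : t * (1 - θ) < (k1 + 1 : ℝ) * q := by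
    have := Nat.lt_floor_add_one (t * (1 - θ) / q)
    rwa [div_lt_iff₀ hq0] at this
  have hk2ge : t * (1 + θ) ≤ (k2 : ℝ) * q := by
    have := Nat.le_ceil (t * (1 + θ) / q)
    rwa [div_le_iff₀ hq0] at this
  have hk2le : (k2 : ℝ) * q < t * (1 + θ) + q := by
    have := Nat.ceil_lt_add_one (show 0 ≤ t * (1 + θ) / q by positivity)
    have h2 : (k2:ℝ) * q < (t * (1 + θ) / q + 1) * q := mul_lt_mul_of_pos_right this hq0
    have h3 : (t * (1 + θ) / q + 1) * q = t * (1 + θ) + q := by field_simp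
    linarith
  have hk1N : N2 ≤ k1 := by
    have h2 : (N2 + 1 : ℝ) * q < (k1 + 1 : ℝ) * q := by linarith
    have h3 : (N2 + 1 : ℝ) < k1 + 1 := lt_of_mul_lt_mul_right h2 hq0.le
    have h4 : N2 + 1 < k1 + 1 := by exact_mod_cast h3
    omega
  have hk2N : N2 ≤ k2 := by
    have h2 : (N2 : ℝ) * q ≤ k2 * q := by linarith
    exact_mod_cast le_of_mul_le_mul_right h2 hq0
  have hle1 : k1 • b0 ≤ b := by
    intro j
    have h1 : (k1 : ℝ) * b0 j ≤ b j := by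
      have h2 := (abs_le.1 (hb j)).1
      have h3 : (k1 : ℝ) * b0 j ≤ k1 * (q * β j) :=
        mul_le_mul_of_nonneg_left (hb0le j) (Nat.cast_nonneg _)
      have h4 : (k1 : ℝ) * (q * β j) ≤ t * (1 - θ) * β j := by
        rw [← mul_assoc]; exact mul_le_mul_of_nonneg_right hk1le (hβ j).le
      have h5 : t * θ * m ≤ t * θ * β j := mul_le_mul_of_nonneg_left (hmβ j) (by positivity)
      have h6 : 0 ≤ t * θ * m := by positivity
      linarith
    simp only [Pi.smul_apply, smul_eq_mul]
    exact_mod_cast h1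
  have hle2 : b ≤ k2 • b0 := by
    intro j
    have h1 : (b j : ℝ) ≤ k2 * b0 j := by
      have h2 := (abs_le.1 (hb j)).2
      have h3 : (k2 : ℝ) * (q * β j) ≤ k2 * (b0 j + 1) :=
        mul_le_mul_of_nonneg_left (hb0ge j).le (Nat.cast_nonneg _)
      have h4 : t * (1 + θ) * β j ≤ (k2 : ℝ) * q * β j :=
        mul_le_mul_of_nonneg_right hk2ge (hβ j).le
      have h5 : t * θ * m ≤ t * θ * β j := mul_le_mul_of_nonneg_left (hmβ j) (by positivity)
      have h7 : (k2:ℝ) ≤ t * θ * m / 2 := by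
        have h9 : 8 * t ≤ q * (θ * m) * t := mul_le_mul_of_nonneg_right hqm.le ht0
        have h8 : (k2:ℝ) * q ≤ (t * θ * m / 2) * q := by linarith
        exact le_of_mul_le_mul_right h8 hq0
      linarith
    simp only [Pi.smul_apply, smul_eq_mul]
    exact_mod_cast h1
  have hs2 : ∑ j, ((k2 • b0) j : ℝ) ≤ D * t := by
    simp only [Pi.smul_apply, smul_eq_mul, Nat.cast_mul]
    rw [← Finset.mul_sum]
    have h1 : (k2:ℝ) * ∑ j, (b0 j : ℝ) ≤ k2 * (q * B) :=
      mul_le_mul_of_nonneg_left hb0s (Nat.cast_nonneg _)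
    have h2 : (k2:ℝ) * (q * B) ≤ (t * (1 + θ) + q) * B := by
      rw [← mul_assoc]; exact mul_le_mul_of_nonneg_right hk2le.le hB0
    have h3 : (t * (1 + θ) + q) * B ≤ (3 * t) * B := 
      mul_le_mul_of_nonneg_right (by linarith) hB0
    linarith
  have hs1 : ∑ j, (((k2 • b0) j : ℝ) - ((k1 • b0) j : ℝ)) ≤ ε0 * (D * t) := by
    simp only [Pi.smul_apply, smul_eq_mul, Nat.cast_mul]
    rw [Finset.sum_sub_distrib, ← Finset.mul_sum, ← Finset.mul_sum, ← sub_mul]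
    have hk12 : (0:ℝ) ≤ k2 - k1 := by
      have : (k1:ℝ) * q ≤ k2 * q := by linarith
      have := le_of_mul_le_mul_right this hq0
      linarith
    have h1 : ((k2:ℝ) - k1) * ∑ j, (b0 j : ℝ) ≤ (k2 - k1) * (q * B) :=
      mul_le_mul_of_nonneg_left hb0s hk12
    have h2 : ((k2:ℝ) - k1) * (q * B) ≤ (2 * θ * t + 2 * q) * B := by
      rw [← mul_assoc]; exact mul_le_mul_of_nonneg_right (by linarith) hB0
    have h3 : 2 * θ * t * B ≤ ε0 * t * B := by
      have : 2 * θ ≤ ε0 := by linarith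
      have h : 0 ≤ t * B := by positivity
      nlinarith
    have h4 : ε0 * t * B * 2 ≤ ε0 * (D * t) := by
      have h : 0 ≤ ε0 * t := by positivity
      have h' : 0 ≤ ε0 * t * B := by positivity
      rw [hD]; linarith
    linarith
  have hDt : N0 ≤ D * t := by
    have := mul_le_mul_of_nonneg_right hD1 ht0
    linarith
  have hsb : ∑ j, (b j : ℝ) ≤ ∑ j, ((k2 • b0) j : ℝ) :=
    Finset.sum_le_sum fun j _ => by exact_mod_cast hle2 j
  have hsb1 : ∑ j, ((k1 • b0) j : ℝ) ≤ ∑ j, (b j : ℝ) :=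
    Finset.sum_le_sum fun j _ => by exact_mod_cast hle1 j
  have u1 := hN0 (D * t) hDt (k1 • b0) b hle1 (by linarith) (by
    rw [Finset.sum_sub_distrib] at hs1 ⊢; linarith)
  have u2 := hN0 (D * t) hDt b (k2 • b0) hle2 hs2 (by
    rw [Finset.sum_sub_distrib] at hs1 ⊢; linarith)
  have hηD : η / (4 * D) * (D * t) = η * t / 4 := by field_simp
  rw [hηD] at u1 u2
  have v1 := abs_le.1 (hN2 k1 hk1N)
  have v2 := abs_le.1 (hN2 k2 hk2N)
  have hk23 : (k2:ℝ) * q ≤ 3 * t := by linarith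
  have hk13 : (k1:ℝ) * q ≤ 3 * t := by linarith
  have x1 : (q * η / 24) * (k1:ℝ) ≤ η * t / 8 := by
    have := mul_le_mul_of_nonneg_left hk13 hη.le
    linarith
  have x2 : (q * η / 24) * (k2:ℝ) ≤ η * t / 8 := by
    have := mul_le_mul_of_nonneg_left hk23 hη.le
    linarith
  have y0 : (θ * t + q) * A ≤ η * t / 8 + η * t / 8 := by
    have := mul_le_mul_of_nonneg_right hθA ht0
    linarith
  have y1 : |(k1:ℝ) * a0 - t * a| ≤ (θ * t + q) * A := by
    have : (k1:ℝ) * a0 - t * a = (k1 * q - t) * a := by rw [haq]; ring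
    rw [this, abs_mul]
    refine mul_le_mul ?_ haA (abs_nonneg _) (by positivity)
    rw [abs_le]; constructor <;> linarith
  have y2 : |(k2:ℝ) * a0 - t * a| ≤ (θ * t + q) * A := by
    have : (k2:ℝ) * a0 - t * a = (k2 * q - t) * a := by rw [haq]; ring
    rw [this, abs_mul]
    refine mul_le_mul ?_ haA (abs_nonneg _) (by positivity)
    rw [abs_le]; constructor <;> linarith
  have z1 := abs_le.1 y1
  have z2 := abs_le.1 y2
  have hηt : 0 < η * t := by positivity
  rw [abs_le]
  constructor <;> linarith [v1.1, v1.2, v2.1, v2.2, z1.1, z1.2, z2.1, z2.2]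

end det
end RWRPX

namespace RWRPX
open RWRP
section det2
variable {J : Type*} [Fintype J]

def al (w : (J → ℕ) → ℝ) (β : J → ℝ) : ℝ := limsup (fun n : ℕ => w (fl β n) / n) atTop

lemma fl_tendsto (β : J → ℝ) (hβ : ∀ j, 0 ≤ β j) (j : J) :
    Tendsto (fun n : ℕ => (fl β n j : ℝ) / n) atTop (𝓝 (β j)) := by
  have h := (tendsto_nat_floor_mul_div_atTop (hβ j)).comp (tendsto_natCast_atTop_atTop (R := ℝ))
  refine h.congr fun n => ?_
  simp [fl, mul_comm]

lemma near_of_tendsto (β : J → ℝ) (bs : ℕ → J → ℕ)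
    (h : ∀ j, Tendsto (fun n : ℕ => (bs n j : ℝ) / n) atTop (𝓝 (β j))) (ε : ℝ) (hε : 0 < ε) :
    ∀ᶠ n : ℕ in atTop, ∀ j, |(bs n j : ℝ) - n * β j| ≤ ε * n := by
  rw [Filter.eventually_all]
  intro j
  filter_upwards [(Metric.tendsto_nhds.1 (h j)) ε hε, eventually_gt_atTop 0] with n hn hn0
  have hn0 : (0:ℝ) < n := by exact_mod_cast hn0
  rw [Real.dist_eq] at hn
  have e : (bs n j : ℝ) - n * β j = (bs n j / n - β j) * n := by field_simp
  rw [e, abs_mul, Nat.abs_cast]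
  exact mul_le_mul_of_nonneg_right hn.le hn0.le

lemma lsp_ev {w : (J → ℕ) → ℝ} {β : J → ℝ} {a η ε N : ℝ} (hε : 0 < ε)
    (h : ∀ t ≥ N, ∀ b : J → ℕ, (∀ j, |(b j : ℝ) - t * β j| ≤ ε * t) → |w b - t * a| ≤ η * t)
    (bs : ℕ → J → ℕ)
    (hb : ∀ᶠ n : ℕ in atTop, ∀ j, |(bs n j : ℝ) - n * β j| ≤ ε * n) :
    ∀ᶠ n : ℕ in atTop, |w (bs n) / n - a| ≤ η := by
  obtain ⟨M, hM⟩ := exists_nat_gt N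
  filter_upwards [hb, eventually_ge_atTop (max M 1)] with n hn hn1
  have h1 : (1:ℝ) ≤ n := by exact_mod_cast le_trans (le_max_right _ _) hn1
  have h2 : (M:ℝ) ≤ n := by exact_mod_cast le_trans (le_max_left _ _) hn1
  have h3 := h n (by linarith) (bs n) hn
  have e : w (bs n) / n - a = (w (bs n) - n * a) / n := by field_simp
  rw [e, abs_div, Nat.abs_cast, div_le_iff₀ (by linarith)]
  exact h3

lemma lsp_seq {w : (J → ℕ) → ℝ} {β : J → ℝ} {a : ℝ} (h : LSP w β a) (bs : ℕ → J → ℕ)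
    (hb : ∀ j, Tendsto (fun n : ℕ => (bs n j : ℝ) / n) atTop (𝓝 (β j))) :
    Tendsto (fun n : ℕ => w (bs n) / n) atTop (𝓝 a) := by
  rw [Metric.tendsto_nhds]
  intro η hη
  obtain ⟨ε, hε, N, hN⟩ := h (η / 2) (by positivity)
  filter_upwards [lsp_ev hε hN bs (near_of_tendsto β bs hb ε hε)] with n hn
  rw [Real.dist_eq]; linarith

lemma lsp_al {w : (J → ℕ) → ℝ} {β : J → ℝ} {a : ℝ} (hβ : ∀ j, 0 ≤ β j) (h : LSP w β a) :
    al w β = a :=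
  (lsp_seq h (fun n => fl β n) (fl_tendsto β hβ)).limsup_eq

lemma lsp_exists {w : (J → ℕ) → ℝ} (hR : Reg w) (h0 : w 0 = 0) {K : ℝ}
    (hlow : ∀ b, -(K * ∑ j, (b j : ℝ)) ≤ w b)
    (hrat : ∀ b : J → ℕ, ∃ a : ℝ, Tendsto (fun n : ℕ => w (n • b) / n) atTop (𝓝 a))
    (β : J → ℝ) (hβ : ∀ j, 0 < β j) : LSP w β (al w β) := by
  have hcl := lsp_claim hR h0 hlow hrat β hβ
  have hb := fl_tendsto β (fun j => (hβ j).le)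
  have hcau : CauchySeq (fun n : ℕ => w (fl β n) / n) := by
    rw [Metric.cauchySeq_iff']
    intro η hη
    obtain ⟨a, ε, hε, N, hN⟩ := hcl (η / 3) (by positivity)
    obtain ⟨M, hM⟩ := eventually_atTop.1
      (lsp_ev hε hN (fun n => fl β n) (near_of_tendsto β _ hb ε hε))
    refine ⟨M, fun n hn => ?_⟩
    have h1 := abs_le.1 (hM n hn)
    have h2 := abs_le.1 (hM M le_rfl)
    rw [Real.dist_eq, abs_lt]
    constructor <;> linarith
  obtain ⟨a, ha⟩ := cauchySeq_tendsto_of_complete hcau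
  have haa : al w β = a := ha.limsup_eq
  rw [haa]
  intro η hη
  obtain ⟨a', ε, hε, N, hN⟩ := hcl (η / 2) (by positivity)
  have hclose : |a - a'| ≤ η / 2 :=
    le_of_tendsto ((ha.sub_const a').abs)
      (lsp_ev hε hN (fun n => fl β n) (near_of_tendsto β _ hb ε hε))
  refine ⟨ε, hε, max N 0, fun t ht b hb => ?_⟩
  have ht0 : 0 ≤ t := le_trans (le_max_right _ _) ht
  have h1 := hN t (le_trans (le_max_left _ _) ht) b hb
  have e : w b - t * a = (w b - t * a') - t * (a - a') := by ring
  rw [e]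
  refine le_trans (abs_sub _ _) ?_
  rw [abs_mul, abs_of_nonneg ht0]
  have := mul_le_mul_of_nonneg_left hclose ht0
  linarith

lemma lsp_smul {w : (J → ℕ) → ℝ} {β : J → ℝ} {a s : ℝ} (hs : 0 < s) (h : LSP w β a) :
    LSP w (s • β) (s * a) := by
  intro η hη
  obtain ⟨ε, hε, N, hN⟩ := h (η / s) (by positivity)
  refine ⟨ε * s, by positivity, N / s, fun t ht b hb => ?_⟩
  have ht' : N ≤ t * s := by rwa [ge_iff_le, div_le_iff₀ hs] at ht
  have h1 := hN (t * s) ht' b (fun j => by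
    have := hb j
    simp only [Pi.smul_apply, smul_eq_mul] at this
    rw [mul_assoc]; convert this using 1; ring)
  have e : η / s * (t * s) = η * t := by field_simp
  rw [e] at h1
  convert h1 using 3
  ring

lemma lsp_cont {w : (J → ℕ) → ℝ} {β : J → ℝ} {a : ℝ} (h : LSP w β a) (η : ℝ) (hη : 0 < η) :
    ∃ ε > (0:ℝ), ∀ (β' : J → ℝ) (a' : ℝ), (∀ j, 0 ≤ β' j) → LSP w β' a' →
      (∀ j, |β' j - β j| ≤ ε) → |a' - a| ≤ η := by
  obtain ⟨ε, hε, N, hN⟩ := h η hη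
  refine ⟨ε / 2, by positivity, fun β' a' hβ' h' hb => ?_⟩
  have ht := lsp_seq h' (fun n => fl β' n) (fl_tendsto β' hβ')
  refine le_of_tendsto ((ht.sub_const a).abs) (lsp_ev hε hN _ ?_)
  filter_upwards [near_of_tendsto β' (fun n => fl β' n) (fl_tendsto β' hβ') (ε/2) (by positivity)]
    with n hn j
  have h1 := hn j
  have h2 := mul_le_mul_of_nonneg_left (hb j) (Nat.cast_nonneg (α := ℝ) n)
  have e : (fl β' n j : ℝ) - n * β j = ((fl β' n j : ℝ) - n * β' j) + n * (β' j - β j) := by ring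
  rw [e]
  refine le_trans (abs_add_le _ _) ?_
  rw [abs_mul, Nat.abs_cast]
  linarith

lemma lsp_cont_seq {w : (J → ℕ) → ℝ} {β : J → ℝ} (h : ∀ β : J → ℝ, (∀ j, 0 < β j) → LSP w β (al w β))
    (hβ : ∀ j, 0 < β j) (βs : ℕ → J → ℝ) (hs : ∀ n j, 0 < βs n j)
    (ht : Tendsto βs atTop (𝓝 β)) :
    Tendsto (fun n => al w (βs n)) atTop (𝓝 (al w β)) := by
  rw [Metric.tendsto_nhds]
  intro η hη
  obtain ⟨ε, hε, hc⟩ := lsp_cont (h β hβ) (η/2) (by positivity)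
  have : ∀ᶠ n in atTop, ∀ j, |βs n j - β j| ≤ ε := by
    rw [Filter.eventually_all]
    intro j
    filter_upwards [(Metric.tendsto_nhds.1 ((tendsto_pi_nhds.1 ht) j)) ε hε] with n hn
    rw [Real.dist_eq] at hn; exact hn.le
  filter_upwards [this] with n hn
  have := hc (βs n) _ (fun j => (hs n j).le) (h _ (hs n)) hn
  rw [Real.dist_eq]; linarith

/-- rational approximants -/
def rq (p : (J → ℕ) × ℕ) : J → ℝ := fun j => ((p.1 j : ℝ) + 1) / ((p.2 : ℝ) + 1)

def ap (β : J → ℝ) (n : ℕ) : (J → ℕ) × ℕ := (fl β (n + 1), n)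

lemma rq_pos (p : (J → ℕ) × ℕ) (j : J) : 0 < rq p j := by unfold rq; positivity

lemma ap_tendsto (β : J → ℝ) (hβ : ∀ j, 0 < β j) :
    Tendsto (fun n => rq (ap β n)) atTop (𝓝 β) := by
  rw [tendsto_pi_nhds]
  intro j
  have h1 := (tendsto_add_atTop_iff_nat 1).2 (fl_tendsto β (fun j => (hβ j).le) j)
  have h2 := tendsto_one_div_add_atTop_nhds_zero_nat (𝕜 := ℝ)
  have h3 := h1.add h2
  rw [add_zero] at h3
  refine h3.congr fun n => ?_
  simp only [rq, ap]
  push_cast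
  ring

end det2
end RWRPX

namespace RWRPX
section king
variable {Ω : Type*} [MeasurableSpace Ω] {μ : Measure Ω} [IsProbabilityMeasure μ] {τ : Ω → Ω}

def Mx (h : Ω → ℝ) (τ : Ω → Ω) : ℕ → Ω → ℝ
  | 0 => fun _ => 0
  | n+1 => fun ω => max 0 (h ω + Mx h τ n (τ ω))

lemma Mx_nonneg (h : Ω → ℝ) (τ : Ω → Ω) (n : ℕ) (ω : Ω) : 0 ≤ Mx h τ n ω := by
  cases n with
  | zero => exact le_rfl
  | succ n => exact le_max_left _ _

lemma Mx_mono (h : Ω → ℝ) (τ : Ω → Ω) (n : ℕ) : ∀ ω, Mx h τ n ω ≤ Mx h τ (n+1) ω := by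
  induction n with
  | zero => intro ω; exact le_max_left _ _
  | succ n ih =>
    intro ω
    show max 0 (h ω + Mx h τ n (τ ω)) ≤ max 0 (h ω + Mx h τ (n+1) (τ ω))
    exact max_le_max le_rfl (by have := ih (τ ω); linarith)

lemma Mx_ge (h : Ω → ℝ) (τ : Ω → Ω) (n : ℕ) :
    ∀ ω, ∑ i ∈ Finset.range n, h (τ^[i] ω) ≤ Mx h τ n ω := by
  induction n with
  | zero => intro ω; simp [Mx]
  | succ n ih =>
    intro ω
    rw [Finset.sum_range_succ']
    have := ih (τ ω)
    refine le_trans ?_ (le_max_right _ _)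
    simp only [Function.iterate_succ, Function.comp, Function.iterate_zero, id]
    linarith

lemma Mx_meas {h : Ω → ℝ} (hh : Measurable h) (hτ : Measurable τ) (n : ℕ) :
    Measurable (Mx h τ n) := by
  induction n with
  | zero => exact measurable_const
  | succ n ih => exact measurable_const.max (hh.add (ih.comp hτ))

lemma Mx_int {h : Ω → ℝ} (hi : Integrable h μ) (hτ : MeasurePreserving τ μ μ) (n : ℕ) :
    Integrable (Mx h τ n) μ := by
  induction n with
  | zero => exact integrable_zero _ _ _
  | succ n ih =>
    have : Integrable (fun ω => h ω + Mx h τ n (τ ω)) μ := hi.add (hτ.integrable_comp_of_integrable ih)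
    have h2 := this.pos_part
    refine h2.congr (Eventually.of_forall fun ω => ?_)
    simp [Mx, max_comm]

lemma hopf {h : Ω → ℝ} (hh : Measurable h) (hi : Integrable h μ) (hτ : MeasurePreserving τ μ μ)
    (n : ℕ) : 0 ≤ ∫ ω in {ω | 0 < Mx h τ (n+1) ω}, h ω ∂μ := by
  have hE : MeasurableSet {ω | 0 < Mx h τ (n+1) ω} :=
    measurableSet_lt measurable_const (Mx_meas hh hτ.measurable _)
  rw [← integral_indicator hE]
  have h1 := Mx_int hi hτ (n+1)
  have h2 : Integrable (fun ω => Mx h τ (n+1) (τ ω)) μ := hτ.integrable_comp_of_integrable h1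
  have h3 : ∫ ω, Mx h τ (n+1) (τ ω) ∂μ = ∫ ω, Mx h τ (n+1) ω ∂μ := by
    have := integral_map (μ := μ) hτ.measurable.aemeasurable (f := Mx h τ (n+1))
      (by rw [hτ.map_eq]; exact h1.aestronglyMeasurable)
    rw [hτ.map_eq] at this
    exact this.symm
  have h4 : ∫ ω, Mx h τ (n+1) ω ∂μ ≤
      ∫ ω, ({ω | 0 < Mx h τ (n+1) ω}.indicator h ω + Mx h τ (n+1) (τ ω)) ∂μ := by
    refine integral_mono h1 ((hi.indicator hE).add h2) fun ω => ?_
    by_cases hω : 0 < Mx h τ (n+1) ω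
    · have e : Mx h τ (n+1) ω = h ω + Mx h τ n (τ ω) := by
        change 0 < max 0 (h ω + Mx h τ n (τ ω)) at hω
        change max 0 (h ω + Mx h τ n (τ ω)) = _
        rcases lt_max_iff.1 hω with h | h
        · exact absurd h (lt_irrefl _)
        · exact max_eq_right h.le
      simp only [Set.indicator, Set.mem_setOf_eq, hω, if_true]
      rw [e]
      have := Mx_mono h τ n (τ ω)
      linarith
    · simp only [Set.indicator, Set.mem_setOf_eq, hω, if_false]
      have := Mx_nonneg h τ (n+1) (τ ω)
      linarith
  rw [integral_add (hi.indicator hE) h2, h3] at h4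
  linarith

lemma maximal {g : Ω → ℝ} (hg : Measurable g) (hi : Integrable g μ) (hg0 : ∀ ω, 0 ≤ g ω)
    (hτ : MeasurePreserving τ μ μ) {l : ℝ} (hl : 0 < l) :
    μ {ω | ∃ n : ℕ, l * n < ∑ i ∈ Finset.range n, g (τ^[i] ω)} ≤ ENNReal.ofReal ((∫ ω, g ω ∂μ) / l) := by
  set h : Ω → ℝ := fun ω => g ω - l with hh
  have hm : Measurable h := hg.sub_const l
  have hhi : Integrable h μ := hi.sub (integrable_const l)
  have hsub : {ω | ∃ n : ℕ, l * n < ∑ i ∈ Finset.range n, g (τ^[i] ω)} ⊆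
      ⋃ n, {ω | 0 < Mx h τ (n+1) ω} := by
    rintro ω ⟨n, hn⟩
    refine mem_iUnion.2 ⟨n, ?_⟩
    have h1 := Mx_ge h τ n ω
    have h2 := Mx_mono h τ n ω
    simp only [hh, Finset.sum_sub_distrib, Finset.sum_const, Finset.card_range, nsmul_eq_mul] at h1
    simp only [Set.mem_setOf_eq]
    have : (n:ℝ) * l = l * n := mul_comm _ _
    simp only [hh] at h2 ⊢
    linarith
  refine le_trans (measure_mono hsub) ?_
  have hmono : Monotone (fun n => {ω | 0 < Mx h τ (n+1) ω}) :=
    monotone_nat_of_le_succ fun n ω hω => lt_of_lt_of_le hω (Mx_mono h τ (n+1) ω)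
  rw [hmono.measure_iUnion]
  refine iSup_le fun n => ?_
  have hE : MeasurableSet {ω | 0 < Mx h τ (n+1) ω} :=
    measurableSet_lt measurable_const (Mx_meas hm hτ.measurable _)
  have h1 := hopf hm hhi hτ n
  simp only [hh] at h1
  rw [integral_sub hi.integrableOn (integrable_const l).integrableOn, setIntegral_const] at h1
  have h2 : ∫ ω in {ω | 0 < Mx h τ (n+1) ω}, g ω ∂μ ≤ ∫ ω, g ω ∂μ :=
    setIntegral_le_integral hi (Eventually.of_forall hg0)
  simp only [smul_eq_mul] at h1
  have h3 : μ.real {ω | 0 < Mx h τ (n+1) ω} ≤ (∫ ω, g ω ∂μ) / l := by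
    rw [le_div_iff₀ hl]
    simp only [hh] at h2 ⊢
    linarith
  rw [← ofReal_measureReal]
  exact ENNReal.ofReal_le_ofReal h3

lemma ae_eq_of_le_comp {f : Ω → ℝ≥0∞} (hf : Measurable f) (hτ : MeasurePreserving τ μ μ)
    (hfin : ∫⁻ ω, f ω ∂μ ≠ ∞) (h : ∀ᵐ ω ∂μ, f ω ≤ f (τ ω)) : ∀ᵐ ω ∂μ, f (τ ω) = f ω := by
  have h1 : ∫⁻ ω, f (τ ω) ∂μ = ∫⁻ ω, f ω ∂μ := hτ.lintegral_comp hf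
  have := ae_eq_of_ae_le_of_lintegral_le h hfin (hf.comp hτ.measurable).aemeasurable h1.le
  filter_upwards [this] with ω hω using hω.symm

lemma ae_eq_of_le_comp_real {f : Ω → ℝ} (hf : Measurable f) (hτ : MeasurePreserving τ μ μ)
    (h : ∀ᵐ ω ∂μ, f ω ≤ f (τ ω)) : ∀ᵐ ω ∂μ, f (τ ω) = f ω := by
  have hb : ∀ x : ℝ, 0 ≤ Real.arctan x + Real.pi / 2 := fun x => by
    have := Real.neg_pi_div_two_lt_arctan x; linarith
  have := ae_eq_of_le_comp (f := fun ω => ENNReal.ofReal (Real.arctan (f ω) + Real.pi / 2))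
    (by fun_prop) hτ ?_ ?_
  · filter_upwards [this] with ω hω
    rw [ENNReal.ofReal_eq_ofReal_iff (hb _) (hb _)] at hω
    exact Real.arctan_injective (by linarith)
  · refine ne_of_lt (lt_of_le_of_lt (lintegral_mono (g := fun _ => ENNReal.ofReal Real.pi) fun ω => ?_) ?_)
    · apply ENNReal.ofReal_le_ofReal
      have := Real.arctan_lt_pi_div_two (f ω); linarith
    · simp
  · filter_upwards [h] with ω hω
    apply ENNReal.ofReal_le_ofReal
    have := Real.arctan_mono hω
    linarith

end king
end RWRPX

namespace RWRPX
section king2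
variable {Ω : Type*} [MeasurableSpace Ω] {μ : Measure Ω} [IsProbabilityMeasure μ] {τ : Ω → Ω}

lemma orbit (X : ℕ → Ω → ℝ) (hX0 : ∀ ω, X 0 ω = 0)
    (hsub : ∀ m n ω, X (m+n) ω ≤ X m ω + X n (τ^[m] ω)) (N : ℕ) (hN : 1 ≤ N) (c : ℝ) (g : Ω → ℝ)
    (hg0 : ∀ ω, 0 ≤ g ω)
    (ω : Ω)
    (hg : ∀ i, (∃ k, 1 ≤ k ∧ k ≤ N ∧ X k (τ^[i] ω) ≤ k * c) ∨ X 1 (τ^[i] ω) ≤ c + g (τ^[i] ω))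
    (n : ℕ) :
    ∃ m ≤ n, n < m + N ∧ X m ω ≤ m * c + ∑ i ∈ Finset.range m, g (τ^[i] ω) := by
  induction n with
  | zero => exact ⟨0, le_rfl, by omega, by simp [hX0]⟩
  | succ n ih =>
    obtain ⟨m, hm, hmN, hX⟩ := ih
    by_cases h : n + 1 < m + N
    · exact ⟨m, by omega, h, hX⟩
    rcases hg m with ⟨k, hk1, hkN, hk⟩ | h1
    · refine ⟨m + k, by omega, by omega, ?_⟩
      have h2 := hsub m k ω
      have h3 : ∑ i ∈ Finset.range m, g (τ^[i] ω) ≤ ∑ i ∈ Finset.range (m+k), g (τ^[i] ω) :=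
        Finset.sum_le_sum_of_subset_of_nonneg (by intro i; simp; omega) (fun i _ _ => hg0 _)
      push_cast
      linarith
    · refine ⟨m + 1, by omega, by omega, ?_⟩
      have h2 := hsub m 1 ω
      rw [Finset.sum_range_succ]
      push_cast
      linarith

lemma kingman (hτ : MeasurePreserving τ μ μ) (X : ℕ → Ω → ℝ) (hXm : ∀ n, Measurable (X n))
    (hX0 : ∀ ω, X 0 ω = 0) (hXn : ∀ n ω, 0 ≤ X n ω)
    (hsub : ∀ m n ω, X (m+n) ω ≤ X m ω + X n (τ^[m] ω)) (hi : Integrable (X 1) μ)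
    (htail : ∀ᵐ ω ∂μ, ∀ η > (0:ℝ), ∀ N : ℕ, ∃ M : ℕ, ∀ n ≥ M, ∀ m ≤ n, n < m + N →
      X n ω ≤ X m ω + η * n) :
    ∀ᵐ ω ∂μ, ∃ a : ℝ, Tendsto (fun n : ℕ => X n ω / n) atTop (𝓝 a) := by
  set u : ℕ → Ω → ℝ≥0∞ := fun n ω => ENNReal.ofReal (X n ω / n) with hu
  have hum : ∀ n, Measurable (u n) := fun n => ((hXm n).div_const _).ennreal_ofReal
  set f : Ω → ℝ≥0∞ := fun ω => liminf (fun n => u n ω) atTop with hf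
  have hfm : Measurable f := Measurable.liminf hum
  have hint : ∀ n, ∫⁻ ω, ENNReal.ofReal (X n ω) ∂μ ≤ n * ∫⁻ ω, ENNReal.ofReal (X 1 ω) ∂μ := by
    intro n
    induction n with
    | zero => simp [hX0]
    | succ n ih =>
      have h1 : ∫⁻ ω, ENNReal.ofReal (X (n+1) ω) ∂μ ≤
          ∫⁻ ω, (ENNReal.ofReal (X n ω) + ENNReal.ofReal (X 1 (τ^[n] ω))) ∂μ := by
        refine lintegral_mono fun ω => ?_
        rw [← ENNReal.ofReal_add (hXn _ _) (hXn _ _)]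
        exact ENNReal.ofReal_le_ofReal (hsub _ _ _)
      rw [lintegral_add_left (hXm n).ennreal_ofReal,
        (hτ.iterate n).lintegral_comp (hXm 1).ennreal_ofReal] at h1
      refine h1.trans ?_
      push_cast
      rw [add_mul, one_mul]
      gcongr
  have hI : ∫⁻ ω, ENNReal.ofReal (X 1 ω) ∂μ < ∞ := by
    have := hi.2
    rw [hasFiniteIntegral_iff_ofReal (Eventually.of_forall (hXn 1))] at this
    exact this
  have hfin : ∫⁻ ω, f ω ∂μ ≠ ∞ := by
    refine ne_of_lt (lt_of_le_of_lt (lintegral_liminf_le hum) ?_)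
    refine lt_of_le_of_lt ?_ hI
    refine liminf_le_of_frequently_le' (Eventually.frequently ?_)
    filter_upwards [eventually_gt_atTop 0] with n hn
    have hn' : (0:ℝ) < n := by exact_mod_cast hn
    have : ∀ ω, u n ω = ENNReal.ofReal (X n ω) / n := fun ω => by
      simp only [hu]
      rw [ENNReal.ofReal_div_of_pos hn', ENNReal.ofReal_natCast]
    simp_rw [this, div_eq_mul_inv]
    rw [lintegral_mul_const _ (hXm n).ennreal_ofReal, ← div_eq_mul_inv]
    refine ENNReal.div_le_of_le_mul ?_
    rw [mul_comm]; exact hint n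
  have hle : ∀ ω, f ω ≤ f (τ ω) := by
    intro ω
    have h1 : f ω = liminf (fun n => u (n+1) ω) atTop := (liminf_nat_add (fun n => u n ω) 1).symm
    have h2 : Tendsto (fun n : ℕ => ENNReal.ofReal (X 1 ω / ((n:ℝ)+1))) atTop (𝓝 0) := by
      rw [← ENNReal.ofReal_zero]
      refine ENNReal.tendsto_ofReal ?_
      have := (tendsto_one_div_add_atTop_nhds_zero_nat (𝕜 := ℝ)).const_mul (X 1 ω)
      simpa [div_eq_mul_inv] using this
    have h3 := ENNReal.liminf_add_of_right_tendsto_zero h2 (fun n => u n (τ ω))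
    show f ω ≤ liminf (fun n => u n (τ ω)) atTop
    rw [h1, ← h3]
    refine liminf_le_liminf (Eventually.of_forall fun n => ?_)
    show _ ≤ u n (τ ω) + _
    simp only [hu]
    rw [← ENNReal.ofReal_add (by have := hXn n (τ ω); positivity) (by have := hXn 1 ω; positivity)]
    apply ENNReal.ofReal_le_ofReal
    have h4 := hsub 1 n ω
    rw [add_comm 1 n] at h4
    simp only [Function.iterate_one] at h4
    have h5 : X n (τ ω) / ((n:ℝ)+1) ≤ X n (τ ω) / n := by
      rcases Nat.eq_zero_or_pos n with h | h
      · subst h; simp [hX0]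
      · exact div_le_div_of_nonneg_left (hXn _ _) (by exact_mod_cast h) (by linarith)
    push_cast
    calc X (n+1) ω / ((n:ℝ)+1) ≤ (X 1 ω + X n (τ ω)) / ((n:ℝ)+1) := by gcongr
      _ = X n (τ ω) / ((n:ℝ)+1) + X 1 ω / ((n:ℝ)+1) := by ring
      _ ≤ _ := by linarith
  have hinv1 := ae_eq_of_le_comp hfm hτ hfin (Eventually.of_forall hle)
  have hinv : ∀ᵐ ω ∂μ, ∀ i : ℕ, f (τ^[i] ω) = f ω := by
    rw [ae_all_iff]
    intro i
    induction i with
    | zero => simp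
    | succ i ih =>
      filter_upwards [ih, (hτ.iterate i).quasiMeasurePreserving.ae hinv1] with ω h1 h2
      rw [Function.iterate_succ_apply', h2, h1]
  have hftop : ∀ᵐ ω ∂μ, f ω < ∞ := ae_lt_top hfm hfin
  set φ : Ω → ℝ := fun ω => (f ω).toReal with hφ
  have hφm : Measurable φ := hfm.ennreal_toReal
  -- key
  have key : ∀ p : ℕ, ∀ᵐ ω ∂μ, ∀ᶠ n : ℕ in atTop, X n ω ≤ n * (φ ω + 3 * (1 / ((p:ℝ)+1))) := by
    intro p
    set e : ℝ := 1 / ((p:ℝ)+1) with he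
    have he0 : 0 < e := by positivity
    set B : ℕ → Set Ω := fun N => {ω | ∀ k : ℕ, 1 ≤ k → k ≤ N → k * (φ ω + e) < X k ω} with hB
    have hBm : ∀ N, MeasurableSet (B N) := by
      intro N
      have : B N = ⋂ k : ℕ, ⋂ (_ : 1 ≤ k), ⋂ (_ : k ≤ N), {ω | k * (φ ω + e) < X k ω} := by
        ext ω; simp [hB]
      rw [this]
      refine MeasurableSet.iInter fun k => MeasurableSet.iInter fun _ => MeasurableSet.iInter fun _ => ?_
      exact measurableSet_lt ((hφm.add_const _).const_mul _) (hXm k)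
    set g : ℕ → Ω → ℝ := fun N => (B N).indicator (X 1) with hg
    have hgm : ∀ N, Measurable (g N) := fun N => (hXm 1).indicator (hBm N)
    have hgi : ∀ N, Integrable (g N) μ := fun N => hi.indicator (hBm N)
    have hg0 : ∀ N ω, 0 ≤ g N ω := fun N ω => Set.indicator_nonneg (fun _ _ => hXn 1 _) _
    have hgt : Tendsto (fun N => ∫ ω, g N ω ∂μ) atTop (𝓝 0) := by
      have := tendsto_integral_of_dominated_convergence (μ := μ) (F := g) (f := fun _ => (0:ℝ)) (X 1)
        (fun N => (hgm N).aestronglyMeasurable) hi ?_ ?_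
      · simpa using this
      · intro N
        refine Eventually.of_forall fun ω => ?_
        rw [Real.norm_of_nonneg (hg0 N ω)]
        exact Set.indicator_le_self' (fun _ _ => hXn 1 _) _
      · filter_upwards [hftop] with ω hω
        have h1 : f ω < ENNReal.ofReal (φ ω + e) := by
          rw [ENNReal.lt_ofReal_iff_toReal_lt hω.ne]
          show φ ω < _
          linarith
        have h2 : ∃ᶠ n in atTop, u n ω < ENNReal.ofReal (φ ω + e) := frequently_lt_of_liminf_lt (by isBoundedDefault) h1
        obtain ⟨k, hk, hk1⟩ := (h2.and_eventually (eventually_ge_atTop 1)).exists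
        have hk' : (0:ℝ) < k := by exact_mod_cast hk1
        have h3 : X k ω / k < φ ω + e := by
          by_contra hcon
          exact absurd (ENNReal.ofReal_le_ofReal (not_lt.1 hcon)) (not_le.2 hk)
        rw [div_lt_iff₀ hk'] at h3
        refine tendsto_const_nhds.congr' ?_
        filter_upwards [eventually_ge_atTop k] with N hN
        have : ω ∉ B N := fun h => by
          have := h k hk1 hN
          linarith
        simp [hg, this]
    have hgood : ∀ᵐ ω ∂μ, ∃ N : ℕ, 1 ≤ N ∧ ∀ n : ℕ, ∑ i ∈ Finset.range n, g N (τ^[i] ω) ≤ e * n := by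
      rw [ae_iff]
      have hb : ∀ N : ℕ, 1 ≤ N → μ {ω | ¬ ∃ N : ℕ, 1 ≤ N ∧ ∀ n : ℕ, ∑ i ∈ Finset.range n, g N (τ^[i] ω) ≤ e * n}
          ≤ ENNReal.ofReal ((∫ ω, g N ω ∂μ) / e) := by
        intro N hN
        refine le_trans (measure_mono ?_) (maximal (hgm N) (hgi N) (hg0 N) hτ he0)
        intro ω hω
        simp only [Set.mem_setOf_eq, not_exists, not_and] at hω ⊢
        have := hω N hN
        push Not at this
        exact this
      have ht : Tendsto (fun N => ENNReal.ofReal ((∫ ω, g N ω ∂μ) / e)) atTop (𝓝 0) := by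
        rw [← ENNReal.ofReal_zero]
        refine ENNReal.tendsto_ofReal ?_
        simpa using hgt.div_const e
      refine le_antisymm (ge_of_tendsto ht ?_) (zero_le)
      filter_upwards [eventually_ge_atTop 1] with N hN using hb N hN
    filter_upwards [hgood, hinv, htail] with ω ⟨N, hN, hs⟩ hiv ht
    obtain ⟨M, hM⟩ := ht e he0 N
    filter_upwards [eventually_ge_atTop M] with n hn
    have hφ0 : 0 ≤ φ ω := ENNReal.toReal_nonneg
    obtain ⟨m, hmn, hmN, hm⟩ := orbit X hX0 hsub N hN (φ ω + e) (g N) (hg0 N) ω (fun i => by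
      by_cases h : τ^[i] ω ∈ B N
      · right
        simp only [hg, Set.indicator_of_mem h]
        linarith
      · left
        simp only [hB, Set.mem_setOf_eq, not_forall, not_lt] at h
        obtain ⟨k, hk1, hkN, hk⟩ := h
        refine ⟨k, hk1, hkN, ?_⟩
        have : φ (τ^[i] ω) = φ ω := by simp only [hφ, hiv i]
        rwa [this] at hk) n
    have h1 := hM n hn m hmn hmN
    have h2 := hs m
    have h3 : (m:ℝ) ≤ n := by exact_mod_cast hmn
    have h4 : (m:ℝ) * (φ ω + e) ≤ n * (φ ω + e) := by gcongr
    have h5 : e * (m:ℝ) ≤ e * n := by gcongr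
    nlinarith
  have key' := ae_all_iff.2 key
  filter_upwards [key', hftop] with ω hk hω
  refine ⟨φ ω, tendsto_order.2 ⟨fun a ha => ?_, fun a ha => ?_⟩⟩
  · by_cases ha0 : a < 0
    · exact Eventually.of_forall fun n => lt_of_lt_of_le ha0 (by have := hXn n ω; positivity)
    · push Not at ha0
      have h1 : ENNReal.ofReal a < f ω := by
        rw [ENNReal.ofReal_lt_iff_lt_toReal ha0 hω.ne]; exact ha
      filter_upwards [eventually_lt_of_lt_liminf h1 (by isBoundedDefault)] with n hn
      by_contra hcon
      exact absurd (ENNReal.ofReal_le_ofReal (not_lt.1 hcon)) (not_le.2 hn)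
  · obtain ⟨p, hp⟩ := exists_nat_one_div_lt (show 0 < (a - φ ω) / 3 by linarith)
    filter_upwards [hk p, eventually_gt_atTop 0] with n hn hn0
    have hn0 : (0:ℝ) < n := by exact_mod_cast hn0
    rw [div_lt_iff₀ hn0]
    refine lt_of_le_of_lt hn ?_
    rw [mul_comm]
    gcongr
    linarith
end king2
end RWRPX

namespace RWRPX
open RWRP
section proc
variable {J : Type*} [Fintype J] {d : ℕ} {Ω : Type*} [MeasurableSpace Ω]

def ph (ζ : J → Zd d) (b : J → ℕ) : Zd d := ∑ j, b j • ζ j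

lemma ph_add (ζ : J → Zd d) (b c : J → ℕ) : ph ζ (b + c) = ph ζ b + ph ζ c := by
  simp [ph, add_smul, Finset.sum_add_distrib]
lemma ph_zero (ζ : J → Zd d) : ph ζ 0 = 0 := by simp [ph]
lemma ph_single (ζ : J → Zd d) (j : J) (k : ℕ) : ph ζ (Pi.single j k) = k • ζ j := by
  unfold ph
  rw [Finset.sum_eq_single j] <;> simp +contextual [Pi.single_apply]
lemma ph_smul (ζ : J → Zd d) (n : ℕ) (b : J → ℕ) : ph ζ (n • b) = n • ph ζ b := by
  simp [ph, Finset.smul_sum, mul_smul]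

structure Proc (μ : Measure Ω) (T : Zd d → Ω → Ω) (ζ : J → Zd d) (W : Ω → (J → ℕ) → ℝ)
    (g : J → Ω → ℝ) (K : ℝ) : Prop where
  mp : ∀ z, MeasurePreserving (T z) μ μ
  T0 : T 0 = id
  Tadd : ∀ x y, T (x + y) = T x ∘ T y
  Wm : ∀ b, Measurable fun ω => W ω b
  W0 : ∀ ω, W ω 0 = 0
  Wsub : ∀ ω b c, W ω (b + c) ≤ W ω b + W (T (ph ζ b) ω) c
  Wlow : ∀ ω b, -(K * ∑ j, (b j : ℝ)) ≤ W ω b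
  Wone : ∀ ω j, W ω (Pi.single j 1) ≤ g j ω
  gm : ∀ j, Measurable (g j)
  g0 : ∀ j ω, 0 ≤ g j ω
  gi : ∀ j, Integrable (g j) μ
  K0 : 0 ≤ K
  cL : ∀ᵐ ω ∂μ, ∀ η > (0:ℝ), ∃ ε > (0:ℝ), ∃ N : ℕ, ∀ n ≥ N, ∀ j, ∀ b : J → ℕ, ∑ i, b i ≤ n →
    ∑ k ∈ Finset.range (⌊ε * n⌋₊ + 1), g j (T (ph ζ b + k • ζ j) ω) ≤ η * n

variable {μ : Measure Ω} [IsProbabilityMeasure μ] {T : Zd d → Ω → Ω} {ζ : J → Zd d}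
  {W : Ω → (J → ℕ) → ℝ} {g : J → Ω → ℝ} {K : ℝ}

lemma Proc.step (P : Proc μ T ζ W g K) (ω : Ω) (b : J → ℕ) (j : J) (k : ℕ) :
    W ω (b + Pi.single j k) ≤ W ω b + ∑ i ∈ Finset.range k, g j (T (ph ζ b + i • ζ j) ω) := by
  induction k with
  | zero => simp
  | succ k ih =>
    have h1 := P.Wsub ω (b + Pi.single j k) (Pi.single j 1)
    have h2 := P.Wone (T (ph ζ (b + Pi.single j k)) ω) j
    rw [add_assoc, ← Pi.single_add] at h1
    rw [ph_add, ph_single] at h1 h2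
    rw [Finset.sum_range_succ]
    linarith

lemma Proc.reg (P : Proc μ T ζ W g K) : ∀ᵐ ω ∂μ, Reg (W ω) := by
  filter_upwards [P.cL] with ω hω η hη
  set q : ℝ := η / (2 * (Fintype.card J + 1)) with hq
  have hq0 : 0 < q := by positivity
  obtain ⟨ε, hε, N, hN⟩ := hω q hq0
  refine ⟨ε, hε, max N 1, fun t ht b b' hbb hs hd => ?_⟩
  have ht1 : (1:ℝ) ≤ t := le_trans (le_max_right _ _) ht
  have htN : (N:ℝ) ≤ t := le_trans (le_max_left _ _) ht
  set n : ℕ := ⌈t⌉₊ with hn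
  have hnt : t ≤ n := Nat.le_ceil t
  have hnN : N ≤ n := by exact_mod_cast htN.trans hnt
  have hn2 : (n:ℝ) ≤ 2 * t := by
    have := Nat.ceil_lt_add_one (show 0 ≤ t by linarith)
    linarith
  have hb'n : ∑ j, b' j ≤ n := by
    have : ((∑ j, b' j : ℕ) : ℝ) ≤ n := by push_cast; linarith
    exact_mod_cast this
  have main : ∀ s : Finset J, W ω (fun j => if j ∈ s then b' j else b j) ≤ W ω b + s.card * (q * n) := by
    intro s
    induction s using Finset.induction_on with
    | empty => simp
    | insert j s hj ih =>
      set c : J → ℕ := fun i => if i ∈ s then b' i else b i with hc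
      have e : (fun i => if i ∈ insert j s then b' i else b i) = c + Pi.single j (b' j - b j) := by
        funext i
        by_cases hi : i = j
        · subst hi; simp [hc, hj, Nat.add_sub_cancel' (hbb i)]
        · simp [hc, hi, Pi.single_apply]
      rw [e]
      have hst := P.step ω c j (b' j - b j)
      have hcn : ∑ i, c i ≤ n := le_trans (Finset.sum_le_sum fun i _ => by
        simp only [hc]; split_ifs
        · exact le_rfl
        · exact hbb i) hb'n
      have h1 := hN n hnN j c hcn
      have hsz : b' j - b j ≤ ⌊ε * n⌋₊ + 1 := by
        have h2 : ((b' j - b j : ℕ) : ℝ) ≤ ∑ i, ((b' i : ℝ) - b i) := by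
          rw [Nat.cast_sub (hbb j)]
          exact Finset.single_le_sum (f := fun i => (b' i : ℝ) - b i)
            (fun i _ => sub_nonneg.2 (by exact_mod_cast hbb i)) (Finset.mem_univ j)
        have h3 : ((b' j - b j : ℕ) : ℝ) ≤ ε * n := h2.trans (hd.trans (by gcongr))
        exact (Nat.le_floor h3).trans (Nat.le_succ _)
      have h4 : ∑ i ∈ Finset.range (b' j - b j), g j (T (ph ζ c + i • ζ j) ω) ≤
          ∑ k ∈ Finset.range (⌊ε * n⌋₊ + 1), g j (T (ph ζ c + k • ζ j) ω) :=
        Finset.sum_le_sum_of_subset_of_nonneg (Finset.range_mono hsz) (fun i _ _ => P.g0 _ _)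
      rw [Finset.card_insert_of_notMem hj]
      push_cast
      linarith
  have h := main Finset.univ
  simp only [Finset.mem_univ, if_true, Finset.card_univ] at h
  refine h.trans ?_
  have h5 : (Fintype.card J : ℝ) * (q * n) ≤ (Fintype.card J + 1) * (q * (2 * t)) := by
    gcongr; linarith
  have h6 : ((Fintype.card J : ℝ) + 1) * (q * (2 * t)) = η * t := by
    rw [hq]; field_simp
  linarith

lemma vec_induct {p : (J → ℕ) → Prop} (h0 : p 0) (hs : ∀ b j, p b → p (b + Pi.single j 1)) :
    ∀ b, p b := by
  have : ∀ n : ℕ, ∀ b : J → ℕ, ∑ j, b j = n → p b := by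
    intro n
    induction n with
    | zero =>
      intro b hb
      have : b = 0 := by
        funext j
        exact (Finset.sum_eq_zero_iff.1 hb) j (Finset.mem_univ j)
      rw [this]; exact h0
    | succ n ih =>
      intro b hb
      have : ∃ j, b j ≠ 0 := by
        by_contra hcon
        push Not at hcon
        simp [hcon] at hb
      obtain ⟨j, hj⟩ := this
      have e : b = Function.update b j (b j - 1) + Pi.single j 1 := by
        funext i
        by_cases hi : i = j
        · subst hi; simp; omega
        · simp [hi, Pi.single_apply]
      rw [e]
      apply hs
      apply ih
      have h2 : ∑ i, b i = ∑ i, (Function.update b j (b j - 1)) i + ∑ i, (Pi.single j 1 : J → ℕ) i := by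
        rw [← Finset.sum_add_distrib]
        exact Finset.sum_congr rfl fun i _ => congrFun e i
      rw [hb] at h2
      simp at h2
      omega
  exact fun b => this _ b rfl

lemma Proc.iter (P : Proc μ T ζ W g K) (x : Zd d) (n : ℕ) : (T x)^[n] = T (n • x) := by
  induction n with
  | zero => simp [P.T0]
  | succ n ih => rw [Function.iterate_succ, ih, succ_nsmul, P.Tadd]

lemma Proc.pre (P : Proc μ T ζ W g K) {S : Set Ω} (hS : ∀ j, T (ζ j) ⁻¹' S = S) (b : J → ℕ) :
    T (ph ζ b) ⁻¹' S = S := by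
  induction b using vec_induct with
  | h0 => simp [ph_zero, P.T0]
  | hs b j ih =>
    rw [ph_add, ph_single, one_smul, P.Tadd, Set.preimage_comp, ih, hS]

lemma Proc.setint (P : Proc μ T ζ W g K) {S : Set Ω} (hSm : MeasurableSet S)
    (hS : ∀ j, T (ζ j) ⁻¹' S = S) (b : J → ℕ) :
    Integrable (fun ω => W ω b) μ ∧ ∫ ω in S, W ω b ∂μ ≤ ∑ j, b j * ∫ ω in S, g j ω ∂μ := by
  induction b using vec_induct with
  | h0 => simp [P.W0]
  | hs b j ih =>
    obtain ⟨ih1, ih2⟩ := ih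
    have hst : ∀ ω, W ω (b + Pi.single j 1) ≤ W ω b + g j (T (ph ζ b) ω) := fun ω => by
      have := P.step ω b j 1
      simpa using this
    have hgi : Integrable (fun ω => g j (T (ph ζ b) ω)) μ :=
      (P.mp _).integrable_comp_of_integrable (P.gi j)
    have hi : Integrable (fun ω => W ω (b + Pi.single j 1)) μ := by
      refine integrable_of_le_of_le (P.Wm _).aestronglyMeasurable
        (Eventually.of_forall fun ω => P.Wlow ω _) (Eventually.of_forall hst)
        (integrable_const _) (ih1.add hgi)
    refine ⟨hi, ?_⟩
    have h1 : ∫ ω in S, W ω (b + Pi.single j 1) ∂μ ≤ ∫ ω in S, (W ω b + g j (T (ph ζ b) ω)) ∂μ :=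
      integral_mono hi.integrableOn (ih1.add hgi).integrableOn hst
    rw [integral_add ih1.integrableOn hgi.integrableOn] at h1
    have h2 : ∫ ω in S, g j (T (ph ζ b) ω) ∂μ = ∫ ω in S, g j ω ∂μ := by
      have h3 := (P.mp (ph ζ b)).restrict_preimage hSm
      rw [P.pre hS b] at h3
      have h4 := integral_map (μ := μ.restrict S) h3.measurable.aemeasurable (f := g j)
        (P.gm j).aestronglyMeasurable
      rw [h3.map_eq] at h4
      exact h4.symm
    have h5 : ∑ i, (((b + Pi.single j 1 : J → ℕ) i : ℕ) : ℝ) * ∫ ω in S, g i ω ∂μ =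
        ∑ i, b i * ∫ ω in S, g i ω ∂μ + ∫ ω in S, g j ω ∂μ := by
      simp only [Pi.add_apply, Nat.cast_add, add_mul, Finset.sum_add_distrib]
      congr 1
      rw [Finset.sum_eq_single j] <;> simp +contextual [Pi.single_apply]
    rw [h5]
    linarith

lemma Proc.rat (P : Proc μ T ζ W g K) (b : J → ℕ) :
    ∀ᵐ ω ∂μ, ∃ a : ℝ, Tendsto (fun n : ℕ => W ω (n • b) / n) atTop (𝓝 a) := by
  set σ : ℝ := ∑ j, (b j : ℝ) with hσ
  have hσ0 : 0 ≤ σ := Finset.sum_nonneg fun j _ => by positivity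
  have hsm : ∀ n : ℕ, ∑ j, (((n • b) j : ℕ) : ℝ) = n * σ := fun n => by
    simp [hσ, Finset.mul_sum]
  have hk := kingman (P.mp (ph ζ b)) (fun n ω => W ω (n • b) + K * (n * σ))
    (fun n => (P.Wm _).add_const _) (fun ω => by simp [P.W0])
    (fun n ω => by
      have := P.Wlow ω (n • b)
      rw [hsm] at this
      linarith)
    (fun m n ω => by
      have := P.Wsub ω (m • b) (n • b)
      rw [P.iter, ← ph_smul, add_smul]
      push_cast
      linarith)
    (((P.setint MeasurableSet.univ (fun _ => rfl) (1 • b)).1).add (integrable_const _)) ?_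
  · filter_upwards [hk] with ω ⟨a, ha⟩
    refine ⟨a - K * σ, ?_⟩
    refine (ha.sub_const (K * σ)).congr' ?_
    filter_upwards [eventually_gt_atTop 0] with n hn
    have : (n:ℝ) ≠ 0 := by positivity
    field_simp
    ring
  · filter_upwards [P.reg] with ω hω η hη N
    obtain ⟨ε, hε, N', hN'⟩ := hω (η / (2 * (σ + 1))) (by positivity)
    obtain ⟨M1, hM1⟩ := exists_nat_gt (max (max N' (N * σ / ε)) (2 * K * N * σ / η))
    refine ⟨M1, fun n hn m hmn hnm => ?_⟩
    have hnM : (M1:ℝ) ≤ n := by exact_mod_cast hn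
    have hn1 : N' ≤ n := by
      have := le_max_left N' (N * σ / ε); have := le_max_left (max N' (N * σ / ε)) (2 * K * N * σ / η)
      linarith
    have hn2 : N * σ / ε ≤ n := by
      have := le_max_right N' (N * σ / ε); have := le_max_left (max N' (N * σ / ε)) (2 * K * N * σ / η)
      linarith
    have hn3 : 2 * K * N * σ / η ≤ n := by
      have := le_max_right (max N' (N * σ / ε)) (2 * K * N * σ / η)
      linarith
    rw [div_le_iff₀ hε] at hn2
    rw [div_le_iff₀ hη] at hn3
    have hn0 : (0:ℝ) ≤ n := by positivity
    have hm : (n:ℝ) - m ≤ N := by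
      have : (n:ℝ) < m + N := by exact_mod_cast hnm
      linarith
    have h1 := hN' (n * (σ + 1)) (by nlinarith) (m • b) (n • b)
      (fun j => by simp only [Pi.smul_apply, smul_eq_mul]; gcongr)
      (by rw [hsm]; nlinarith)
      (by
        rw [Finset.sum_sub_distrib, hsm, hsm]
        have : (n:ℝ) * σ - m * σ ≤ N * σ := by nlinarith
        nlinarith [mul_nonneg (mul_nonneg hε.le hn0) hσ0])
    have h2 : η / (2 * (σ + 1)) * (n * (σ + 1)) = η * n / 2 := by field_simp
    have h3 : K * (n * σ) - K * (m * σ) ≤ K * (N * σ) := by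
      have : (n:ℝ) * σ - m * σ ≤ N * σ := by nlinarith
      nlinarith [P.K0]
    linarith

lemma Proc.lsp (P : Proc μ T ζ W g K) :
    ∀ᵐ ω ∂μ, ∀ β : J → ℝ, (∀ j, 0 < β j) → LSP (W ω) β (al (W ω) β) := by
  filter_upwards [P.reg, ae_all_iff.2 P.rat] with ω h1 h2 β hβ
  exact lsp_exists h1 (P.W0 ω) (P.Wlow ω) h2 β hβ

lemma Proc.al_meas (P : Proc μ T ζ W g K) (β : J → ℝ) : Measurable fun ω => al (W ω) β :=
  Measurable.limsup fun n => (P.Wm _).div_const _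

end proc
end RWRPX

namespace RWRPX
open RWRP
section proc2
variable {J : Type*} [Fintype J] {d : ℕ} {Ω : Type*} [MeasurableSpace Ω]
variable {μ : Measure Ω} [IsProbabilityMeasure μ] {T : Zd d → Ω → Ω} {ζ : J → Zd d}
  {W : Ω → (J → ℕ) → ℝ} {g : J → Ω → ℝ} {K : ℝ}

lemma Proc.ae_comp (P : Proc μ T ζ W g K) {p : Ω → Prop} (h : ∀ᵐ ω ∂μ, p ω) (z : Zd d) :
    ∀ᵐ ω ∂μ, p (T z ω) := (P.mp z).quasiMeasurePreserving.ae h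

lemma Proc.inv1 (P : Proc μ T ζ W g K) (β : J → ℝ) (hβ : ∀ j, 0 < β j) (j : J) :
    ∀ᵐ ω ∂μ, al (W (T (ζ j) ω)) β = al (W ω) β := by
  refine ae_eq_of_le_comp_real (f := fun ω => al (W ω) β) (P.al_meas β) (P.mp (ζ j)) ?_
  filter_upwards [P.lsp, P.ae_comp P.lsp (ζ j)] with ω h1 h2
  have ht := fl_tendsto β (fun j => (hβ j).le)
  have e1 := lsp_seq (h1 β hβ) (fun n => Pi.single j 1 + fl β n) (fun i => by
    have h3 := ((tendsto_const_div_atTop_nhds_zero_nat (((Pi.single j 1 : J → ℕ) i : ℕ) : ℝ))).add (ht i)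
    rw [zero_add] at h3
    refine h3.congr fun n => ?_
    simp only [Pi.add_apply, Nat.cast_add, add_div])
  have e2 := (tendsto_const_div_atTop_nhds_zero_nat (W ω (Pi.single j 1))).add
    (lsp_seq (h2 β hβ) (fun n => fl β n) ht)
  rw [zero_add] at e2
  refine le_of_tendsto_of_tendsto' e1 e2 fun n => ?_
  rw [← add_div]
  have := P.Wsub ω (Pi.single j 1) (fl β n)
  rw [ph_single, one_smul] at this
  gcongr

lemma Proc.inv (P : Proc μ T ζ W g K) (β : J → ℝ) (hβ : ∀ j, 0 < β j) (b : J → ℕ) :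
    ∀ᵐ ω ∂μ, al (W (T (ph ζ b) ω)) β = al (W ω) β := by
  induction b using vec_induct with
  | h0 => simp [ph_zero, P.T0]
  | hs b j ih =>
    filter_upwards [P.inv1 β hβ j, P.ae_comp ih (ζ j)] with ω h1 h2
    rw [ph_add, ph_single, one_smul, P.Tadd, Function.comp, h2, h1]

lemma Proc.subadd1 (P : Proc μ T ζ W g K) (β γ : J → ℝ) (hβ : ∀ j, 0 < β j) (hγ : ∀ j, 0 < γ j) :
    ∀ᵐ ω ∂μ, al (W ω) (β + γ) ≤ al (W ω) β + al (W ω) γ := by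
  have htβ := fl_tendsto β (fun j => (hβ j).le)
  have htγ := fl_tendsto γ (fun j => (hγ j).le)
  set h : ℕ → Ω → ℝ := fun n ω => W ω (fl γ n) / n with hh
  have hm : ∀ n, Measurable (h n) := fun n => (P.Wm _).div_const _
  have h1 : TendstoInMeasure μ h atTop (fun ω => al (W ω) γ) := by
    refine tendstoInMeasure_of_tendsto_ae (fun n => (hm n).aestronglyMeasurable) ?_
    filter_upwards [P.lsp] with ω hω
    exact lsp_seq (hω γ hγ) _ htγ
  have h2 : TendstoInMeasure μ (fun n ω => h n (T (ph ζ (fl β n)) ω)) atTop (fun ω => al (W ω) γ) := by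
    intro ε hε
    refine (h1 ε hε).congr fun n => ?_
    have hS : MeasurableSet {ω | ε ≤ edist (h n ω) (al (W ω) γ)} :=
      measurableSet_le measurable_const ((hm n).edist (P.al_meas γ))
    rw [← (P.mp (ph ζ (fl β n))).measure_preimage hS.nullMeasurableSet]
    refine measure_congr ?_
    filter_upwards [P.inv γ hγ (fl β n)] with ω hω
    have : (ω ∈ T (ph ζ (fl β n)) ⁻¹' {ω | ε ≤ edist (h n ω) (al (W ω) γ)}) =
      (ω ∈ {x | ε ≤ edist (h n (T (ph ζ (fl β n)) x)) (al (W x) γ)}) := by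
      simp only [Set.mem_preimage, Set.mem_setOf_eq, hω]
    exact this
  obtain ⟨ns, hns, hlim⟩ := h2.exists_seq_tendsto_ae
  filter_upwards [hlim, P.lsp] with ω hl hω
  have e1 := (lsp_seq (hω (β + γ) (fun j => add_pos (hβ j) (hγ j))) (fun n => fl β n + fl γ n)
    (fun j => by
      refine ((htβ j).add (htγ j)).congr fun n => ?_
      simp only [Pi.add_apply, Nat.cast_add, add_div])).comp hns.tendsto_atTop
  have e2 := ((lsp_seq (hω β hβ) _ htβ).comp hns.tendsto_atTop).add hl
  refine le_of_tendsto_of_tendsto' e1 e2 fun i => ?_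
  simp only [Function.comp, hh]
  rw [← add_div]
  have := P.Wsub ω (fl β (ns i)) (fl γ (ns i))
  gcongr

lemma Proc.subadd (P : Proc μ T ζ W g K) :
    ∀ᵐ ω ∂μ, ∀ β γ : J → ℝ, (∀ j, 0 < β j) → (∀ j, 0 < γ j) →
      al (W ω) (β + γ) ≤ al (W ω) β + al (W ω) γ := by
  have h := ae_all_iff.2 fun p : (J → ℕ) × ℕ => ae_all_iff.2 fun q : (J → ℕ) × ℕ =>
    P.subadd1 (rq p) (rq q) (rq_pos p) (rq_pos q)
  filter_upwards [h, P.lsp] with ω h1 h2 β γ hβ hγ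
  have t1 := lsp_cont_seq h2 hβ _ (fun n => rq_pos _) (ap_tendsto β hβ)
  have t2 := lsp_cont_seq h2 hγ _ (fun n => rq_pos _) (ap_tendsto γ hγ)
  have t3 := lsp_cont_seq h2 (fun j => add_pos (hβ j) (hγ j) : ∀ j, 0 < (β + γ) j)
    (fun n => rq (ap β n) + rq (ap γ n)) (fun n j => add_pos (rq_pos _ _) (rq_pos _ _))
    ((ap_tendsto β hβ).add (ap_tendsto γ hγ))
  exact le_of_tendsto_of_tendsto' t3 (t1.add t2) fun n => h1 _ _

lemma Proc.modif (P : Proc μ T ζ W g K) {E : Set Ω} (hE : MeasurableSet E)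
    (h : ∀ j, T (ζ j) ⁻¹' E =ᵐ[μ] E) :
    ∃ E' : Set Ω, MeasurableSet E' ∧ (∀ j, T (ζ j) ⁻¹' E' = E') ∧ E' =ᵐ[μ] E := by
  set H := AddSubgroup.closure (Set.range ζ) with hH
  have hall : ∀ x ∈ H, T x ⁻¹' E =ᵐ[μ] E := by
    intro x hx
    induction hx using AddSubgroup.closure_induction with
    | mem x hx => obtain ⟨j, rfl⟩ := hx; exact h j
    | zero => rw [P.T0]; exact Filter.EventuallyEq.rfl
    | add x y _ _ hx hy =>
      rw [P.Tadd, Set.preimage_comp]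
      exact ((P.mp y).quasiMeasurePreserving.preimage_ae_eq hx).trans hy
    | neg x _ hx =>
      have h1 := (P.mp (-x)).quasiMeasurePreserving.preimage_ae_eq hx
      rw [← Set.preimage_comp, ← P.Tadd, add_neg_cancel, P.T0] at h1
      exact h1.symm
  refine ⟨⋂ x : H, T x ⁻¹' E, MeasurableSet.iInter fun x => (P.mp _).measurable hE, fun j => ?_, ?_⟩
  · have hz : ζ j ∈ H := AddSubgroup.subset_closure ⟨j, rfl⟩
    ext ω
    simp only [Set.mem_preimage, Set.mem_iInter, Subtype.forall]
    constructor
    · intro hω x hx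
      have := hω (x - ζ j) (H.sub_mem hx hz)
      rwa [← Function.comp_apply (f := T _), ← P.Tadd, sub_add_cancel] at this
    · intro hω x hx
      have := hω (x + ζ j) (H.add_mem hx hz)
      rwa [P.Tadd] at this
  · have h2 : (⋂ x : H, T (x : Zd d) ⁻¹' E) =ᵐ[μ] (⋂ x : H, E) :=
      EventuallyEq.countable_iInter fun x => hall x x.2
    rwa [Set.iInter_const] at h2

lemma inv_fun {S : Set (Zd d)} {f : Ω → ℝ} (hf : Measurable[invSigma T S] f) {z : Zd d} (hz : z ∈ S)
    (ω : Ω) : f (T z ω) = f ω := by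
  have h1 : MeasurableSet[invSigma T S] (f ⁻¹' {f ω}) := hf (measurableSet_singleton _)
  have h2 : ω ∈ T z ⁻¹' (f ⁻¹' {f ω}) := by rw [h1.2 z hz]; rfl
  exact h2

lemma invSigma_le (S : Set (Zd d)) : invSigma T S ≤ (inferInstance : MeasurableSpace Ω) :=
  fun _ h => h.1

def Cc (μ : Measure Ω) (T : Zd d → Ω → Ω) (ζ : J → Zd d) (g : J → Ω → ℝ) (j : J) : Ω → ℝ :=
  condExp (invSigma T (Set.range ζ)) μ (g j)

lemma Cc_meas' (j : J) : Measurable[invSigma T (Set.range ζ)] (Cc μ T ζ g j) :=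
  stronglyMeasurable_condExp.measurable

lemma Cc_meas (j : J) : Measurable (Cc μ T ζ g j) :=
  Measurable.mono (Cc_meas' j) (invSigma_le _) le_rfl

lemma Cc_int (j : J) : Integrable (Cc μ T ζ g j) μ := integrable_condExp

lemma Proc.Cc_nonneg (P : Proc μ T ζ W g K) (j : J) : ∀ᵐ ω ∂μ, 0 ≤ Cc μ T ζ g j ω :=
  condExp_nonneg (Eventually.of_forall (P.g0 j))

lemma Proc.upper1 (P : Proc μ T ζ W g K) (β : J → ℝ) (hβ : ∀ j, 0 < β j) :
    ∀ᵐ ω ∂μ, al (W ω) β ≤ ∑ j, β j * Cc μ T ζ g j ω := by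
  set D : Ω → ℝ := fun ω => ∑ j, β j * Cc μ T ζ g j ω with hD
  have hDm : Measurable D := Finset.measurable_sum _ fun j _ => (Cc_meas j).const_mul _
  have hDi : Integrable D μ := integrable_finsetSum _ fun j _ => (Cc_int j).const_mul _
  have hD0 : ∀ᵐ ω ∂μ, 0 ≤ D ω := by
    filter_upwards [ae_all_iff.2 P.Cc_nonneg] with ω hω
    exact Finset.sum_nonneg fun j _ => mul_nonneg (hβ j).le (hω j)
  have hDT : ∀ j ω, D (T (ζ j) ω) = D ω := fun j ω => by
    simp only [hD]
    refine Finset.sum_congr rfl fun i _ => ?_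
    rw [inv_fun (Cc_meas' i) ⟨j, rfl⟩]
  set E : Set Ω := {ω | D ω < al (W ω) β} with hE
  have hEm : MeasurableSet E := measurableSet_lt hDm (P.al_meas β)
  obtain ⟨E', hE'm, hE'i, hE'⟩ := P.modif hEm (fun j => by
    filter_upwards [P.inv1 β hβ j] with ω hω
    have : (ω ∈ T (ζ j) ⁻¹' E) = (ω ∈ E) := by
      simp only [hE, Set.mem_preimage, Set.mem_setOf_eq, hω, hDT]
    exact this)
  set σ : ℝ := ∑ j, β j with hσ
  have hσ0 : 0 ≤ K * σ := mul_nonneg P.K0 (Finset.sum_nonneg fun j _ => (hβ j).le)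
  have hfl : ∀ (n : ℕ) j, (fl β n j : ℝ) ≤ n * β j := fun n j =>
    Nat.floor_le (mul_nonneg (Nat.cast_nonneg n) (hβ j).le)
  have hY0 : ∀ (n : ℕ) ω, 0 ≤ W ω (fl β n) / n + K * σ := by
    intro n ω
    rcases Nat.eq_zero_or_pos n with hn | hn
    · subst hn; simpa using hσ0
    have hn : (0:ℝ) < n := by exact_mod_cast hn
    have h1 := P.Wlow ω (fl β n)
    have h2 : ∑ j, (fl β n j : ℝ) ≤ n * σ := by
      rw [hσ, Finset.mul_sum]; exact Finset.sum_le_sum fun j _ => hfl n j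
    have h3 : -(K * (n * σ)) ≤ W ω (fl β n) := by
      have := mul_le_mul_of_nonneg_left h2 P.K0
      linarith
    have h4 : -(K * σ) ≤ W ω (fl β n) / n := by
      rw [le_div_iff₀ hn]; linarith
    linarith
  have hint : ∀ n : ℕ, 0 < n → ∫⁻ ω in E', ENNReal.ofReal (W ω (fl β n) / n + K * σ) ∂μ ≤
      ∫⁻ ω in E', ENNReal.ofReal (D ω + K * σ) ∂μ := by
    intro n hn
    have hn : (0:ℝ) < n := by exact_mod_cast hn
    obtain ⟨hi, hle⟩ := P.setint hE'm hE'i (fl β n)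
    have hi2 : Integrable (fun ω => W ω (fl β n) / n + K * σ) μ := (hi.div_const _).add (integrable_const _)
    have hi3 : Integrable (fun ω => D ω + K * σ) μ := hDi.add (integrable_const _)
    rw [← ofReal_integral_eq_lintegral_ofReal hi2.integrableOn (Eventually.of_forall (hY0 n)),
      ← ofReal_integral_eq_lintegral_ofReal hi3.integrableOn
        (ae_restrict_of_ae (by filter_upwards [hD0] with ω hω; exact add_nonneg hω hσ0))]
    apply ENNReal.ofReal_le_ofReal
    rw [integral_add (hi.div_const _).integrableOn (integrable_const _).integrableOn,
      integral_add hDi.integrableOn (integrable_const _).integrableOn]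
    refine add_le_add ?_ le_rfl
    have e1 : ∫ ω in E', D ω ∂μ = ∑ j, β j * ∫ ω in E', g j ω ∂μ := by
      simp only [hD]
      rw [integral_finsetSum _ fun j _ => ((Cc_int j).const_mul _).integrableOn]
      refine Finset.sum_congr rfl fun j _ => ?_
      rw [integral_const_mul]
      congr 1
      exact setIntegral_condExp (invSigma_le _) (P.gi j)
        (show MeasurableSet[invSigma T (Set.range ζ)] E' from
          ⟨hE'm, by rintro _ ⟨j, rfl⟩; exact hE'i j⟩)
    rw [e1, integral_div, div_le_iff₀ hn]
    refine hle.trans ?_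
    rw [Finset.sum_mul]
    refine Finset.sum_le_sum fun j _ => ?_
    have : 0 ≤ ∫ ω in E', g j ω ∂μ := integral_nonneg (P.g0 j)
    nlinarith [hfl n j]
  have hfat : ∫⁻ ω in E', ENNReal.ofReal (al (W ω) β + K * σ) ∂μ ≤
      ∫⁻ ω in E', ENNReal.ofReal (D ω + K * σ) ∂μ := by
    have h1 : ∫⁻ ω in E', ENNReal.ofReal (al (W ω) β + K * σ) ∂μ =
        ∫⁻ ω in E', liminf (fun n : ℕ => ENNReal.ofReal (W ω (fl β n) / n + K * σ)) atTop ∂μ := by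
      refine lintegral_congr_ae (ae_restrict_of_ae ?_)
      filter_upwards [P.lsp] with ω hω
      have := lsp_seq (hω β hβ) _ (fl_tendsto β (fun j => (hβ j).le))
      exact (ENNReal.tendsto_ofReal (this.add_const (K * σ))).liminf_eq.symm
    rw [h1]
    refine (lintegral_liminf_le fun n => (((P.Wm _).div_const _).add_const _).ennreal_ofReal).trans ?_
    refine liminf_le_of_frequently_le' (Eventually.frequently ?_)
    filter_upwards [eventually_gt_atTop 0] with n hn using hint n hn
  have hmemE : ∀ᵐ ω ∂(μ.restrict E'), ω ∈ E := by
    filter_upwards [ae_restrict_mem hE'm, ae_restrict_of_ae hE'] with ω h1 h2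
    exact (iff_of_eq h2).1 h1
  have hfin : ∫⁻ ω in E', ENNReal.ofReal (D ω + K * σ) ∂μ ≠ ∞ := by
    have hi3 : Integrable (fun ω => D ω + K * σ) μ := hDi.add (integrable_const _)
    exact hi3.integrableOn.lintegral_lt_top.ne
  have heq := ae_eq_of_ae_le_of_lintegral_le (μ := μ.restrict E')
    (f := fun ω => ENNReal.ofReal (D ω + K * σ)) (g := fun ω => ENNReal.ofReal (al (W ω) β + K * σ))
    (by
      filter_upwards [hmemE] with ω hω
      apply ENNReal.ofReal_le_ofReal
      have : D ω < al (W ω) β := hω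
      linarith) hfin (((P.al_meas β).add_const _).ennreal_ofReal.aemeasurable) hfat
  have hfalse : ∀ᵐ ω ∂(μ.restrict E'), False := by
    filter_upwards [hmemE, heq, ae_restrict_of_ae hD0] with ω h1 h2 h3
    have h4 : D ω < al (W ω) β := h1
    rw [ENNReal.ofReal_eq_ofReal_iff (by linarith) (by linarith)] at h2
    linarith
  have hz : μ E' = 0 := by
    rw [Filter.eventually_false_iff_eq_bot, ae_eq_bot, Measure.restrict_eq_zero] at hfalse
    exact hfalse
  have hzE : μ E = 0 := by rw [← measure_congr hE']; exact hz
  filter_upwards [measure_eq_zero_iff_ae_notMem.1 hzE] with ω hω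
  exact not_lt.1 hω

lemma Proc.upper (P : Proc μ T ζ W g K) :
    ∀ᵐ ω ∂μ, ∀ β : J → ℝ, (∀ j, 0 < β j) → al (W ω) β ≤ ∑ j, β j * Cc μ T ζ g j ω := by
  have h := ae_all_iff.2 fun p : (J → ℕ) × ℕ => P.upper1 (rq p) (rq_pos p)
  filter_upwards [h, P.lsp] with ω h1 h2 β hβ
  have t1 := lsp_cont_seq h2 hβ _ (fun n => rq_pos _) (ap_tendsto β hβ)
  refine le_of_tendsto_of_tendsto' t1 (tendsto_finsetSum _ fun j _ =>
    ((tendsto_pi_nhds.1 (ap_tendsto β hβ) j).mul_const _)) fun n => h1 _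

lemma Proc.lower (P : Proc μ T ζ W g K) :
    ∀ᵐ ω ∂μ, ∀ β : J → ℝ, (∀ j, 0 < β j) → -(K * ∑ j, β j) ≤ al (W ω) β := by
  filter_upwards [P.lsp] with ω h2 β hβ
  have ht := fl_tendsto β (fun j => (hβ j).le)
  have t2 := lsp_seq (h2 β hβ) _ ht
  have t1 := ((tendsto_finsetSum (Finset.univ : Finset J) fun j _ => ht j).const_mul K).neg
  refine le_of_tendsto_of_tendsto' t1 t2 fun n => ?_
  have := P.Wlow ω (fl β n)
  rw [← Finset.sum_div, ← mul_div_assoc, ← neg_div]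
  gcongr

lemma Proc.erg (P : Proc μ T ζ W g K) (he : ErgodicUnder μ T (Set.range ζ)) :
    ∃ c : (J → ℕ) × ℕ → ℝ, ∀ᵐ ω ∂μ, ∀ p, al (W ω) (rq p) = c p := by
  have h : ∀ p : (J → ℕ) × ℕ, ∃ c : ℝ, ∀ᵐ ω ∂μ, al (W ω) (rq p) = c := by
    intro p
    have := exists_eventuallyEq_const_of_forall_separating (l := ae μ)
      (f := fun ω => al (W ω) (rq p)) MeasurableSet (fun U hU => ?_)
    · exact this
    · set E : Set Ω := (fun ω => al (W ω) (rq p)) ⁻¹' U with hE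
      have hEm : MeasurableSet E := P.al_meas _ hU
      obtain ⟨E', hE'm, hE'i, hE'⟩ := P.modif hEm (fun j => by
        filter_upwards [P.inv1 (rq p) (rq_pos p) j] with ω hω
        have : (ω ∈ T (ζ j) ⁻¹' E) = (ω ∈ E) := by
          simp only [hE, Set.mem_preimage, hω]
        exact this)
      rcases he E' hE'm (by rintro _ ⟨j, rfl⟩; exact hE'i j) with h0 | h1
      · right
        rw [measure_congr hE'] at h0
        exact measure_eq_zero_iff_ae_notMem.1 h0
      · left
        rw [measure_congr hE'] at h1
        exact (mem_ae_iff_prob_eq_one hEm).2 h1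
  choose c hc using h
  exact ⟨c, ae_all_iff.2 hc⟩

end proc2
end RWRPX

namespace RWRPX
open RWRP
section paths
variable {d : ℕ} {Ω : Type*} {T : Zd d → Ω → Ω} {R : Finset (Zd d)} {V : Ω → Zd d → ℝ}
  {L : Zd d →+ ℝ}

lemma pos_succ (x : Zd d) (f : ℕ → Zd d) (k : ℕ) : pos x f (k+1) = pos x f k + f k := by
  simp [pos, Finset.sum_range_succ, add_assoc]

lemma pos_congr {x : Zd d} {f h : ℕ → Zd d} {n : ℕ} (e : ∀ i < n, f i = h i) {k : ℕ} (hk : k ≤ n) :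
    pos x f k = pos x h k := by
  unfold pos
  congr 1
  exact Finset.sum_congr rfl fun i hi => e i (lt_of_lt_of_le (Finset.mem_range.1 hi) hk)

lemma pathV_congr {ω : Ω} {x : Zd d} {f h : ℕ → Zd d} {n : ℕ} (e : ∀ i < n, f i = h i) :
    pathV T V ω x n f = pathV T V ω x n h := by
  unfold pathV
  refine Finset.sum_congr rfl fun i hi => ?_
  have hi := Finset.mem_range.1 hi
  rw [pos_congr e hi.le, e i hi]

lemma pathV_succ (ω : Ω) (x : Zd d) (f : ℕ → Zd d) (n : ℕ) :
    pathV T V ω x (n+1) f = pathV T V ω x n f + V (T (pos x f n) ω) (f n) := by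
  simp [pathV, Finset.sum_range_succ]

lemma pathV_mono (hV : ∀ ω, ∀ z ∈ R, -L z ≤ V ω z) (ω : Ω) (x : Zd d) (f : ℕ → Zd d) {n : ℕ}
    (hf : ∀ i < n, f i ∈ R) {m : ℕ} (hm : m ≤ n) :
    pathV T V ω x m f + L (pos x f m) ≤ pathV T V ω x n f + L (pos x f n) := by
  induction n with
  | zero => rw [Nat.le_zero.1 hm]
  | succ n ih =>
    rcases Nat.lt_or_ge n m with h | h
    · rw [le_antisymm hm h]
    · refine (ih (fun i hi => hf i (by omega)) h).trans ?_
      rw [pathV_succ, pos_succ, map_add]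
      have := hV (T (pos x f n) ω) (f n) (hf n (by omega))
      linarith

lemma stepF_mem {n : ℕ} (s : Fin n → {z : Zd d // z ∈ R}) : ∀ i < n, stepF n s i ∈ R := by
  intro i hi
  simp [stepF, hi]

lemma stepF_of {n : ℕ} {f : ℕ → Zd d} (hf : ∀ i < n, f i ∈ R) :
    ∃ s : Fin n → {z : Zd d // z ∈ R}, ∀ i < n, f i = stepF n s i :=
  ⟨fun i => ⟨f i, hf i i.2⟩, fun i hi => by simp [stepF, hi]⟩

def ISet (T : Zd d → Ω → Ω) (V : Ω → Zd d → ℝ) (R : Finset (Zd d)) (ω : Ω) (y : Zd d) : Set ℝ :=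
  {v : ℝ | ∃ n : ℕ, ∃ s : Fin (n+1) → {z : Zd d // z ∈ R},
      firstHit 0 y (n+1) (stepF (n+1) s) ∧ v = pathV T V ω 0 (n+1) (stepF (n+1) s)}

lemma aInf_zero (ω : Ω) : aInf T V R ω 0 0 = 0 := by simp [aInf]

lemma aInf_eq (ω : Ω) {y : Zd d} (hy : y ≠ 0) : aInf T V R ω 0 y = sInf (ISet T V R ω y) := by
  simp [aInf, hy, ISet]

lemma pos_zero' (f : ℕ → Zd d) : pos 0 f 0 = 0 := by simp [pos]

lemma ISet_low (hV : ∀ ω, ∀ z ∈ R, -L z ≤ V ω z) (ω : Ω) (y : Zd d) :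
    ∀ v ∈ ISet T V R ω y, -L y ≤ v := by
  rintro v ⟨n, s, ⟨h1, h2⟩, rfl⟩
  have := pathV_mono (T := T) (m := 0) hV ω 0 (stepF (n+1) s) (stepF_mem s) (by omega)
  rw [h1, pos_zero'] at this
  simp [pathV] at this ⊢
  linarith

lemma ISet_cut (hV : ∀ ω, ∀ z ∈ R, -L z ≤ V ω z) (ω : Ω) {y : Zd d} (hy : y ≠ 0) {n : ℕ}
    {f : ℕ → Zd d} (hf : ∀ i < n, f i ∈ R) (hp : pos 0 f n = y) :
    ∃ v ∈ ISet T V R ω y, v ≤ pathV T V ω 0 n f := by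
  have hex : ∃ m, pos 0 f m = y := ⟨n, hp⟩
  set m := Nat.find hex with hm
  have hmp : pos 0 f m = y := Nat.find_spec hex
  have hmn : m ≤ n := Nat.find_min' hex hp
  have hm0 : m ≠ 0 := by
    intro h
    rw [h, pos_zero'] at hmp
    exact hy hmp.symm
  obtain ⟨k, hk⟩ := Nat.exists_eq_succ_of_ne_zero hm0
  obtain ⟨s, hs⟩ := stepF_of (n := k+1) (f := f) (R := R) (fun i hi => hf i (by omega))
  refine ⟨pathV T V ω 0 (k+1) (stepF (k+1) s), ⟨k, s, ⟨?_, ?_⟩, rfl⟩, ?_⟩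
  · rw [← pos_congr hs le_rfl, ← hmp, hk]
  · intro i hi
    rw [Finset.mem_Ioo] at hi
    rw [← pos_congr hs hi.2.le]
    exact Nat.find_min hex (by omega)
  · rw [← pathV_congr hs]
    have := pathV_mono (T := T) hV ω 0 f hf (m := k+1) (by omega)
    have e : pos 0 f (k+1) = y := by rw [← hmp, hk]
    rw [hp, e] at this
    linarith

lemma aInf_le (hV : ∀ ω, ∀ z ∈ R, -L z ≤ V ω z) (ω : Ω) {y : Zd d} {n : ℕ}
    {f : ℕ → Zd d} (hf : ∀ i < n, f i ∈ R) (hp : pos 0 f n = y) :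
    aInf T V R ω 0 y ≤ pathV T V ω 0 n f := by
  by_cases hy : y = 0
  · subst hy
    rw [aInf_zero]
    have := pathV_mono (T := T) (m := 0) hV ω 0 f hf (by omega)
    rw [hp, pos_zero'] at this
    simpa [pathV] using this
  · rw [aInf_eq ω hy]
    obtain ⟨v, hv, hle⟩ := ISet_cut (T := T) hV ω hy hf hp
    exact (csInf_le ⟨_, ISet_low hV ω y⟩ hv).trans hle

lemma reach {x : Zd d} (hx : x ∈ Gp R) : ∃ (n : ℕ) (f : ℕ → Zd d), (∀ i < n, f i ∈ R) ∧ pos 0 f n = x := by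
  have hstep : ∀ (x z : Zd d), z ∈ R → (∃ (n : ℕ) (f : ℕ → Zd d), (∀ i < n, f i ∈ R) ∧ pos 0 f n = x) →
      (∃ (n : ℕ) (f : ℕ → Zd d), (∀ i < n, f i ∈ R) ∧ pos 0 f n = x + z) := by
    rintro x z hz ⟨n, f, hf, hp⟩
    have e : ∀ i < n, Function.update f n z i = f i := fun i hi => by
      rw [Function.update_of_ne (by omega)]
    refine ⟨n+1, Function.update f n z, fun i hi => ?_, ?_⟩
    · rcases Nat.lt_succ_iff_lt_or_eq.1 hi with h | h
      · rw [e i h]; exact hf i h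
      · subst h; simpa using hz
    · rw [pos_succ, pos_congr e le_rfl, hp]; simp
  obtain ⟨b, rfl⟩ := hx
  have : ∀ S : Finset (Zd d), S ⊆ R → (∃ (n : ℕ) (f : ℕ → Zd d), (∀ i < n, f i ∈ R) ∧ pos 0 f n = ∑ z ∈ S, b z • z) := by
    intro S
    induction S using Finset.induction_on with
    | empty => intro _; exact ⟨0, fun _ => 0, by simp, by simp [pos]⟩
    | insert z S hz ih =>
      intro hS
      rw [Finset.sum_insert hz, add_comm]
      have h1 := ih (fun w hw => hS (Finset.mem_insert_of_mem hw))
      have hzR := hS (Finset.mem_insert_self z S)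
      have : ∀ k : ℕ, (∃ (n : ℕ) (f : ℕ → Zd d), (∀ i < n, f i ∈ R) ∧ pos 0 f n = ∑ z ∈ S, b z • z + k • z) := by
        intro k
        induction k with
        | zero => simpa using h1
        | succ k ih => rw [succ_nsmul, ← add_assoc]; exact hstep _ _ hzR ih
      exact this _
  exact this R (Finset.Subset.refl _)

lemma aInf_approx (hV : ∀ ω, ∀ z ∈ R, -L z ≤ V ω z) (ω : Ω) {y : Zd d} (hy : y ∈ Gp R) {ε : ℝ}
    (hε : 0 < ε) : ∃ (n : ℕ) (f : ℕ → Zd d), (∀ i < n, f i ∈ R) ∧ pos 0 f n = y ∧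
      pathV T V ω 0 n f < aInf T V R ω 0 y + ε := by
  by_cases h : y = 0
  · subst h
    refine ⟨0, fun _ => 0, by simp, by simp [pos], ?_⟩
    rw [aInf_zero]; simpa [pathV] using hε
  · obtain ⟨n, f, hf, hp⟩ := reach hy
    obtain ⟨v, hv, -⟩ := ISet_cut (T := T) hV ω h hf hp
    obtain ⟨w, ⟨k, s, hs, rfl⟩, hw⟩ := exists_lt_of_csInf_lt (s := ISet T V R ω y) ⟨v, hv⟩
      (show sInf (ISet T V R ω y) < sInf (ISet T V R ω y) + ε by linarith)
    exact ⟨k+1, stepF (k+1) s, stepF_mem s, hs.1, by rw [aInf_eq ω h]; exact hw⟩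

lemma aInf_low (hV : ∀ ω, ∀ z ∈ R, -L z ≤ V ω z) (ω : Ω) {y : Zd d} (hy : y ∈ Gp R) :
    -L y ≤ aInf T V R ω 0 y := by
  by_contra hcon
  push Not at hcon
  obtain ⟨n, f, hf, hp, h⟩ := aInf_approx (T := T) hV ω hy (show 0 < -L y - aInf T V R ω 0 y by linarith)
  have := pathV_mono (T := T) (m := 0) hV ω 0 f hf (by omega)
  rw [hp, pos_zero'] at this
  simp only [pathV, Finset.range_zero, Finset.sum_empty, map_zero] at this h
  linarith

lemma aInf_sub (hT : ∀ x y, T (x + y) = T x ∘ T y) (hV : ∀ ω, ∀ z ∈ R, -L z ≤ V ω z) (ω : Ω)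
    {x y : Zd d} (hx : x ∈ Gp R) (hy : y ∈ Gp R) :
    aInf T V R ω 0 (x + y) ≤ aInf T V R ω 0 x + aInf T V R (T x ω) 0 y := by
  refine le_of_forall_pos_le_add fun ε hε => ?_
  obtain ⟨n, f, hf, hp, h1⟩ := aInf_approx (T := T) hV ω hx (half_pos hε)
  obtain ⟨m, h, hh, hq, h2⟩ := aInf_approx (T := T) hV (T x ω) hy (half_pos hε)
  set k : ℕ → Zd d := fun i => if i < n then f i else h (i - n) with hk
  have e : ∀ i < n, k i = f i := fun i hi => by simp [hk, hi]
  have hpos : ∀ j, pos 0 k (n + j) = x + pos 0 h j := by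
    intro j
    induction j with
    | zero => rw [add_zero, pos_congr e le_rfl, hp, pos_zero', add_zero]
    | succ j ih => rw [← add_assoc, pos_succ, ih, pos_succ, add_assoc]; simp [hk]
  have hpv : ∀ j, pathV T V ω 0 (n + j) k = pathV T V ω 0 n f + pathV T V (T x ω) 0 j h := by
    intro j
    induction j with
    | zero => rw [add_zero, pathV_congr e]; simp [pathV]
    | succ j ih =>
      rw [← add_assoc, pathV_succ, ih, pathV_succ, hpos, add_comm x, hT, add_assoc]
      simp [hk]
  have := aInf_le (T := T) hV ω (y := x + y) (n := n + m) (f := k) (fun i hi => by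
    simp only [hk]; split_ifs with hin
    · exact hf i hin
    · exact hh _ (by omega)) (by rw [hpos, hq])
  rw [hpv] at this
  linarith

lemma aInf_one (hT0 : T 0 = id) (hV : ∀ ω, ∀ z ∈ R, -L z ≤ V ω z) (ω : Ω) {z : Zd d} (hz : z ∈ R) :
    aInf T V R ω 0 z ≤ V ω z := by
  have := aInf_le (T := T) hV ω (y := z) (n := 1) (f := fun _ => z) (fun _ _ => hz) (by simp [pos])
  simpa [pathV, pos, hT0] using this

lemma aInf_meas [MeasurableSpace Ω] (hT : ∀ z, Measurable (T z)) (hV : ∀ z, Measurable fun ω => V ω z)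
    (y : Zd d) : Measurable fun ω => aInf T V R ω 0 y := by
  by_cases hy : y = 0
  · subst hy; simp only [aInf_zero]; exact measurable_const
  · have e : ∀ ω, aInf T V R ω 0 y = ⨅ i : {p : Σ n : ℕ, Fin (n+1) → {z : Zd d // z ∈ R} //
        firstHit 0 y (p.1+1) (stepF (p.1+1) p.2)}, pathV T V ω 0 (i.1.1+1) (stepF (i.1.1+1) i.1.2) := by
      intro ω
      rw [aInf_eq ω hy]
      unfold iInf
      congr 1
      ext v
      constructor
      · rintro ⟨n, s, h1, h2⟩
        exact ⟨⟨⟨n, s⟩, h1⟩, h2.symm⟩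
      · rintro ⟨⟨⟨n, s⟩, h1⟩, h2⟩
        exact ⟨n, s, h1, h2.symm⟩
    simp_rw [e]
    refine Measurable.iInf fun i => ?_
    unfold pathV
    exact Finset.measurable_sum _ fun k _ => (hV _).comp (hT _)

lemma aInf_congr {V' : Ω → Zd d → ℝ} {ω : Ω} (h : ∀ x, ∀ z ∈ R, V (T x ω) z = V' (T x ω) z) (y : Zd d) :
    aInf T V R ω 0 y = aInf T V' R ω 0 y := by
  have : ∀ (n : ℕ) (s : Fin (n+1) → {z : Zd d // z ∈ R}),
      pathV T V ω 0 (n+1) (stepF (n+1) s) = pathV T V' ω 0 (n+1) (stepF (n+1) s) := by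
    intro n s
    unfold pathV
    exact Finset.sum_congr rfl fun i hi => h _ _ (stepF_mem s i (Finset.mem_range.1 hi))
  unfold aInf
  simp_rw [this]
end paths
end RWRPX

namespace RWRPX
open RWRP
section geo
variable {d : ℕ}

lemma ii_line {A : Set (Fin d → ℝ)} {x y : Fin d → ℝ} (hx : x ∈ intrinsicInterior ℝ A)
    (hy : y ∈ affineSpan ℝ A) : ∃ ε > (0:ℝ), ∀ t : ℝ, |t| < ε → x + t • (y - x) ∈ A := by
  rw [mem_intrinsicInterior] at hx
  obtain ⟨x', hx', rfl⟩ := hx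
  set f : ℝ → affineSpan ℝ A := fun t => ⟨AffineMap.lineMap (x' : Fin d → ℝ) y t,
    AffineMap.lineMap_mem t x'.2 hy⟩ with hf
  have hc : Continuous f := by
    refine Continuous.subtype_mk ?_ _
    exact AffineMap.lineMap_continuous
  have h0 : f 0 = x' := by ext1; simp [hf]
  have : f ⁻¹' (interior ((↑) ⁻¹' A)) ∈ 𝓝 (0:ℝ) :=
    hc.continuousAt.preimage_mem_nhds (by rw [h0]; exact isOpen_interior.mem_nhds hx')
  obtain ⟨ε, hε, h⟩ := Metric.mem_nhds_iff.1 this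
  refine ⟨ε, hε, fun t ht => ?_⟩
  have h1 : f t ∈ ((↑) ⁻¹' A : Set (affineSpan ℝ A)) :=
    interior_subset (h (by simpa [Metric.mem_ball, Real.dist_eq] using ht))
  have h2 : ((f t : affineSpan ℝ A) : Fin d → ℝ) ∈ A := h1
  simp only [hf, AffineMap.lineMap_apply, vsub_eq_sub, vadd_eq_add] at h2
  rwa [add_comm]

lemma span_aff {A : Set (Fin d → ℝ)} (h0 : (0 : Fin d → ℝ) ∈ A) {x : Fin d → ℝ}
    (hx : x ∈ Submodule.span ℝ A) : x ∈ affineSpan ℝ A := by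
  have h0' := subset_affineSpan ℝ A h0
  induction hx using Submodule.span_induction with
  | mem x hx => exact subset_affineSpan ℝ A hx
  | zero => exact h0'
  | add x y _ _ hx hy =>
    have := (affineSpan ℝ A).smul_vsub_vadd_mem 1 hx h0' hy
    simpa using this
  | smul c x _ hx =>
    have := (affineSpan ℝ A).smul_vsub_vadd_mem c hx h0' h0'
    simpa using this

lemma toR_add (x y : Zd d) : toR (x + y) = toR x + toR y := by ext; simp [toR]
lemma toR_zero : toR (0 : Zd d) = 0 := by ext; simp [toR]

def toRH (d : ℕ) : Zd d →+ (Fin d → ℝ) := ⟨⟨toR, toR_zero⟩, toR_add⟩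

lemma exists_ell {R : Finset (Zd d)} {U₀ : Set (Fin d → ℝ)} (h : IsZeroFace R U₀) :
    ∃ ℓ : (Fin d → ℝ) →ₗ[ℝ] ℝ, (∀ z ∈ R, toR z ∈ U₀ → ℓ (toR z) = 0) ∧
      (∀ z ∈ R, toR z ∉ U₀ → 1 ≤ ℓ (toR z)) := by
  set Q : Set (Fin d → ℝ) := convexHull ℝ (toR '' {z | z ∈ R ∧ toR z ∉ U₀}) with hQ
  have hfinite : (toR '' {z | z ∈ R ∧ toR z ∉ U₀}).Finite :=
    (R.finite_toSet.subset fun z hz => hz.1).image _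
  have hQc : IsCompact Q := hfinite.isCompact_convexHull ℝ
  have hQU : Q ⊆ hullU R := convexHull_mono (Set.image_mono fun z hz => hz.1)
  have hdis : Disjoint ((Submodule.span ℝ U₀ : Submodule ℝ (Fin d → ℝ)) : Set (Fin d → ℝ)) Q := by
    rw [Set.disjoint_left]
    intro q hqL hqQ
    rcases h with ⟨h0, hface, hint⟩ | ⟨h0, rfl⟩
    · have h0' : (0 : Fin d → ℝ) ∈ U₀ := intrinsicInterior_subset hint
      have hq : q ∈ affineSpan ℝ U₀ := span_aff h0' hqL
      obtain ⟨ε, hε, hl⟩ := ii_line hint hq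
      have h1 := hl (-(ε/2)) (by rw [abs_neg, abs_of_pos (by positivity)]; linarith)
      simp only [zero_add, sub_zero] at h1
      have hqU₀ : q ∈ U₀ := by
        have hpos : 0 < 1 + ε/2 := by positivity
        refine (hface.2.2 (ξ := 0) (ζ := q) (η := -(ε/2) • q) (t := (ε/2)/(1+ε/2)) h0' (hQU hqQ)
          (hface.1 h1) ⟨by positivity, by rw [div_lt_one hpos]; linarith⟩ ?_).1
        rw [smul_smul, ← add_smul]
        have : ε / 2 / (1 + ε / 2) + (1 - ε / 2 / (1 + ε / 2)) * -(ε / 2) = 0 := by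
          field_simp; ring
        rw [this, zero_smul]
      have hconv : Convex ℝ (hullU R \ U₀) := by
        rw [convex_iff_openSegment_subset]
        rintro x ⟨hx, hxU⟩ y ⟨hy, hyU⟩ w ⟨a, b, ha, hb, hab, rfl⟩
        refine ⟨(convex_convexHull ℝ _) hx hy ha.le hb.le hab, fun hw => ?_⟩
        exact hxU (hface.2.2 hw hx hy (t := a) ⟨ha, by linarith⟩ (by
          have : b = 1 - a := by linarith
          rw [this])).1
      have : Q ⊆ hullU R \ U₀ := by
        refine convexHull_min ?_ hconv
        rintro _ ⟨z, hz, rfl⟩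
        exact ⟨subset_convexHull ℝ _ ⟨z, hz.1, rfl⟩, hz.2⟩
      exact (this hqQ).2 hqU₀
    · simp at hqL
      subst hqL
      exact h0 (hQU hqQ)
  obtain ⟨f, u, v, hf1, huv, hf2⟩ := geometric_hahn_banach_closed_compact
    (Submodule.convex _) (Submodule.closed_of_finiteDimensional _) (convex_convexHull ℝ _) hQc hdis
  have hu : 0 < u := by simpa using hf1 0 (Submodule.zero_mem _)
  have hf0 : ∀ x ∈ Submodule.span ℝ U₀, f x = 0 := by
    intro x hx
    by_contra hne
    have := hf1 ((u / f x) • x) (Submodule.smul_mem _ _ hx)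
    rw [map_smul, smul_eq_mul, div_mul_cancel₀ _ hne] at this
    exact lt_irrefl _ this
  refine ⟨(v⁻¹ • f : (Fin d → ℝ) →L[ℝ] ℝ).toLinearMap, fun z hz hU => ?_, fun z hz hU => ?_⟩
  · have := hf0 _ (Submodule.subset_span hU)
    simp [this]
  · have h1 := hf2 (toR z) (subset_convexHull ℝ _ ⟨z, ⟨hz, hU⟩, rfl⟩)
    have hv : 0 < v := hu.trans huv
    simp only [ContinuousLinearMap.coe_coe, ContinuousLinearMap.smul_apply, smul_eq_mul]
    rw [inv_mul_eq_div, le_div_iff₀ hv]; linarith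

lemma exists_L {Ω : Type*} [MeasurableSpace Ω] {μ : Measure Ω} {V : Ω → Zd d → ℝ} {R : Finset (Zd d)}
    {U₀ : Set (Fin d → ℝ)} (h : IsZeroFace R U₀) (hi : AssumptionI μ V R U₀) :
    ∃ L : Zd d →+ ℝ, (∀ z ∈ R, 0 ≤ L z) ∧ ∀ z ∈ R, ∀ᵐ ω ∂μ, -L z ≤ V ω z := by
  obtain ⟨ℓ, h1, h2⟩ := exists_ell h
  obtain ⟨h0, c, hc⟩ := hi
  refine ⟨((|c| • ℓ).toAddMonoidHom).comp (toRH d), fun z hz => ?_, fun z hz => ?_⟩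
  · show 0 ≤ |c| * ℓ (toR z)
    by_cases hU : toR z ∈ U₀
    · rw [h1 z hz hU, mul_zero]
    · have := h2 z hz hU; positivity
  · show ∀ᵐ ω ∂μ, -(|c| * ℓ (toR z)) ≤ V ω z
    by_cases hU : toR z ∈ U₀
    · filter_upwards [h0 z ⟨hz, hU⟩] with ω hω
      rw [h1 z hz hU]; simpa using hω
    · filter_upwards [hc z hz hU] with ω hω
      have h3 := h2 z hz hU
      have := neg_abs_le c
      nlinarith [abs_nonneg c]
end geo
end RWRPX

namespace RWRPX
open RWRP
section lat
variable {d : ℕ} {J : Type*} [Fintype J]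

def Phi (ζ : J → Zd d) : (J → ℝ) →ₗ[ℝ] (Fin d → ℝ) :=
  ∑ j, (LinearMap.proj j : (J → ℝ) →ₗ[ℝ] ℝ).smulRight (toR (ζ j))

lemma Phi_apply (ζ : J → Zd d) (β : J → ℝ) : Phi ζ β = ∑ j, β j • toR (ζ j) := by
  simp [Phi]

lemma Phi_cont (ζ : J → Zd d) : Continuous (Phi ζ) := LinearMap.continuous_of_finiteDimensional _

lemma toR_sum (c : J → ℤ) (ζ : J → Zd d) : toR (∑ j, c j • ζ j) = Phi ζ (fun j => (c j : ℝ)) := by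
  rw [Phi_apply]
  ext i
  simp [toR, Finset.sum_apply]

lemma toR_ph (b : J → ℕ) (ζ : J → Zd d) : toR (ph ζ b) = Phi ζ (fun j => (b j : ℝ)) := by
  rw [Phi_apply]
  ext i
  simp [toR, ph, Finset.sum_apply]

lemma n1_nonneg (ξ : Fin d → ℝ) : 0 ≤ n1 ξ := Finset.sum_nonneg fun _ _ => abs_nonneg _
lemma n1_cont : Continuous (n1 : (Fin d → ℝ) → ℝ) := by unfold n1; fun_prop
lemma n1_smul (s : ℝ) (hs : 0 ≤ s) (ξ : Fin d → ℝ) : n1 (s • ξ) = s * n1 ξ := by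
  simp [n1, abs_mul, Finset.mul_sum, abs_of_nonneg hs]
lemma n1_zero_iff {ξ : Fin d → ℝ} : n1 ξ = 0 ↔ ξ = 0 := by
  unfold n1
  rw [Finset.sum_eq_zero_iff_of_nonneg fun _ _ => abs_nonneg _]
  simp [funext_iff]
lemma norm_le_n1 (ξ : Fin d → ℝ) : ‖ξ‖ ≤ n1 ξ := by
  rw [pi_norm_le_iff_of_nonneg (n1_nonneg ξ)]
  intro i
  exact Finset.single_le_sum (f := fun i => |ξ i|) (fun _ _ => abs_nonneg _) (Finset.mem_univ i)

lemma bdd_coef (ζ : J → Zd d) : ∃ D : ℝ, 0 ≤ D ∧ ∀ β : J → ℝ, (∀ j, 0 ≤ β j) →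
    ∃ γ : J → ℝ, (∀ j, 0 ≤ γ j) ∧ Phi ζ γ = Phi ζ β ∧ ∑ j, γ j ≤ D * n1 (Phi ζ β) := by
  by_contra hcon
  push Not at hcon
  have hcon' := fun n : ℕ => hcon ((n:ℝ) + 1) (by positivity)
  -- approximate minimizers
  have hmin : ∀ n : ℕ, ∃ β : J → ℝ, (∀ j, 0 ≤ β j) ∧ ((n:ℝ)+1) * n1 (Phi ζ β) < ∑ j, β j ∧ 0 < ∑ j, β j ∧
      ∀ γ : J → ℝ, (∀ j, 0 ≤ γ j) → Phi ζ γ = Phi ζ β → (2/3) * ∑ j, β j ≤ ∑ j, γ j := by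
    intro n
    obtain ⟨β, hβ, h⟩ := hcon' n
    set S : Set ℝ := {s | ∃ γ : J → ℝ, (∀ j, 0 ≤ γ j) ∧ Phi ζ γ = Phi ζ β ∧ s = ∑ j, γ j} with hS
    have hSb : ∀ s ∈ S, ((n:ℝ)+1) * n1 (Phi ζ β) ≤ s := by
      rintro s ⟨γ, h1, h2, rfl⟩; exact (h γ h1 h2).le
    have hbdd : BddBelow S := ⟨_, hSb⟩
    have hne : S.Nonempty := ⟨_, β, hβ, rfl, rfl⟩
    have hx0 : 0 < n1 (Phi ζ β) := by
      rcases (n1_nonneg (Phi ζ β)).lt_or_eq with h' | h'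
      · exact h'
      · exfalso
        have h2 := n1_zero_iff.1 h'.symm
        have := h 0 (fun _ => le_rfl) (by rw [map_zero, h2])
        rw [← h'] at this
        simp at this
    have hm0 : 0 < sInf S := lt_of_lt_of_le (by positivity) (le_csInf hne hSb)
    obtain ⟨s, ⟨γ, h1, h2, rfl⟩, hs⟩ := exists_lt_of_csInf_lt hne (show sInf S < 3/2 * sInf S by linarith)
    refine ⟨γ, h1, by rw [h2]; exact h γ h1 h2, hm0.trans_le (csInf_le hbdd ⟨γ, h1, h2, rfl⟩), fun δ h3 h4 => ?_⟩
    have := csInf_le hbdd (show ∑ j, δ j ∈ S from ⟨δ, h3, h4.trans h2, rfl⟩)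
    linarith
  choose β hβ0 hβn hβp hβm using hmin
  set γ : ℕ → J → ℝ := fun n => (∑ j, β n j)⁻¹ • β n with hγ
  have hγs : ∀ n, γ n ∈ stdSimplex ℝ J := by
    intro n
    refine ⟨fun j => mul_nonneg (inv_nonneg.2 (hβp n).le) (hβ0 n j), ?_⟩
    simp only [hγ, Pi.smul_apply, smul_eq_mul]
    rw [← Finset.mul_sum, inv_mul_cancel₀ (hβp n).ne']
  obtain ⟨γ₀, hγ₀, φ, hφ, hlim⟩ := (isCompact_stdSimplex ℝ J).tendsto_subseq hγs
  have hPhi : Phi ζ γ₀ = 0 := by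
    rw [← n1_zero_iff]
    have h1 : Tendsto (fun n => n1 (Phi ζ (γ (φ n)))) atTop (𝓝 (n1 (Phi ζ γ₀))) :=
      ((n1_cont.comp (Phi_cont ζ)).tendsto γ₀).comp hlim
    have h2 : Tendsto (fun n => 1 / (((φ n : ℕ):ℝ) + 1)) atTop (𝓝 0) :=
      (tendsto_one_div_add_atTop_nhds_zero_nat (𝕜 := ℝ)).comp hφ.tendsto_atTop
    refine tendsto_nhds_unique h1 (squeeze_zero (fun n => n1_nonneg _) (fun n => ?_) h2)
    simp only [hγ]
    rw [map_smul, n1_smul _ (inv_nonneg.2 (hβp _).le), inv_mul_eq_div, div_le_div_iff₀ (hβp _) (by positivity)]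
    have := hβn (φ n)
    linarith
  have hev : ∀ᶠ n in atTop, ∀ j, γ₀ j / 2 ≤ γ (φ n) j := by
    rw [Filter.eventually_all]
    intro j
    have h1 := tendsto_pi_nhds.1 hlim j
    rcases (hγ₀.1 j).lt_or_eq with h | h
    · filter_upwards [h1.eventually (lt_mem_nhds (show γ₀ j / 2 < γ₀ j by linarith))] with n hn using hn.le
    · refine Eventually.of_forall fun n => ?_
      rw [← h]; simpa using (hγs (φ n)).1 j
  obtain ⟨n, hn⟩ := hev.exists
  set s := ∑ j, β (φ n) j with hs
  have hs0 : 0 < s := hβp (φ n)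
  have e : β (φ n) = s • γ (φ n) := by
    simp only [hγ]
    rw [smul_smul, mul_inv_cancel₀ hs0.ne', one_smul]
  have := hβm (φ n) (s • (γ (φ n) - (2:ℝ)⁻¹ • γ₀)) (fun j => by
    simp only [Pi.smul_apply, Pi.sub_apply, smul_eq_mul]
    have := hn j
    exact mul_nonneg hs0.le (by linarith)) (by
    rw [map_smul, map_sub, map_smul (Phi ζ) _ γ₀, hPhi, smul_zero, sub_zero, ← map_smul, ← e])
  simp only [Pi.smul_apply, Pi.sub_apply, smul_eq_mul] at this
  rw [← Finset.mul_sum, Finset.sum_sub_distrib, ← Finset.mul_sum, (hγs (φ n)).2, hγ₀.2] at this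
  linarith

lemma int_rep (ζ : J → Zd d) : ∃ E : ℝ, 0 ≤ E ∧ ∀ (b : J → ℤ) (v : J → ℝ),
    Phi ζ v = Phi ζ (fun j => (b j : ℝ)) →
    ∃ c : J → ℤ, ∑ j, c j • ζ j = ∑ j, b j • ζ j ∧ ∀ j, |(c j : ℝ) - v j| ≤ E := by
  set M : ℝ := ∑ j, ‖toR (ζ j)‖ with hM
  set m : ℤ := ⌈M⌉ with hm
  set S : Finset (Zd d) := Finset.Icc (fun _ => -m) (fun _ => m) with hS
  set e : Zd d → J → ℤ := fun u => if h : ∃ c : J → ℤ, ∑ j, c j • ζ j = u then h.choose else 0 with he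
  refine ⟨1 + ∑ u ∈ S, ∑ j, |(e u j : ℝ)|, by positivity, fun b v hv => ?_⟩
  set u : Zd d := ∑ j, (b j - ⌊v j⌋) • ζ j with hu
  have hex : ∃ c : J → ℤ, ∑ j, c j • ζ j = u := ⟨_, rfl⟩
  have heu : ∑ j, e u j • ζ j = u := by
    simp only [he, hex, dif_pos]
    exact hex.choose_spec
  have huR : toR u = Phi ζ (fun j => Int.fract (v j)) := by
    rw [hu, toR_sum]
    have e1 : (fun j => ((b j - ⌊v j⌋ : ℤ) : ℝ)) = (fun j => (b j : ℝ)) - (fun j => ((⌊v j⌋ : ℤ) : ℝ)) := by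
      ext j; simp
    have e2 : (fun j => Int.fract (v j)) = v - (fun j => ((⌊v j⌋ : ℤ) : ℝ)) := by
      ext j; rfl
    rw [e1, e2, map_sub, map_sub, hv]
  have hun : ‖toR u‖ ≤ M := by
    rw [huR, Phi_apply]
    refine (norm_sum_le _ _).trans (Finset.sum_le_sum fun j _ => ?_)
    rw [norm_smul, Real.norm_of_nonneg (Int.fract_nonneg _)]
    exact mul_le_of_le_one_left (norm_nonneg _) (Int.fract_lt_one _).le
  have huS : u ∈ S := by
    have h1 : ∀ i, |u i| ≤ m := by
      intro i
      have h2 : |(u i : ℝ)| ≤ m := (norm_le_pi_norm (toR u) i).trans (hun.trans (Int.le_ceil M))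
      exact_mod_cast h2
    rw [hS, Finset.mem_Icc]
    exact ⟨fun i => (abs_le.1 (h1 i)).1, fun i => (abs_le.1 (h1 i)).2⟩
  refine ⟨fun j => ⌊v j⌋ + e u j, ?_, fun j => ?_⟩
  · simp only [add_smul, Finset.sum_add_distrib]
    rw [heu, hu, ← Finset.sum_add_distrib]
    refine Finset.sum_congr rfl fun j _ => ?_
    rw [← add_smul]; congr 1; ring
  · have h1 : |(e u j : ℝ)| ≤ ∑ u ∈ S, ∑ j, |(e u j : ℝ)| := by
      refine le_trans ?_ (Finset.single_le_sum (f := fun u => ∑ j, |(e u j : ℝ)|) (fun _ _ => by positivity) huS)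
      exact Finset.single_le_sum (f := fun j => |(e u j : ℝ)|) (fun _ _ => by positivity) (Finset.mem_univ j)
    have h2 : |((⌊v j⌋ : ℤ) : ℝ) - v j| ≤ 1 := by
      rw [abs_le]
      constructor
      · have := Int.lt_floor_add_one (v j); linarith
      · have := Int.floor_le (v j); linarith
    push_cast
    calc |((⌊v j⌋ : ℤ) : ℝ) + (e u j : ℝ) - v j| = |(((⌊v j⌋ : ℤ) : ℝ) - v j) + (e u j : ℝ)| := by ring_nf
      _ ≤ _ := (abs_add_le _ _).trans (add_le_add h2 h1)

/-- local shape property in space -/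
def LSX (ζ : J → Zd d) (w : Zd d → ℝ) (ξ : Fin d → ℝ) (a : ℝ) : Prop :=
  ∀ η > (0:ℝ), ∃ ε > (0:ℝ), ∃ N : ℝ, ∀ t ≥ N, ∀ b : J → ℕ,
    ‖toR (ph ζ b) - t • ξ‖ ≤ ε * t → |w (ph ζ b) - t * a| ≤ η * t

lemma lsx_of_lsp {ζ : J → Zd d} {w : Zd d → ℝ} {β : J → ℝ} (hβ : ∀ j, 0 < β j) {a : ℝ}
    (h : LSP (fun b => w (ph ζ b)) β a) : LSX ζ w (Phi ζ β) a := by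
  intro η hη
  obtain ⟨ε, hε, N, hN⟩ := h η hη
  obtain ⟨S, hS⟩ := LinearMap.exists_rightInverse_of_surjective (Phi ζ).rangeRestrict
    (LinearMap.range_rangeRestrict _)
  set Sc := LinearMap.toContinuousLinearMap S with hSc
  obtain ⟨E, hE, hrep⟩ := int_rep ζ
  -- uniform positivity
  obtain ⟨m, hm, hmβ⟩ : ∃ m > (0:ℝ), ∀ j, m ≤ β j := by
    by_cases hne : Nonempty J
    · obtain ⟨j0, h0⟩ := Finite.exists_min β
      exact ⟨β j0, hβ j0, h0⟩
    · exact ⟨1, one_pos, fun j => absurd ⟨j⟩ hne⟩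
  set q : ℝ := min ε m / 2 with hq
  have hq0 : 0 < q := by positivity
  have hqε : 2 * q ≤ ε := by have := min_le_left ε m; linarith
  have hqm : 2 * q ≤ m := by have := min_le_right ε m; linarith
  refine ⟨q / (‖Sc‖ + 1), by positivity, max (max N 1) (E / q), fun t ht b hb => ?_⟩
  have ht1 : N ≤ t := le_trans (le_trans (le_max_left _ _) (le_max_left _ _)) ht
  have ht2 : 1 ≤ t := le_trans (le_trans (le_max_right _ _) (le_max_left _ _)) ht
  have ht3 : E ≤ q * t := by
    have := le_trans (le_max_right _ _) ht
    rw [div_le_iff₀ hq0] at this; linarith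
  set y : LinearMap.range (Phi ζ) := (Phi ζ).rangeRestrict ((fun j => (b j : ℝ)) - t • β) with hy
  have hyv : (y : Fin d → ℝ) = toR (ph ζ b) - t • Phi ζ β := by
    show Phi ζ ((fun j => (b j : ℝ)) - t • β) = _
    rw [map_sub, map_smul, toR_ph]
  set γ := Sc y with hγ
  have hγy : Phi ζ γ = y := by
    have := congrArg (fun f => ((f y : LinearMap.range (Phi ζ)) : Fin d → ℝ)) hS
    simpa [hγ, hSc] using this
  have hγn : ‖γ‖ ≤ q * t := by
    refine (Sc.le_opNorm y).trans ?_
    have h1 : ‖y‖ ≤ q / (‖Sc‖ + 1) * t := by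
      have h0 : ‖y‖ = ‖(y : Fin d → ℝ)‖ := rfl
      rw [h0, hyv]; exact hb
    calc ‖Sc‖ * ‖y‖ ≤ (‖Sc‖ + 1) * (q / (‖Sc‖ + 1) * t) := by gcongr; linarith
      _ = q * t := by field_simp
  obtain ⟨c, hc1, hc2⟩ := hrep (fun j => (b j : ℤ)) (t • β + γ) (by
    rw [map_add, map_smul, hγy, hyv, toR_ph]; simp)
  have hcj : ∀ j, |(c j : ℝ) - t * β j| ≤ 2 * q * t := by
    intro j
    have h1 := hc2 j
    have h2 : |γ j| ≤ q * t := (norm_le_pi_norm γ j).trans hγn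
    simp only [Pi.add_apply, Pi.smul_apply, smul_eq_mul] at h1
    calc |(c j : ℝ) - t * β j| = |((c j : ℝ) - (t * β j + γ j)) + γ j| := by ring_nf
      _ ≤ E + q * t := (abs_add_le _ _).trans (add_le_add h1 h2)
      _ ≤ _ := by linarith
  have hc0 : ∀ j, 0 ≤ c j := by
    intro j
    have h1 := (abs_le.1 (hcj j)).1
    have h2 : 2 * q * t ≤ t * β j := by
      have := hmβ j
      nlinarith
    have h3 : (0:ℝ) ≤ c j := by linarith
    exact_mod_cast h3
  have hcast : ∀ j, ((Int.toNat (c j) : ℕ) : ℤ) = c j := fun j => Int.toNat_of_nonneg (hc0 j)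
  have e : ph ζ (fun j => Int.toNat (c j)) = ph ζ b := by
    have e1 : ph ζ (fun j => Int.toNat (c j)) = ∑ j, c j • ζ j := by
      unfold ph
      refine Finset.sum_congr rfl fun j _ => ?_
      rw [← natCast_zsmul, hcast]
    rw [e1, hc1]
    unfold ph
    exact Finset.sum_congr rfl fun j _ => natCast_zsmul _ _
  have := hN t ht1 (fun j => Int.toNat (c j)) (fun j => by
    have h1 : ((Int.toNat (c j) : ℕ) : ℝ) = (c j : ℝ) := by exact_mod_cast hcast j
    rw [h1]
    refine (hcj j).trans ?_
    gcongr)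
  simp only [e] at this
  exact this

end lat
end RWRPX

namespace RWRPX
open RWRP
section det
variable {d : ℕ} {J : Type*} [Fintype J]

lemma lsx_near {ζ : J → Zd d} {w : Zd d → ℝ} {u : Fin d → ℝ} {a : ℝ} (h : LSX ζ w u a) {η : ℝ} (hη : 0 < η) :
    ∃ ε > (0:ℝ), (∃ N : ℝ, ∀ t ≥ N, ∀ b : J → ℕ,
      ‖toR (ph ζ b) - t • u‖ ≤ ε * t → |w (ph ζ b) - t * a| ≤ η * t) ∧
      ∀ (β : J → ℝ) (a' : ℝ), (∀ j, 0 ≤ β j) → LSP (fun b => w (ph ζ b)) β a' →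
        ‖Phi ζ β - u‖ ≤ ε / 2 → |a' - a| ≤ η := by
  obtain ⟨ε, hε, N, hN⟩ := h η hη
  refine ⟨ε, hε, ⟨N, hN⟩, fun β a' hβ hl hd => ?_⟩
  have ht := lsp_seq hl (fun n => fl β n) (fl_tendsto β hβ)
  refine le_of_tendsto ((ht.sub_const a).abs) ?_
  have h1 : Tendsto (fun n : ℕ => (fun j => (fl β n j : ℝ) / n)) atTop (𝓝 β) :=
    tendsto_pi_nhds.2 (fl_tendsto β hβ)
  have h2 := ((((Phi_cont ζ).tendsto β).comp h1).sub_const u).norm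
  have h3 : ‖Phi ζ β - u‖ < ε := by linarith
  filter_upwards [h2.eventually (gt_mem_nhds h3), eventually_gt_atTop 0,
    (tendsto_natCast_atTop_atTop (R := ℝ)).eventually_ge_atTop N] with n hn hn0 hnN
  have hn0' : (0:ℝ) < n := by exact_mod_cast hn0
  have e : toR (ph ζ (fl β n)) - (n:ℝ) • u = (n:ℝ) • (Phi ζ (fun j => (fl β n j : ℝ) / n) - u) := by
    rw [smul_sub, ← map_smul, toR_ph]
    congr 2
    ext j
    simp only [Pi.smul_apply, smul_eq_mul]
    field_simp
  have := hN n hnN (fl β n) (by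
    rw [e, norm_smul, Real.norm_of_nonneg hn0'.le, mul_comm]
    exact mul_le_mul_of_nonneg_right hn.le hn0'.le)
  have e2 : w (ph ζ (fl β n)) / n - a = (w (ph ζ (fl β n)) - n * a) / n := by field_simp
  rw [e2, abs_div, abs_of_pos hn0', div_le_iff₀ hn0']
  exact this

def Oc (ζ : J → Zd d) (ξ : Fin d → ℝ) : Prop := ∃ β : J → ℝ, (∀ j, 0 < β j) ∧ Phi ζ β = ξ

def aX (ζ : J → Zd d) (w : Zd d → ℝ) (ξ : Fin d → ℝ) : ℝ :=
  if h : Oc ζ ξ then al (fun b => w (ph ζ b)) h.choose else 0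

def Good (ζ : J → Zd d) (w : Zd d → ℝ) : Prop :=
  ∀ β : J → ℝ, (∀ j, 0 < β j) → LSP (fun b => w (ph ζ b)) β (al (fun b => w (ph ζ b)) β)

variable {ζ : J → Zd d} {w : Zd d → ℝ}

lemma Good.lsx (h : Good ζ w) {β : J → ℝ} (hβ : ∀ j, 0 < β j) :
    LSX ζ w (Phi ζ β) (al (fun b => w (ph ζ b)) β) := lsx_of_lsp hβ (h β hβ)

lemma Good.cons (h : Good ζ w) {β γ : J → ℝ} (hβ : ∀ j, 0 < β j) (hγ : ∀ j, 0 < γ j)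
    (e : Phi ζ β = Phi ζ γ) : al (fun b => w (ph ζ b)) β = al (fun b => w (ph ζ b)) γ := by
  rw [← sub_eq_zero, ← abs_nonpos_iff]
  refine le_of_forall_pos_le_add fun η hη => ?_
  obtain ⟨ε, hε, -, h2⟩ := lsx_near (h.lsx hγ) hη
  have := h2 β _ (fun j => (hβ j).le) (h β hβ) (by rw [e, sub_self, norm_zero]; positivity)
  linarith

lemma Good.aX_eq (h : Good ζ w) {β : J → ℝ} (hβ : ∀ j, 0 < β j) :
    aX ζ w (Phi ζ β) = al (fun b => w (ph ζ b)) β := by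
  have hO : Oc ζ (Phi ζ β) := ⟨β, hβ, rfl⟩
  unfold aX
  rw [dif_pos hO]
  exact h.cons hO.choose_spec.1 hβ hO.choose_spec.2

lemma Good.smul_pos (h : Good ζ w) {ξ : Fin d → ℝ} (hξ : Oc ζ ξ) {s : ℝ} (hs : 0 < s) :
    aX ζ w (s • ξ) = s * aX ζ w ξ := by
  obtain ⟨β, hβ, rfl⟩ := hξ
  have hsβ : ∀ j, 0 < (s • β) j := fun j => mul_pos hs (hβ j)
  rw [← map_smul, h.aX_eq hsβ, h.aX_eq hβ]
  exact lsp_al (fun j => (hsβ j).le) (lsp_smul hs (h β hβ))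

lemma Good.smul (h : Good ζ w) {ξ : Fin d → ℝ} (hξ : Oc ζ ξ) {s : ℝ} (hs : 0 ≤ s) :
    aX ζ w (s • ξ) = s * aX ζ w ξ := by
  rcases hs.lt_or_eq with h' | h'
  · exact h.smul_pos hξ h'
  · rw [← h', zero_smul, zero_mul]
    by_cases h0 : Oc ζ (0 : Fin d → ℝ)
    · have := h.smul_pos h0 (show (0:ℝ) < 2 by norm_num)
      rw [smul_zero] at this
      linarith
    · unfold aX; rw [dif_neg h0]

lemma Good.add (h : Good ζ w)
    (hs : ∀ β γ : J → ℝ, (∀ j, 0 < β j) → (∀ j, 0 < γ j) →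
      al (fun b => w (ph ζ b)) (β + γ) ≤ al (fun b => w (ph ζ b)) β + al (fun b => w (ph ζ b)) γ)
    {ξ χ : Fin d → ℝ} (hξ : Oc ζ ξ) (hχ : Oc ζ χ) :
    aX ζ w (ξ + χ) ≤ aX ζ w ξ + aX ζ w χ := by
  obtain ⟨β, hβ, rfl⟩ := hξ
  obtain ⟨γ, hγ, rfl⟩ := hχ
  rw [← map_add, h.aX_eq hβ, h.aX_eq hγ, h.aX_eq (β := β + γ) (fun j => add_pos (hβ j) (hγ j))]
  exact hs β γ hβ hγ

lemma Good.bound (h : Good ζ w) {c : J → ℝ} {K D : ℝ} (hc0 : ∀ j, 0 ≤ c j) (hK : 0 ≤ K)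
    (hu : ∀ β : J → ℝ, (∀ j, 0 < β j) → al (fun b => w (ph ζ b)) β ≤ ∑ j, β j * c j)
    (hl : ∀ β : J → ℝ, (∀ j, 0 < β j) → -(K * ∑ j, β j) ≤ al (fun b => w (ph ζ b)) β)
    (hD : ∀ β : J → ℝ, (∀ j, 0 ≤ β j) →
      ∃ γ : J → ℝ, (∀ j, 0 ≤ γ j) ∧ Phi ζ γ = Phi ζ β ∧ ∑ j, γ j ≤ D * n1 (Phi ζ β))
    {ξ : Fin d → ℝ} (hξ : Oc ζ ξ) : |aX ζ w ξ| ≤ (D * ∑ j, c j + K * D) * n1 ξ := by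
  obtain ⟨β, hβ, rfl⟩ := hξ
  obtain ⟨γ, hγ, hγe, hγs⟩ := hD β (fun j => (hβ j).le)
  set bs : ℕ → J → ℝ := fun n => γ + (1 / ((n:ℝ) + 1)) • (β - γ) with hbs
  have hn : ∀ n : ℕ, (0:ℝ) < 1 / ((n:ℝ)+1) ∧ 1 / ((n:ℝ)+1) ≤ 1 := fun n =>
    ⟨by positivity, by rw [div_le_one (by positivity)]; have : (0:ℝ) ≤ n := by positivity
                       linarith⟩
  have hpos : ∀ n j, 0 < bs n j := by
    intro n j
    simp only [hbs, Pi.add_apply, Pi.smul_apply, Pi.sub_apply, smul_eq_mul]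
    obtain ⟨h1, h2⟩ := hn n
    have h3 := mul_pos h1 (hβ j)
    have h4 := mul_nonneg (sub_nonneg.2 h2) (hγ j)
    nlinarith
  have hval : ∀ n, al (fun b => w (ph ζ b)) (bs n) = aX ζ w (Phi ζ β) := by
    intro n
    rw [h.aX_eq hβ]
    refine h.cons (hpos n) hβ ?_
    simp only [hbs]
    rw [map_add, map_smul, map_sub, hγe, sub_self, smul_zero, add_zero]
  have hlim : ∀ j, Tendsto (fun n => bs n j) atTop (𝓝 (γ j)) := by
    intro j
    have := (tendsto_one_div_add_atTop_nhds_zero_nat (𝕜 := ℝ)).mul_const (β j - γ j)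
    have := this.const_add (γ j)
    simpa [hbs] using this
  have hU : aX ζ w (Phi ζ β) ≤ ∑ j, γ j * c j := by
    refine ge_of_tendsto' (tendsto_finsetSum _ fun j _ => (hlim j).mul_const (c j)) fun n => ?_
    rw [← hval n]; exact hu _ (hpos n)
  have hL : -(K * ∑ j, γ j) ≤ aX ζ w (Phi ζ β) := by
    refine le_of_tendsto' (((tendsto_finsetSum Finset.univ fun j _ => hlim j).const_mul K).neg) fun n => ?_
    rw [← hval n]; exact hl _ (hpos n)
  have h1 : ∑ j, γ j * c j ≤ (∑ j, γ j) * ∑ j, c j := by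
    rw [Finset.sum_mul]
    refine Finset.sum_le_sum fun j _ => mul_le_mul_of_nonneg_left ?_ (hγ j)
    exact Finset.single_le_sum (fun i _ => hc0 i) (Finset.mem_univ j)
  have hcs : 0 ≤ ∑ j, c j := Finset.sum_nonneg fun j _ => hc0 j
  have hγ0 : 0 ≤ ∑ j, γ j := Finset.sum_nonneg fun j _ => hγ j
  have h2 := mul_le_mul_of_nonneg_right hγs hcs
  have h3 := mul_le_mul_of_nonneg_left hγs hK
  have h4 := mul_nonneg hγ0 hcs
  have h5 := mul_nonneg hK hγ0
  rw [abs_le]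
  constructor <;> nlinarith

lemma Good.shape (h : Good ζ w) {Kc : Set (Fin d → ℝ)} (hK : IsCompact Kc) (hKO : ∀ u ∈ Kc, Oc ζ u)
    {η : ℝ} (hη : 0 < η) : ∃ M : ℝ, ∀ b : J → ℕ, M ≤ n1Z (ph ζ b) →
      (n1Z (ph ζ b))⁻¹ • toR (ph ζ b) ∈ Kc →
      |w (ph ζ b) - aX ζ w (toR (ph ζ b))| ≤ η * n1Z (ph ζ b) := by
  have key : ∀ u : Kc, ∃ ε > (0:ℝ), ∃ N : ℝ, (∀ t ≥ N, ∀ b : J → ℕ,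
      ‖toR (ph ζ b) - t • u.1‖ ≤ ε * t → |w (ph ζ b) - t * aX ζ w u| ≤ η/2 * t) ∧
      ∀ v, Oc ζ v → ‖v - u‖ ≤ ε / 2 → |aX ζ w v - aX ζ w u| ≤ η/2 := by
    rintro ⟨u, hu⟩
    obtain ⟨β, hβ, rfl⟩ := hKO u hu
    obtain ⟨ε, hε, ⟨N, hN⟩, h2⟩ := lsx_near (h.lsx hβ) (half_pos hη)
    refine ⟨ε, hε, N, by simpa only [h.aX_eq hβ] using hN, ?_⟩
    rintro v ⟨γ, hγ, rfl⟩ hv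
    simp only [h.aX_eq hβ, h.aX_eq hγ]
    exact h2 γ _ (fun j => (hγ j).le) (h γ hγ) hv
  choose ε hε N hN hc using key
  obtain ⟨t, htc⟩ := hK.elim_nhds_subcover' (fun x hx => Metric.ball x (ε ⟨x, hx⟩ / 2))
    (fun x hx => Metric.ball_mem_nhds _ (half_pos (hε _)))
  refine ⟨max 1 (∑ u ∈ t, |N u|), fun b hb hbK => ?_⟩
  set s := n1Z (ph ζ b) with hs
  have hs1 : 1 ≤ s := le_trans (le_max_left _ _) hb
  have hs0 : 0 < s := by linarith
  set v := s⁻¹ • toR (ph ζ b) with hv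
  have ev : toR (ph ζ b) = s • v := by rw [hv, smul_smul, mul_inv_cancel₀ hs0.ne', one_smul]
  obtain ⟨u, hut, hu⟩ : ∃ u ∈ t, v ∈ Metric.ball u.1 (ε u / 2) := by
    simpa using htc hbK
  have hd : ‖v - u.1‖ ≤ ε u / 2 := by rw [← dist_eq_norm]; exact (Metric.mem_ball.1 hu).le
  have hNs : N u ≤ s := by
    refine (le_abs_self _).trans (le_trans ?_ ((le_max_right _ _).trans hb))
    exact Finset.single_le_sum (f := fun u => |N u|) (fun _ _ => abs_nonneg _) hut
  have h1 := hN u s hNs b (by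
    rw [ev, ← smul_sub, norm_smul, Real.norm_of_nonneg hs0.le, mul_comm]
    refine mul_le_mul_of_nonneg_right ?_ hs0.le
    have := hε u
    linarith)
  have h2 := hc u v (hKO v hbK) hd
  rw [ev, h.smul_pos (hKO v hbK) hs0]
  have h3 : |s * aX ζ w v - s * aX ζ w u| ≤ η/2 * s := by
    rw [← mul_sub, abs_mul, abs_of_pos hs0, mul_comm]
    exact mul_le_mul_of_nonneg_right h2 hs0.le
  rw [abs_le] at *
  constructor <;> linarith [h1.1, h1.2, h3.1, h3.2]

end det
end RWRPX

namespace RWRPX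
open RWRP
section face
variable {d : ℕ} {R : Finset (Zd d)} {A : Set (Fin d → ℝ)}

lemma Cp_add {x y : Fin d → ℝ} (hx : x ∈ Cp R) (hy : y ∈ Cp R) : x + y ∈ Cp R := by
  obtain ⟨b, hb, rfl⟩ := hx
  obtain ⟨c, hc, rfl⟩ := hy
  refine ⟨b + c, fun z => add_nonneg (hb z) (hc z), ?_⟩
  simp [add_smul, Finset.sum_add_distrib]

lemma Cp_smul {x : Fin d → ℝ} (hx : x ∈ Cp R) {s : ℝ} (hs : 0 ≤ s) : s • x ∈ Cp R := by
  obtain ⟨b, hb, rfl⟩ := hx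
  refine ⟨s • b, fun z => mul_nonneg hs (hb z), ?_⟩
  rw [Finset.smul_sum]
  simp [smul_smul]

lemma Cp_zero : (0 : Fin d → ℝ) ∈ Cp R := ⟨0, fun _ => le_rfl, by simp⟩

lemma Cp_step {z : Zd d} (hz : z ∈ R) : toR z ∈ Cp R := by
  refine ⟨Pi.single z 1, fun y => ?_, ?_⟩
  · by_cases h : y = z
    · subst h; simp
    · simp [h]
  · rw [Finset.sum_eq_single z]
    · simp
    · intro y _ h; simp [h]
    · intro h; exact absurd hz h

lemma face_part (hA : IsFace (Cp R) A) {ξ x y : Fin d → ℝ} (hξ : ξ ∈ A) (hx : x ∈ Cp R) (hy : y ∈ Cp R)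
    {s : ℝ} (hs : 0 < s) (e : ξ = s • x + y) : x ∈ A := by
  set t := min s (1/2) with ht
  have ht0 : 0 < t := lt_min hs (by norm_num)
  have hts : t ≤ s := min_le_left _ _
  have ht1 : t ≤ 1/2 := min_le_right _ _
  have h1 : 0 < 1 - t := by linarith
  refine (hA.2.2 (ζ := x) (η := (1-t)⁻¹ • ((s - t) • x + y)) (t := t) hξ hx
    (Cp_smul (Cp_add (Cp_smul hx (by linarith)) hy) (inv_nonneg.2 h1.le)) ⟨ht0, by linarith⟩ ?_).1
  rw [smul_smul, mul_inv_cancel₀ h1.ne', one_smul, ← add_assoc, ← add_smul, e]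
  congr 2; ring

variable {S : Finset (Zd d)}

/-- data of a face -/
structure FD (R : Finset (Zd d)) (A : Set (Fin d → ℝ)) (S : Finset (Zd d)) : Prop where
  face : IsFace (Cp R) A
  hS : ∀ z, z ∈ S ↔ z ∈ R ∧ z ≠ 0 ∧ toR z ∈ A
  ne : ∃ z, z ∈ S




lemma FD.zero (F : FD R A S) : (0 : Fin d → ℝ) ∈ A := by
  obtain ⟨z, hz⟩ := F.ne
  have h := (F.hS z).1 hz
  exact face_part F.face h.2.2 Cp_zero (Cp_step h.1) one_pos (by simp)

lemma FD.smul (F : FD R A S) {ξ : Fin d → ℝ} (hξ : ξ ∈ A) {s : ℝ} (hs : 0 ≤ s) : s • ξ ∈ A := by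
  rcases hs.lt_or_eq with h | h
  · exact face_part F.face hξ (Cp_smul (F.face.1 hξ) hs) Cp_zero (inv_pos.2 h)
      (by rw [smul_smul, inv_mul_cancel₀ h.ne', one_smul, add_zero])
  · rw [← h, zero_smul]; exact F.zero

lemma FD.add (F : FD R A S) {ξ χ : Fin d → ℝ} (hξ : ξ ∈ A) (hχ : χ ∈ A) : ξ + χ ∈ A := by
  have h := F.smul (F.face.2.1 hξ hχ (show (0:ℝ) ≤ 1/2 by norm_num) (show (0:ℝ) ≤ 1/2 by norm_num) (by norm_num))
    (show (0:ℝ) ≤ 2 by norm_num)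
  rw [smul_add, smul_smul, smul_smul] at h
  norm_num at h
  exact h

lemma FD.Phi_mem (F : FD R A S) (β : S → ℝ) (hβ : ∀ j, 0 ≤ β j) : Phi (Subtype.val : S → Zd d) β ∈ A := by
  rw [Phi_apply]
  refine Finset.sum_induction _ (· ∈ A) (fun _ _ => F.add) F.zero fun j _ => ?_
  exact F.smul ((F.hS j).1 j.2).2.2 (hβ j)

lemma FD.coef (F : FD R A S) {b : Zd d → ℝ} (hb : ∀ z, 0 ≤ b z) (h : ∑ z ∈ R, b z • toR z ∈ A) {z : Zd d} (hz : z ∈ R)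
    (hzS : z ∉ S) : b z = 0 ∨ z = 0 := by
  by_contra hcon
  push Not at hcon
  refine hzS ((F.hS z).2 ⟨hz, hcon.2, ?_⟩)
  refine face_part F.face h (Cp_step hz) (y := ∑ y ∈ R.erase z, b y • toR y) ?_
    (lt_of_le_of_ne (hb z) hcon.1.symm) ?_
  · refine Finset.sum_induction _ (· ∈ Cp R) (fun _ _ => Cp_add) Cp_zero fun y hy => ?_
    exact Cp_smul (Cp_step (Finset.mem_of_mem_erase hy)) (hb y)
  · rw [Finset.add_sum_erase R (fun z => b z • toR z) hz]

lemma FD.sub (F : FD R A S) : S ⊆ R := fun z hz => ((F.hS z).1 hz).1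

lemma FD.rep (F : FD R A S) {ξ : Fin d → ℝ} (hξ : ξ ∈ A) :
    ∃ β : S → ℝ, (∀ j, 0 ≤ β j) ∧ Phi (Subtype.val : S → Zd d) β = ξ := by
  obtain ⟨b, hb, rfl⟩ := F.face.1 hξ
  refine ⟨fun j => b j, fun j => hb j, ?_⟩
  rw [Phi_apply, Finset.sum_coe_sort S (fun z => b z • toR z)]
  refine Finset.sum_subset F.sub fun z hz hzS => ?_
  rcases F.coef hb hξ hz hzS with h | h
  · rw [h, zero_smul]
  · rw [h, toR_zero, smul_zero]

lemma FD.repZ (F : FD R A S) {x : Zd d} (hx : x ∈ Gp R) (hxA : toR x ∈ A) :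
    ∃ b : S → ℕ, ph (Subtype.val : S → Zd d) b = x := by
  obtain ⟨b, rfl⟩ := hx
  refine ⟨fun j => b j, ?_⟩
  unfold ph
  rw [Finset.sum_coe_sort S (fun z => b z • z)]
  have e : toR (∑ z ∈ R, b z • z) = ∑ z ∈ R, (b z : ℝ) • toR z := by
    ext i; simp [toR, Finset.sum_apply]
  rw [e] at hxA
  refine Finset.sum_subset F.sub fun z hz hzS => ?_
  rcases F.coef (b := fun z => (b z : ℝ)) (fun z => by positivity) hxA hz hzS with h | h
  · have : b z = 0 := by exact_mod_cast h
    rw [this, zero_smul]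
  · rw [h, smul_zero]

lemma FD.oc (F : FD R A S) {ξ : Fin d → ℝ} (hξ : ξ ∈ intrinsicInterior ℝ A) : Oc (Subtype.val : S → Zd d) ξ := by
  set σ := Phi (Subtype.val : S → Zd d) 1 with hσ
  have hσA : σ ∈ A := F.Phi_mem _ fun _ => zero_le_one
  obtain ⟨ε, hε, h⟩ := ii_line hξ (subset_affineSpan ℝ A hσA)
  have h1 := h (-(ε/2)) (by rw [abs_neg, abs_of_pos (half_pos hε)]; linarith)
  obtain ⟨β, hβ, e⟩ := F.rep h1
  have hp : 0 < 1 + ε/2 := by linarith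
  refine ⟨(1 + ε/2)⁻¹ • (β + (ε/2) • (1 : S → ℝ)), fun j => ?_, ?_⟩
  · have := hβ j
    simp only [Pi.smul_apply, Pi.add_apply, smul_eq_mul, Pi.one_apply]
    positivity
  · rw [map_smul, map_add, map_smul, e, ← hσ, inv_smul_eq_iff₀ hp.ne']
    module


lemma FD.compact (F : FD R A S) (δ : ℝ) : IsCompact {u : Fin d → ℝ | u ∈ A ∧ n1 u = 1 ∧
    ENNReal.ofReal δ ≤ ⨅ (η : Fin d → ℝ) (_ : η ∈ A \ intrinsicInterior ℝ A), ENNReal.ofReal (n1 (u - η))} := by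
  obtain ⟨D, hD0, hD⟩ := bdd_coef (Subtype.val : S → Zd d)
  set B : Set (S → ℝ) := Set.Icc 0 (fun _ => D) with hB
  have hBc : IsCompact B := isCompact_Icc
  have hIm := hBc.image (Phi_cont (Subtype.val : S → Zd d))
  have hcl : IsClosed {u : Fin d → ℝ | n1 u = 1 ∧ ENNReal.ofReal δ ≤
      ⨅ (η : Fin d → ℝ) (_ : η ∈ A \ intrinsicInterior ℝ A), ENNReal.ofReal (n1 (u - η))} := by
    rw [Set.setOf_and]
    refine (isClosed_eq n1_cont continuous_const).inter ?_
    simp only [le_iInf_iff, Set.setOf_forall]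
    refine isClosed_iInter fun η => isClosed_iInter fun _ => ?_
    exact isClosed_le continuous_const
      (ENNReal.continuous_ofReal.comp (n1_cont.comp (continuous_id.sub continuous_const)))
  convert hIm.inter_right hcl using 1
  ext u
  constructor
  · rintro ⟨h1, h2, h3⟩
    refine ⟨?_, h2, h3⟩
    obtain ⟨β, hβ, e⟩ := F.rep h1
    obtain ⟨γ, hγ, e2, hs⟩ := hD β hβ
    rw [e, h2, mul_one] at hs
    refine ⟨γ, ⟨hγ, fun j => le_trans ?_ hs⟩, e2.trans e⟩
    exact Finset.single_le_sum (fun i _ => hγ i) (Finset.mem_univ j)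
  · rintro ⟨⟨β, hβ, rfl⟩, h2, h3⟩
    exact ⟨F.Phi_mem _ hβ.1, h2, h3⟩

lemma FD.shape (F : FD R A S) {w : Zd d → ℝ} (h : Good (Subtype.val : S → Zd d) w) {δ ε : ℝ} (hδ : 0 < δ) (hε : 0 < ε) :
    ∃ M : ℝ, ∀ x ∈ Gp R, toR x ∈ faceDelta A δ → M ≤ n1Z x →
      |w x - aX (Subtype.val : S → Zd d) w (toR x)| ≤ ε * n1Z x := by
  obtain ⟨M, hM⟩ := h.shape (F.compact δ) (fun u hu => F.oc (by
    by_contra hcon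
    have h1 := hu.2.2.trans (iInf₂_le u ⟨hu.1, hcon⟩)
    rw [sub_self, n1_zero_iff.2 rfl, ENNReal.ofReal_zero, nonpos_iff_eq_zero, ENNReal.ofReal_eq_zero] at h1
    linarith)) hε
  refine ⟨M, fun x hx hxA hMx => ?_⟩
  obtain ⟨b, rfl⟩ := F.repZ hx hxA.1
  have hp : 0 < n1Z (ph (Subtype.val : S → Zd d) b) := by
    refine lt_of_le_of_ne (n1_nonneg _) fun h0 => hxA.2.1 (n1_zero_iff.1 h0.symm)
  refine hM b hMx ⟨F.smul hxA.1 (inv_nonneg.2 hp.le), ?_, hxA.2.2⟩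
  rw [n1_smul _ (inv_nonneg.2 hp.le)]
  exact inv_mul_cancel₀ hp.ne'

end face

section gp
variable {d : ℕ}
lemma ph_Gp {S R : Finset (Zd d)} (h : S ⊆ R) (b : S → ℕ) : ph (Subtype.val : S → Zd d) b ∈ Gp R := by
  refine ⟨fun z => if h : z ∈ S then b ⟨z, h⟩ else 0, ?_⟩
  rw [← Finset.sum_subset h (fun z _ hz => by simp [hz])]
  unfold ph
  rw [← Finset.sum_coe_sort S]
  exact Finset.sum_congr rfl fun j _ => by simp
end gp
end RWRPX

namespace RWRPX
open RWRP
section cl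
variable {d : ℕ} {Ω : Type*} {T : Zd d → Ω → Ω}

lemma classL_unpack {g : Ω → ℝ} (hg : ∀ ω, 0 ≤ g ω) {z : Zd d} {R' : Finset (Zd d)} {ω : Ω}
    (h : (⨅ ε : {e : ℝ // 0 < e},
      Filter.limsup (fun n : ℕ =>
        ⨆ (x : Zd d) (_ : x ∈ Gp R' ∧ n1Z x ≤ n),
          (n : ℝ≥0∞)⁻¹ *
            ∑ k ∈ Finset.range (⌊(ε : ℝ) * n⌋₊ + 1), ENNReal.ofReal (g (T (x + k • z) ω)))
        Filter.atTop) = 0) {η : ℝ} (hη : 0 < η) :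
    ∃ ε > (0:ℝ), ∃ N : ℕ, ∀ n ≥ N, ∀ x ∈ Gp R', n1Z x ≤ n →
      ∑ k ∈ Finset.range (⌊ε * n⌋₊ + 1), g (T (x + k • z) ω) ≤ η * n := by
  have h1 : (⨅ ε : {e : ℝ // 0 < e},
      Filter.limsup (fun n : ℕ =>
        ⨆ (x : Zd d) (_ : x ∈ Gp R' ∧ n1Z x ≤ n),
          (n : ℝ≥0∞)⁻¹ *
            ∑ k ∈ Finset.range (⌊(ε : ℝ) * n⌋₊ + 1), ENNReal.ofReal (g (T (x + k • z) ω)))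
        Filter.atTop) < ENNReal.ofReal η := by
    rw [h]; exact ENNReal.ofReal_pos.2 hη
  obtain ⟨⟨ε, hε⟩, h2⟩ := iInf_lt_iff.1 h1
  obtain ⟨N, hN⟩ := eventually_atTop.1 (Filter.eventually_lt_of_limsup_lt h2)
  refine ⟨ε, hε, max N 1, fun n hn x hx hxn => ?_⟩
  have hn0 : 0 < n := lt_of_lt_of_le one_pos ((le_max_right _ _).trans hn)
  have hn0' : (0:ℝ) < n := by exact_mod_cast hn0
  have h3 := hN n ((le_max_left _ _).trans hn)
  have h4 := lt_of_le_of_lt (le_iSup₂ (f := fun (x : Zd d) (_ : x ∈ Gp R' ∧ n1Z x ≤ n) => (n : ℝ≥0∞)⁻¹ *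
            ∑ k ∈ Finset.range (⌊ε * n⌋₊ + 1), ENNReal.ofReal (g (T (x + k • z) ω))) x ⟨hx, hxn⟩) h3
  rw [← ENNReal.ofReal_sum_of_nonneg (fun _ _ => hg _), ← ENNReal.ofReal_natCast n,
    ← ENNReal.ofReal_inv_of_pos hn0', ← ENNReal.ofReal_mul (by positivity),
    ENNReal.ofReal_lt_ofReal_iff hη, inv_mul_lt_iff₀ hn0'] at h4
  linarith

variable {J : Type*} [Fintype J]

lemma n1Z_ph (ζ : J → Zd d) : ∃ D : ℕ, 0 < D ∧ ∀ b : J → ℕ, n1Z (ph ζ b) ≤ D * ∑ j, (b j : ℝ) := by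
  have hadd : ∀ x y : Fin d → ℝ, n1 (x + y) ≤ n1 x + n1 y := by
    intro x y
    unfold n1
    rw [← Finset.sum_add_distrib]
    exact Finset.sum_le_sum fun i _ => abs_add_le _ _
  obtain ⟨D, hD⟩ := exists_nat_ge (∑ j, n1 (toR (ζ j)))
  refine ⟨D + 1, by omega, fun b => ?_⟩
  unfold n1Z
  rw [toR_ph, Phi_apply, Finset.mul_sum]
  have h0 : n1 (0 : Fin d → ℝ) = 0 := n1_zero_iff.2 rfl
  refine (Finset.le_sum_of_subadditive n1 h0.le hadd _ _).trans (Finset.sum_le_sum fun j _ => ?_)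
  rw [n1_smul _ (by positivity), mul_comm]
  refine mul_le_mul_of_nonneg_right ?_ (by positivity)
  have := Finset.single_le_sum (f := fun j => n1 (toR (ζ j))) (fun i _ => n1_nonneg _) (Finset.mem_univ j)
  push_cast
  linarith

lemma cL_of [MeasurableSpace Ω] {μ : Measure Ω} (ζ : J → Zd d) {g : J → Ω → ℝ} (hg : ∀ j ω, 0 ≤ g j ω)
    {R' : Finset (Zd d)} (hR : ∀ b : J → ℕ, ph ζ b ∈ Gp R')
    (h : ∀ j, classL μ T (g j) (ζ j) R') :
    ∀ᵐ ω ∂μ, ∀ η > (0:ℝ), ∃ ε > (0:ℝ), ∃ N : ℕ, ∀ n ≥ N, ∀ j, ∀ b : J → ℕ, ∑ i, b i ≤ n →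
    ∑ k ∈ Finset.range (⌊ε * n⌋₊ + 1), g j (T (ph ζ b + k • ζ j) ω) ≤ η * n := by
  obtain ⟨D, hD0, hD⟩ := n1Z_ph ζ
  have hD0' : (0:ℝ) < D := by exact_mod_cast hD0
  filter_upwards [ae_all_iff.2 h] with ω hω η hη
  have key := fun j => classL_unpack (hg j) (hω j) (div_pos hη hD0')
  choose ε hε N hN using key
  obtain ⟨m, hm, hmε⟩ : ∃ m > (0:ℝ), ∀ j, m ≤ ε j := by
    by_cases hne : Nonempty J
    · obtain ⟨j0, h0⟩ := Finite.exists_min ε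
      exact ⟨ε j0, hε j0, h0⟩
    · exact ⟨1, one_pos, fun j => absurd ⟨j⟩ hne⟩
  refine ⟨m, hm, ∑ j, N j, fun n hn j b hb => ?_⟩
  have h1 : N j ≤ D * n := by
    have h2 := Finset.single_le_sum (f := N) (fun i _ => Nat.zero_le _) (Finset.mem_univ j)
    calc N j ≤ n := h2.trans hn
      _ ≤ D * n := Nat.le_mul_of_pos_left _ hD0
  have h2 := hN j (D * n) h1 (ph ζ b) (hR b) (by
    refine (hD b).trans ?_
    push_cast
    refine mul_le_mul_of_nonneg_left ?_ hD0'.le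
    exact_mod_cast hb)
  have e : η / D * ((D * n : ℕ) : ℝ) = η * n := by push_cast; field_simp
  rw [e] at h2
  refine le_trans (Finset.sum_le_sum_of_subset_of_nonneg ?_ fun _ _ _ => hg j _) h2
  refine Finset.range_mono ?_
  have : m * n ≤ ε j * ((D * n : ℕ) : ℝ) := by
    push_cast
    have h3 : (1:ℝ) ≤ D := by exact_mod_cast hD0
    calc m * n ≤ ε j * n := mul_le_mul_of_nonneg_right (hmε j) (by positivity)
      _ ≤ ε j * (D * n) := by
        refine mul_le_mul_of_nonneg_left ?_ (hε j).le
        exact le_mul_of_one_le_left (by positivity) h3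
  have := Nat.floor_mono this
  show _ + 1 ≤ _ + 1
  omega

end cl

section asm
variable {d : ℕ} {Ω : Type*} [MeasurableSpace Ω]

lemma mkProc {μ : Measure Ω} [IsProbabilityMeasure μ] {T : Zd d → Ω → Ω} {R : Finset (Zd d)} {V V' : Ω → Zd d → ℝ}
    (hTm : ∀ z, Measurable (T z)) (hT0 : T 0 = id) (hTa : ∀ x y, T (x + y) = T x ∘ T y)
    (hmp : ∀ z, MeasurePreserving (T z) μ μ) (hVm : ∀ z, Measurable fun ω => V ω z)
    (hV1 : VplusL1 μ V R) {L : Zd d →+ ℝ} (hL0 : ∀ z ∈ R, 0 ≤ L z)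
    (hV' : V' = fun ω z => max (V ω z) (-L z))
    {S R' : Finset (Zd d)} (hSR : S ⊆ R) (hSR' : S ⊆ R')
    (hL : ∀ z ∈ S, classL μ T (fun ω => max (V ω z) 0) z R') :
    Proc μ T (Subtype.val : S → Zd d)
      (fun ω b => aInf T V' R ω 0 (ph (Subtype.val : S → Zd d) b))
      (fun j ω => max (V ω j) 0) (∑ z ∈ R, L z) where
  mp := hmp
  T0 := hT0
  Tadd := hTa
  Wm b := aInf_meas hTm (fun z => by rw [hV']; exact (hVm z).max measurable_const) _
  W0 ω := by simp only [ph_zero, aInf_zero]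
  Wsub ω b c := by
    simp only [ph_add]
    exact aInf_sub (L := L) hTa (fun ω z _ => by rw [hV']; exact le_max_right _ _) ω (ph_Gp hSR b) (ph_Gp hSR c)
  Wlow ω b := by
    refine le_trans (neg_le_neg ?_) (aInf_low (L := L) (fun ω z _ => by rw [hV']; exact le_max_right _ _) ω (ph_Gp hSR b))
    unfold ph
    rw [map_sum, Finset.mul_sum]
    refine Finset.sum_le_sum fun j _ => ?_
    rw [map_nsmul, nsmul_eq_mul, mul_comm]
    refine mul_le_mul_of_nonneg_right ?_ (by positivity)
    exact Finset.single_le_sum (f := fun z => L z) hL0 (hSR j.2)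
  Wone ω j := by
    simp only [ph_single, one_smul]
    refine (aInf_one (L := L) hT0 (fun ω z _ => by rw [hV']; exact le_max_right _ _) ω (hSR j.2)).trans ?_
    rw [hV']
    exact max_le_max le_rfl (neg_nonpos.2 (hL0 _ (hSR j.2)))
  gm j := (hVm j).max measurable_const
  g0 j ω := le_max_right _ _
  gi j := hV1 j (hSR j.2)
  K0 := Finset.sum_nonneg hL0
  cL := cL_of _ (fun j ω => le_max_right _ _) (fun b => ph_Gp hSR' b) (fun j => hL j j.2)

end asm
end RWRPX

open RWRP in
/-- shape theorem for the zero-temperature quantity `a_∞` and `α_∞`. -/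
theorem statement1
    {d : ℕ} {Ω : Type*} [MeasurableSpace Ω]
    (ℙ : Measure Ω) [IsProbabilityMeasure ℙ]
    (T : Zd d → Ω → Ω) (R : Finset (Zd d)) (V : Ω → Zd d → ℝ) (p : Zd d → ℝ)
    (hset : Setting ℙ T R V p)
    (hV1 : VplusL1 ℙ V R)
    (U₀ : Set (Fin d → ℝ)) (hU₀ : IsZeroFace R U₀)
    (hi : AssumptionI ℙ V R U₀)
    (A : Set (Fin d → ℝ)) (hA : IsFace (Cp R) A) (hAne : A ≠ {0})
    (R' : Finset (Zd d)) (hR' : ∀ z, z ∈ R' ↔ z ∈ R ∧ toR z ∈ A)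
    (hL : ∀ z ∈ R', z ≠ 0 → classL ℙ T (fun ω => max (V ω z) 0) z R')
    (hL0 : ∃ zh ∈ R', zh ≠ 0 ∧ classL ℙ T (fun ω => max (V ω 0) 0) zh R')
    :
    ∃ (αI : Ω → (Fin d → ℝ) → ℝ) (C : Ω → ℝ),
      (∀ ξ, Measurable fun ω => αI ω ξ) ∧ Measurable C ∧ Integrable C ℙ ∧
      (∀ᵐ ω ∂ℙ,
        0 < C ω ∧
        (∀ ξ ∈ intrinsicInterior ℝ A, |αI ω ξ| ≤ C ω * n1 ξ) ∧
        (∀ s : ℝ, 0 ≤ s → ∀ ξ ∈ intrinsicInterior ℝ A, αI ω (s • ξ) = s * αI ω ξ) ∧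
        (∀ ξ ∈ intrinsicInterior ℝ A, ∀ ζ ∈ intrinsicInterior ℝ A,
          αI ω (ξ + ζ) ≤ αI ω ξ + αI ω ζ) ∧
        (∀ δ > (0:ℝ), ∀ ε > (0:ℝ), ∃ M : ℝ, ∀ x ∈ Gp R, toR x ∈ faceDelta A δ →
          M ≤ n1Z x → |aInf T V R ω 0 x - αI ω (toR x)| ≤ ε * n1Z x)) ∧
      (ErgodicUnder ℙ T {z | z ∈ R ∧ toR z ∈ A} →
        ∃ α₀ : (Fin d → ℝ) → ℝ,
          ∀ᵐ ω ∂ℙ, ∀ ξ ∈ intrinsicInterior ℝ A, αI ω ξ = α₀ ξ) := by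
  obtain ⟨hTm, hT0, hTa, hmp, -, hVm, -, -⟩ := hset
  obtain ⟨L, hLn, hLV⟩ := RWRPX.exists_L hU₀ hi
  set S : Finset (Zd d) := R'.erase 0 with hSdef
  have hSm : ∀ z, z ∈ S ↔ z ∈ R ∧ z ≠ 0 ∧ toR z ∈ A := by
    intro z
    rw [hSdef, Finset.mem_erase, hR']
    tauto
  have F : RWRPX.FD R A S := by
    obtain ⟨zh, h1, h2, -⟩ := hL0
    exact ⟨hA, hSm, zh, by rw [hSdef]; exact Finset.mem_erase.2 ⟨h2, h1⟩⟩
  set V' : Ω → Zd d → ℝ := fun ω z => max (V ω z) (-L z) with hV'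
  have P := RWRPX.mkProc hTm hT0 hTa hmp hVm hV1 hLn hV' F.sub (Finset.erase_subset 0 R')
    (fun z hz => hL z (Finset.mem_of_mem_erase hz) ((hSm z).1 hz).2.1)
  set ζ : S → Zd d := Subtype.val with hζ
  set w : Ω → Zd d → ℝ := fun ω y => aInf T V' R ω 0 y with hw
  obtain ⟨D, hD0, hD⟩ := RWRPX.bdd_coef ζ
  set K : ℝ := ∑ z ∈ R, L z with hK
  set cc : S → Ω → ℝ := RWRPX.Cc ℙ T ζ (fun j ω => max (V ω j) 0) with hcc
  set C : Ω → ℝ := fun ω => D * ∑ j, |cc j ω| + K * D + 1 with hC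
  have hcm : ∀ j, Measurable (cc j) := fun j => RWRPX.Cc_meas j
  have hci : ∀ j, Integrable (cc j) ℙ := fun j => RWRPX.Cc_int j
  have hK0 : 0 ≤ K := P.K0
  have hgood : ∀ᵐ ω ∂ℙ, RWRPX.Good ζ (w ω) := P.lsp
  refine ⟨fun ω ξ => RWRPX.aX ζ (w ω) ξ, C, fun ξ => ?_, ?_, ?_, ?_, fun he => ?_⟩
  · by_cases h : RWRPX.Oc ζ ξ
    · simp only [RWRPX.aX, dif_pos h]
      exact P.al_meas _
    · simp only [RWRPX.aX, dif_neg h]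
      exact measurable_const
  · refine ((Measurable.const_mul (Finset.measurable_sum _ fun j _ => ?_) D).add_const _).add_const _
    exact (hcm j).norm
  · refine Integrable.add (Integrable.add (Integrable.const_mul (integrable_finsetSum _ fun j _ => (hci j).norm) D) (integrable_const _)) (integrable_const _)
  · have hcong : ∀ᵐ ω ∂ℙ, ∀ x, ∀ z ∈ R, V (T x ω) z = V' (T x ω) z := by
      rw [ae_all_iff]
      intro x
      have h1 : ∀ᵐ ω ∂ℙ, ∀ z ∈ R, V ω z = V' ω z := by
        rw [ae_all_iff]
        intro z
        by_cases hz : z ∈ R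
        · filter_upwards [hLV z hz] with ω hω _
          exact (max_eq_left hω).symm
        · exact Eventually.of_forall fun _ h => absurd h hz
      exact (hmp x).quasiMeasurePreserving.ae h1
    filter_upwards [hgood, P.subadd, P.upper, P.lower, ae_all_iff.2 P.Cc_nonneg, hcong] with ω hg hs hu hl hc0 hcg
    have hsum : 0 ≤ ∑ j, |cc j ω| := Finset.sum_nonneg fun j _ => abs_nonneg _
    refine ⟨by positivity, fun ξ hξ => ?_, fun s hs0 ξ hξ => hg.smul (F.oc hξ) hs0,
      fun ξ hξ χ hχ => hg.add hs (F.oc hξ) (F.oc hχ), fun δ hδ ε hε => ?_⟩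
    · refine (hg.bound hc0 hK0 hu hl hD (F.oc hξ)).trans ?_
      refine mul_le_mul_of_nonneg_right ?_ (RWRPX.n1_nonneg ξ)
      have e : ∑ j, |cc j ω| = ∑ j, cc j ω := Finset.sum_congr rfl fun j _ => abs_of_nonneg (hc0 j)
      simp only [hC]
      rw [e]
      linarith
    · obtain ⟨M, hM⟩ := F.shape hg hδ hε
      refine ⟨M, fun x hx hxA hMx => ?_⟩
      rw [RWRPX.aInf_congr hcg x]
      exact hM x hx hxA hMx
  · have he' : ErgodicUnder ℙ T (Set.range ζ) := by
      intro E hE hinv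
      refine he E hE fun z hz => ?_
      by_cases h0 : z = 0
      · rw [h0, hT0]; rfl
      · exact hinv z ⟨⟨z, (hSm z).2 ⟨hz.1, h0, hz.2⟩⟩, rfl⟩
    obtain ⟨c, hc⟩ := P.erg he'
    refine ⟨fun ξ => if h : RWRPX.Oc ζ ξ then limsup (fun n => c (RWRPX.ap h.choose n)) atTop else 0, ?_⟩
    filter_upwards [hgood, hc] with ω hg hcω ξ hξ
    have hO : RWRPX.Oc ζ ξ := F.oc hξ
    simp only [RWRPX.aX, dif_pos hO]
    have ht := RWRPX.lsp_cont_seq hg hO.choose_spec.1 _ (fun n => RWRPX.rq_pos _)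
      (RWRPX.ap_tendsto _ hO.choose_spec.1)
    rw [← ht.limsup_eq]
    congr 1
    ext n
    exact hcω _
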